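/- arXiv:2112.14960 — 3 statements merged into one kernel-verified Lean document; each statement's English description precedes it below -/
import Mathlib

section
/- For all integers n = m ≥ 5, the bipartite Ramsey number br(C_{2n}, C_{2n}) equals 2n; that is, 2n is the minimum N such that every red/blue edge-coloring of K_{N,N} contains a monochromatic C_{2n}. -/
def hasCycleLength {V : Type*} (G : SimpleGraph V) (l : ℕ) : Prop :=
  ∃ (v : V) (p : G.Walk v v), p.IsCycle ∧ p.length = l

/-- `AltPath r u v k A Z`: there is a path from `u` to `v` in the bipartite graph of `r` that
alternates between `k` vertices of `A` and `k - 1` vertices of `Z`. -/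
inductive AltPath {α β : Type*} (r : α → β → Prop) : α → α → ℕ → Set α → Set β → Prop
  | single {u : α} {A : Set α} {Z : Set β} (hu : u ∈ A) : AltPath r u u 1 A Z
  | cons {u u' v : α} {z : β} {k : ℕ} {A : Set α} {Z : Set β} (hu : u ∈ A) (hz : z ∈ Z)
      (h : r u z) (h' : r u' z) (hp : AltPath r u' v k (A \ {u}) (Z \ {z})) :
      AltPath r u v (k + 1) A Z

/-- The bipartite graph of `r` contains a cycle through `k` vertices of each side. -/
def HasAltCycle {α β : Type*} (r : α → β → Prop) (k : ℕ) : Prop :=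
  ∃ (u v : α) (z : β) (A : Set α) (Z : Set β),
    AltPath r u v k A Z ∧ z ∉ Z ∧ r u z ∧ r v z ∧ 2 ≤ k

/-- The vertices `w 0, z 0, w 1, …, z (t - 1), w t` form a path in the bipartite graph of `r`. -/
structure IsAltPath {α β : Type*} (r : α → β → Prop) (w : ℕ → α) (z : ℕ → β) (t : ℕ) : Prop where
  left : ∀ i < t, r (w i) (z i)
  right : ∀ i < t, r (w (i + 1)) (z i)
  injw : ∀ i ≤ t, ∀ j ≤ t, w i = w j → i = j
  injz : ∀ i < t, ∀ j < t, z i = z j → i = j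

section Basic

variable {α β : Type*} {r : α → β → Prop}

namespace AltPath

theorem mono {u v : α} {k : ℕ} {A A' : Set α} {Z Z' : Set β} (h : AltPath r u v k A Z)
    (hA : A ⊆ A') (hZ : Z ⊆ Z') : AltPath r u v k A' Z' := by
  induction h generalizing A' Z' with
  | single hu => exact .single (hA hu)
  | cons hu hz h h' _ ih =>
    exact .cons (hA hu) (hZ hz) h h' (ih (Set.sdiff_subset_sdiff_left hA)
      (Set.sdiff_subset_sdiff_left hZ))

theorem mono_rel {s : α → β → Prop} {u v : α} {k : ℕ} {A : Set α} {Z : Set β}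
    (h : AltPath r u v k A Z) (hrs : ∀ a b, r a b → s a b) : AltPath s u v k A Z := by
  induction h with
  | single hu => exact .single hu
  | cons hu hz h h' _ ih => exact .cons hu hz (hrs _ _ h) (hrs _ _ h') ih

theorem right_mem {u v : α} {k : ℕ} {A : Set α} {Z : Set β} (h : AltPath r u v k A Z) :
    v ∈ A := by
  induction h with
  | single hu => exact hu
  | cons _ _ _ _ _ ih => exact ih.1

theorem pos {u v : α} {k : ℕ} {A : Set α} {Z : Set β} (h : AltPath r u v k A Z) : 1 ≤ k := by
  cases h <;> omega

theorem append {u v v' y : α} {z : β} {k k' : ℕ} {A A' A'' : Set α} {Z Z' Z'' : Set β}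
    (h : AltPath r u v k A Z) (h' : AltPath r v' y k' A' Z') (hvz : r v z) (hvz' : r v' z)
    (hA : Disjoint A A') (hZ : Disjoint Z Z') (hz : z ∉ Z) (hz' : z ∉ Z')
    (hA₁ : A ⊆ A'') (hA₂ : A' ⊆ A'') (hZ₁ : Z ⊆ Z'') (hZ₂ : Z' ⊆ Z'') (hz'' : z ∈ Z'') :
    AltPath r u y (k + k') A'' Z'' := by
  induction h generalizing A'' Z'' with
  | single hu =>
    rw [Nat.add_comm]
    refine .cons (hA₁ hu) hz'' hvz hvz'
      (h'.mono (fun a ha => ⟨hA₂ ha, ?_⟩) fun b hb => ⟨hZ₂ hb, ?_⟩)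
    · rintro rfl
      exact Set.disjoint_left.1 hA hu ha
    · rintro rfl
      exact hz' hb
  | @cons u u₁ v z₁ k A Z hu hz₁ h₁ h₂ hp ih =>
    have : k + 1 + k' = (k + k') + 1 := by omega
    rw [this]
    refine .cons (hA₁ hu) (hZ₁ hz₁) h₁ h₂ (ih hvz (hA.mono_left Set.sdiff_subset)
      (hZ.mono_left Set.sdiff_subset) (fun hh => hz hh.1) (Set.sdiff_subset_sdiff_left hA₁)
      (fun a ha => ⟨hA₂ ha, ?_⟩) (Set.sdiff_subset_sdiff_left hZ₁) (fun b hb => ⟨hZ₂ hb, ?_⟩)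
      ⟨hz'', ?_⟩)
    · rintro rfl
      exact Set.disjoint_left.1 hA hu ha
    · rintro rfl
      exact Set.disjoint_left.1 hZ hz₁ hb
    · rintro rfl
      exact hz hz₁

theorem reverse {u v : α} {k : ℕ} {A : Set α} {Z : Set β} (h : AltPath r u v k A Z) :
    AltPath r v u k A Z := by
  induction h with
  | single hu => exact .single hu
  | @cons u u₁ v z₁ k A Z hu hz₁ h₁ h₂ hp ih =>
    refine ih.append (A' := {u}) (Z' := ∅) (.single rfl) h₂ h₁ ?_ (by simp) (by simp) (by simp)
      Set.sdiff_subset (by simpa using hu) Set.sdiff_subset (by simp) hz₁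
    exact Set.disjoint_singleton_right.2 (by simp)

theorem exists_fun [Nonempty β] {u v : α} {k : ℕ} {A : Set α} {Z : Set β}
    (h : AltPath r u v (k + 1) A Z) :
    ∃ (w : ℕ → α) (z : ℕ → β), IsAltPath r w z k ∧ w 0 = u ∧ w k = v ∧
      (∀ i ≤ k, w i ∈ A) ∧ ∀ i < k, z i ∈ Z := by
  induction k generalizing u A Z with
  | zero =>
    cases h with
    | single hu =>
      exact ⟨fun _ => v, fun _ => Classical.arbitrary β, ⟨by simp, by simp, by omega, by omega⟩,
        rfl, rfl, fun _ _ => hu, by simp⟩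
    | cons hu hz h h' hp => exact absurd hp.pos (by omega)
  | succ k ih =>
    cases h with
    | @cons _ u' _ z₀ _ _ _ hu hz h h' hp =>
      obtain ⟨w, z, hw, h0, hk, hA, hZ⟩ := ih hp
      refine ⟨fun i => Nat.casesOn i u w, fun i => Nat.casesOn i z₀ z, ⟨?_, ?_, ?_, ?_⟩, rfl, hk,
        ?_, ?_⟩
      · rintro (_ | i) hi
        · exact h
        · exact hw.left i (by omega)
      · rintro (_ | i) hi
        · simpa [h0] using h'
        · exact hw.right i (by omega)
      · rintro (_ | i) hi (_ | j) hj hij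
        · rfl
        · exact absurd hij.symm (hA j (by omega)).2
        · exact absurd hij (hA i (by omega)).2
        · have := hw.injw i (by omega) j (by omega) hij
          omega
      · rintro (_ | i) hi (_ | j) hj hij
        · rfl
        · exact absurd hij.symm (hZ j (by omega)).2
        · exact absurd hij (hZ i (by omega)).2
        · have := hw.injz i (by omega) j (by omega) hij
          omega
      · rintro (_ | i) hi
        · exact hu
        · exact (hA i (by omega)).1
      · rintro (_ | i) hi
        · exact hz
        · exact (hZ i (by omega)).1

theorem join {u v v' y : α} {z : β} {k k' : ℕ} {A A' : Set α} {Z Z' : Set β}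
    (h : AltPath r u v k A Z) (h' : AltPath r v' y k' A' Z') (hvz : r v z) (hvz' : r v' z)
    (hA : Disjoint A A') (hZ : Disjoint Z Z') (hz : z ∉ Z) (hz' : z ∉ Z') :
    AltPath r u y (k + k') (A ∪ A') (insert z (Z ∪ Z')) :=
  h.append h' hvz hvz' hA hZ hz hz' Set.subset_union_left Set.subset_union_right
    (Set.subset_union_left.trans (Set.subset_insert _ _))
    (Set.subset_union_right.trans (Set.subset_insert _ _)) (Set.mem_insert _ _)

theorem point (r : α → β → Prop) (u : α) : AltPath r u u 1 {u} ∅ := .single rfl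

theorem cycle {u v : α} {z : β} {k k' : ℕ} {A : Set α} {Z : Set β}
    (h : AltPath r u v k A Z) (hz : z ∉ Z) (hu : r u z) (hv : r v z) (hk : 2 ≤ k') (e : k = k') :
    HasAltCycle r k' :=
  ⟨u, v, z, A, Z, e ▸ h, hz, hu, hv, hk⟩

end AltPath

theorem HasAltCycle.mono_rel {s : α → β → Prop} {k : ℕ} (h : HasAltCycle r k)
    (hrs : ∀ a b, r a b → s a b) : HasAltCycle s k := by
  obtain ⟨u, v, z, A, Z, h, hz, hu, hv, hk⟩ := h
  exact ⟨u, v, z, A, Z, h.mono_rel hrs, hz, hrs _ _ hu, hrs _ _ hv, hk⟩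

/-- Exchanging the two sides of an alternating path that is closed up at both ends. -/
theorem AltPath.flip_aux {u v : α} {k : ℕ} {A : Set α} {Z : Set β} (h : AltPath r u v k A Z)
    {y y' : β} (hy : y ∉ Z) (hy' : y' ∉ Z) (hyy : y ≠ y') (huy : r u y) (hvy : r v y') :
    AltPath (fun b a => r a b) y y' (k + 1) (insert y (insert y' Z)) A := by
  induction h generalizing y with
  | single hu => exact .cons (by simp) hu huy hvy (.single (by simp [hyy.symm]))
  | @cons u u₁ v z₁ k A Z hu hz₁ h₁ h₂ hp ih =>
    refine .cons (by simp) hu huy h₁ ((ih (y := z₁) (by simp) (fun h => hy' h.1) ?_ h₂ hvy).mono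
      ?_ subset_rfl)
    · rintro rfl
      exact hy' hz₁
    · rintro b hb
      have : z₁ ≠ y := by
        rintro rfl
        exact hy hz₁
      simp only [Set.mem_insert_iff, Set.mem_sdiff, Set.mem_singleton_iff] at hb ⊢
      rcases hb with rfl | rfl | hb
      · exact ⟨Or.inr (Or.inr hz₁), this⟩
      · exact ⟨by simp, hyy.symm⟩
      · refine ⟨by simp [hb.1], ?_⟩
        rintro rfl
        exact hy hb.1

theorem HasAltCycle.flip {k : ℕ} (h : HasAltCycle r k) : HasAltCycle (fun b a => r a b) k := by
  obtain ⟨u, v, z, A, Z, h, hz, hu, hv, hk⟩ := h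
  cases h with
  | single _ => omega
  | @cons _ u₁ _ z₁ k _ _ hu' hz₁ h₁ h₂ hp =>
    have hne : z₁ ≠ z := by
      rintro rfl
      exact hz hz₁
    exact (hp.flip_aux (by simp) (fun h => hz h.1) hne h₂ hv).cycle (z := u) (by simp) h₁ hu hk rfl

namespace IsAltPath

variable {w : ℕ → α} {z : ℕ → β} {t : ℕ}

theorem seg (h : IsAltPath r w z t) {i j : ℕ} (hij : i ≤ j) (hj : j ≤ t) :
    AltPath r (w i) (w j) (j - i + 1) (w '' Set.Icc i j) (z '' Set.Ico i j) := by
  obtain ⟨d, rfl⟩ := Nat.exists_eq_add_of_le hij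
  induction d with
  | zero => simpa using AltPath.single (r := r) (Set.mem_image_of_mem w (by simp : i ∈ Set.Icc i i))
  | succ d ih =>
    have := ((ih (by omega) (by omega)).append (AltPath.point r (w (i + (d + 1))))
      (A'' := w '' Set.Icc i (i + (d + 1))) (Z'' := z '' Set.Ico i (i + (d + 1))) (z := z (i + d))
      (h.left (i + d) (by omega)) (h.right (i + d) (by omega)) ?_ (by simp) ?_ (by simp) ?_ ?_ ?_
      (by simp) ?_)
    · convert this using 1
      omega
    · rw [Set.disjoint_singleton_right]
      rintro ⟨k, hk, e⟩
      rw [Set.mem_Icc] at hk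
      have := h.injw _ (by omega) _ hj e
      omega
    · rintro ⟨k, hk, e⟩
      rw [Set.mem_Ico] at hk
      have := h.injz _ (by omega) _ (by omega) e
      omega
    · exact Set.image_mono (Set.Icc_subset_Icc_right (by omega))
    · simpa using ⟨i + (d + 1), by simp, rfl⟩
    · exact Set.image_mono (Set.Ico_subset_Ico_right (by omega))
    · exact ⟨i + d, by simp, rfl⟩

theorem seg' (h : IsAltPath r w z t) {i j : ℕ} (hij : i ≤ j) (hj : j ≤ t) :
    AltPath r (w j) (w i) (j - i + 1) (w '' Set.Icc i j) (z '' Set.Ico i j) :=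
  (h.seg hij hj).reverse

theorem mem_w (h : IsAltPath r w z t) {a b i : ℕ} (hi : i ≤ t) (hb : b ≤ t) :
    w i ∈ w '' Set.Icc a b ↔ a ≤ i ∧ i ≤ b := by
  constructor
  · rintro ⟨j, hj, e⟩
    obtain rfl := h.injw _ (hj.2.trans hb) _ hi e
    exact hj
  · exact fun hi => ⟨i, hi, rfl⟩

theorem mem_z (h : IsAltPath r w z t) {a b i : ℕ} (hi : i < t) (hb : b ≤ t) :
    z i ∈ z '' Set.Ico a b ↔ a ≤ i ∧ i < b := by
  constructor
  · rintro ⟨j, hj, e⟩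
    obtain rfl := h.injz _ (hj.2.trans_le hb) _ hi e
    exact hj
  · exact fun hi => ⟨i, hi, rfl⟩

theorem disjoint_w (h : IsAltPath r w z t) {a b c d : ℕ} (hb : b ≤ t) (hd : d ≤ t)
    (hbd : b < c ∨ d < a) : Disjoint (w '' Set.Icc a b) (w '' Set.Icc c d) := by
  rw [Set.disjoint_left]
  rintro _ ⟨i, hi, rfl⟩ hw
  rw [Set.mem_Icc] at hi
  rw [h.mem_w (by omega) hd] at hw
  omega

theorem disjoint_z (h : IsAltPath r w z t) {a b c d : ℕ} (hb : b ≤ t) (hd : d ≤ t)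
    (hbd : b ≤ c ∨ d ≤ a) : Disjoint (z '' Set.Ico a b) (z '' Set.Ico c d) := by
  rw [Set.disjoint_left]
  rintro _ ⟨i, hi, rfl⟩ hw
  rw [Set.mem_Ico] at hi
  rw [h.mem_z (by omega) hd] at hw
  omega

theorem reverse (h : IsAltPath r w z t) :
    IsAltPath r (fun k => w (t - k)) (fun k => z (t - 1 - k)) t where
  left i hi := by
    have := h.right (t - 1 - i) (by omega)
    rwa [show t - 1 - i + 1 = t - i by omega] at this
  right i hi := by
    have := h.left (t - 1 - i) (by omega)
    rwa [show t - 1 - i = t - (i + 1) by omega] at this ⊢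
  injw i hi j hj e := by
    have := h.injw _ (by omega) _ (by omega) e
    omega
  injz i hi j hj e := by
    have := h.injz _ (by omega) _ (by omega) e
    omega

theorem rotate (h : IsAltPath r w z t) {i : ℕ} (hi : i < t) (hr : r (w 0) (z i)) :
    IsAltPath r (fun k => if k ≤ i then w (i - k) else w k)
      (fun k => if k < i then z (i - 1 - k) else z k) t where
  left k hk := by
    rcases lt_trichotomy k i with h' | rfl | h'
    · have := h.right (i - 1 - k) (by omega)
      rw [show i - 1 - k + 1 = i - k by omega] at this
      simpa [h', h'.le] using this
    · simpa using hr
    · simpa [h'.not_ge, h'.not_gt] using h.left k hk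
  right k hk := by
    rcases lt_or_ge k i with h' | h'
    · have := h.left (i - 1 - k) (by omega)
      rw [show i - 1 - k = i - (k + 1) by omega] at this
      simpa [h', Nat.succ_le_iff.2 h', show i - 1 - k = i - (k + 1) by omega] using this
    · simpa [show ¬ k + 1 ≤ i by omega, h'.not_gt] using h.right k hk
  injw a ha b hb e := by
    have key : ∀ k ≤ t, (if k ≤ i then w (i - k) else w k) = w (if k ≤ i then i - k else k) := by
      intro k _
      split_ifs <;> rfl
    simp only [key a ha, key b hb] at e
    have := h.injw _ (by split_ifs <;> omega) _ (by split_ifs <;> omega) e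
    split_ifs at this <;> omega
  injz a ha b hb e := by
    have key : ∀ k ≤ t, (if k < i then z (i - 1 - k) else z k) =
        z (if k < i then i - 1 - k else k) := by
      intro k _
      split_ifs <;> rfl
    simp only [key a ha.le, key b hb.le] at e
    have := h.injz _ (by split_ifs <;> omega) _ (by split_ifs <;> omega) e
    split_ifs at this <;> omega

end IsAltPath
end Basic

/-- The vertices `w 0, z 0, w 1, …, w (k - 1), z (k - 1), w k = w 0` form a cycle in the bipartite
graph of `r`. -/
structure IsAltCycle {α β : Type*} (r : α → β → Prop) (w : ℕ → α) (z : ℕ → β) (k : ℕ) : Prop where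
  left : ∀ i < k, r (w i) (z i)
  right : ∀ i < k, r (w (i + 1)) (z i)
  wrap : w k = w 0
  injw : ∀ i < k, ∀ j < k, w i = w j → i = j
  injz : ∀ i < k, ∀ j < k, z i = z j → i = j

section Cycle

variable {α β : Type*} {r : α → β → Prop} {w : ℕ → α} {z : ℕ → β} {k : ℕ}

theorem HasAltCycle.exists_fun (h : HasAltCycle r k) :
    ∃ (w : ℕ → α) (z : ℕ → β), IsAltCycle r w z k := by
  obtain ⟨u, v, y, A, Z, h, hz, hu, hv, hk⟩ := h
  have : Nonempty β := ⟨y⟩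
  obtain ⟨k, rfl⟩ : ∃ m, k = m + 1 := ⟨k - 1, by omega⟩
  obtain ⟨w, z, hw, rfl, rfl, hA, hZ⟩ := h.exists_fun
  have hne : ∀ i < k, z i ≠ y := by
    rintro i hi rfl
    exact hz (hZ i hi)
  refine ⟨fun i => if i ≤ k then w i else w 0, fun i => if i < k then z i else y,
    ⟨fun i hi => ?_, fun i hi => ?_, by simp, fun i hi j hj => ?_, fun i hi j hj => ?_⟩⟩
  · rcases Nat.lt_succ_iff_lt_or_eq.1 hi with h | rfl
    · simpa [h, h.le] using hw.left i h
    · simpa using hv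
  · rcases Nat.lt_succ_iff_lt_or_eq.1 hi with h | rfl
    · simpa [h, Nat.succ_le_iff.2 h] using hw.right i h
    · simpa using hu
  · simpa [Nat.le_of_lt_succ hi, Nat.le_of_lt_succ hj] using hw.injw i (by omega) j (by omega)
  · have := hw.injz i
    have := hne i
    have := hne j
    grind

namespace IsAltCycle

theorem isAltPath (h : IsAltCycle r w z k) : IsAltPath r w z (k - 1) where
  left i hi := h.left i (by omega)
  right i hi := h.right i (by omega)
  injw i hi j hj e := by
    rcases Nat.eq_zero_or_pos k with rfl | hk
    · omega
    · exact h.injw i (by omega) j (by omega) e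
  injz i hi j hj e := h.injz i (by omega) j (by omega) e

theorem hasAltCycle (h : IsAltCycle r w z k) (hk : 2 ≤ k) : HasAltCycle r k := by
  refine (h.isAltPath.seg (Nat.zero_le (k - 1)) le_rfl).cycle (z := z (k - 1)) ?_ ?_
    (h.left _ (by omega)) hk (by omega)
  · rintro ⟨i, hi, e⟩
    rw [Set.mem_Ico] at hi
    have := h.injz _ (by omega) _ (by omega) e
    omega
  · have := h.right (k - 1) (by omega)
    rwa [show k - 1 + 1 = k by omega, h.wrap] at this

theorem rotate (h : IsAltCycle r w z k) {i : ℕ} (hi : i < k) :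
    IsAltCycle r (fun j => if j + i < k then w (j + i) else w (j + i - k))
      (fun j => if j + i < k then z (j + i) else z (j + i - k)) k where
  left j hj := by
    split_ifs with h'
    · exact h.left _ h'
    · exact h.left _ (by omega)
  right j hj := by
    split_ifs with h' h'' h''
    · rw [show j + 1 + i = j + i + 1 by omega]
      exact h.right _ h''
    · omega
    · rw [show j + 1 + i - k = 0 by omega, ← h.wrap, show k = j + i + 1 by omega]
      exact h.right _ (by omega)
    · rw [show j + 1 + i - k = j + i - k + 1 by omega]
      exact h.right _ (by omega)
  wrap := by
    simp [hi]
  injw a ha b hb e := by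
    have key : ∀ j < k, (if j + i < k then w (j + i) else w (j + i - k)) =
        w (if j + i < k then j + i else j + i - k) := by
      intro j _
      split_ifs <;> rfl
    simp only [key a ha, key b hb] at e
    have := h.injw _ (by split_ifs <;> omega) _ (by split_ifs <;> omega) e
    split_ifs at this <;> omega
  injz a ha b hb e := by
    have key : ∀ j < k, (if j + i < k then z (j + i) else z (j + i - k)) =
        z (if j + i < k then j + i else j + i - k) := by
      intro j _
      split_ifs <;> rfl
    simp only [key a ha, key b hb] at e
    have := h.injz _ (by split_ifs <;> omega) _ (by split_ifs <;> omega) e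
    split_ifs at this <;> omega

theorem reverse (h : IsAltCycle r w z k) :
    IsAltCycle r (fun j => w (k - j)) (fun j => z (k - 1 - j)) k where
  left j hj := by
    have := h.right (k - 1 - j) (by omega)
    rwa [show k - 1 - j + 1 = k - j by omega] at this
  right j hj := by
    have := h.left (k - 1 - j) (by omega)
    rwa [show k - 1 - j = k - (j + 1) by omega] at this ⊢
  wrap := by simp [h.wrap]
  injw a ha b hb e := by
    have key : ∀ j < k, w (k - j) = w (if j = 0 then 0 else k - j) := by
      intro j _
      split_ifs with h'
      · simp [h', h.wrap]
      · rfl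
    simp only [key a ha, key b hb] at e
    have := h.injw _ (by split_ifs <;> omega) _ (by split_ifs <;> omega) e
    split_ifs at this <;> omega
  injz a ha b hb e := by
    have := h.injz _ (by omega) _ (by omega) e
    omega

theorem swap [DecidableEq α] (h : IsAltCycle r w z k) {u x : α} (hx : ∀ i < k, w i ≠ x)
    (hr : ∀ j < k, w j = u ∨ w (j + 1) = u → r x (z j)) :
    IsAltCycle r (fun j => if w j = u then x else w j) z k where
  left j hj := by
    split_ifs with h'
    · exact hr j hj (.inl h')
    · exact h.left j hj
  right j hj := by
    split_ifs with h'
    · exact hr j hj (.inr h')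
    · exact h.right j hj
  wrap := by simp [h.wrap]
  injw a ha b hb e := by
    have := h.injw a ha b hb
    have := hx a ha
    have := hx b hb
    grind
  injz := h.injz

theorem insert_zero (h : IsAltCycle r w z k) (hk : 1 ≤ k) {q : β} {x : α} (hx : ∀ i < k, w i ≠ x)
    (hq : ∀ i < k, z i ≠ q) (h0 : r (w 0) q) (hxq : r x q) (hxz : r x (z (k - 1))) :
    HasAltCycle r (k + 1) := by
  refine hasAltCycle (w := fun j => if j < k then w j else if j = k then x else w 0)
    (z := fun j => if j < k then z j else q) ⟨fun j hj => ?_, fun j hj => ?_, ?_,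
      fun a ha b hb e => ?_, fun a ha b hb e => ?_⟩ (by omega)
  · rcases Nat.lt_succ_iff_lt_or_eq.1 hj with h' | rfl
    · simpa [h'] using h.left j h'
    · simpa using hxq
  · rcases Nat.lt_succ_iff_lt_or_eq.1 hj with h' | rfl
    · rcases Nat.lt_or_ge (j + 1) k with h'' | h''
      · simpa [h', h''] using h.right j h'
      · obtain rfl : k = j + 1 := by omega
        simpa using hxz
    · simpa using h0
  · simp [show 0 < k by omega]
  · have := h.injw a
    have := hx a
    have := hx b
    grind
  · have := h.injz a
    have := hq a
    have := hq b
    grind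

theorem insert (h : IsAltCycle r w z k) (hk : 2 ≤ k) {q : β} {x : α} (hx : ∀ i < k, w i ≠ x)
    (hq : ∀ i < k, z i ≠ q) {i : ℕ} (hi : i < k) (hiq : r (w i) q) (hxq : r x q)
    (hxz : ∀ a < k, ∀ b < k, a ≠ b → r x (z a) ∨ r x (z b)) : HasAltCycle r (k + 1) := by
  have h' := h.rotate hi
  set w' := (fun j => if j + i < k then w (j + i) else w (j + i - k)) with hw'
  set z' := (fun j => if j + i < k then z (j + i) else z (j + i - k)) with hz'
  have hx' : ∀ j < k, w' j ≠ x := by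
    intro j hj
    simp only [hw']
    split_ifs
    · exact hx _ ‹_›
    · exact hx _ (by omega)
  have hq' : ∀ j < k, z' j ≠ q := by
    intro j hj
    simp only [hz']
    split_ifs
    · exact hq _ ‹_›
    · exact hq _ (by omega)
  have h0 : r (w' 0) q := by simpa [hw', hi] using hiq
  have hxz' : r x (z' 0) ∨ r x (z' (k - 1)) := by
    by_contra hcon
    push Not at hcon
    simp only [hz'] at hcon
    rw [if_pos (by omega)] at hcon
    split_ifs at hcon
    · have := hxz (0 + i) (by omega) (k - 1 + i) (by omega) (by omega)
      tauto
    · have := hxz (0 + i) (by omega) (k - 1 + i - k) (by omega) (by omega)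
      tauto
  rcases hxz' with hh | hh
  · refine h'.reverse.insert_zero (by omega) (fun j hj => ?_) (fun j hj => hq' _ (by omega)) ?_ hxq
      (by simpa using hh)
    · rcases Nat.eq_zero_or_pos j with rfl | h0
      · simpa [h'.wrap] using hx' 0 (by omega)
      · exact hx' _ (by omega)
    · simpa [h'.wrap] using h0
  · exact h'.insert_zero (by omega) hx' hq' h0 hxq hh

end IsAltCycle

open Finset in
/-- A bipartite graph with sides of sizes `n + 1` and `n`, in which every vertex on the larger side
has at most one non-neighbour and every vertex on the smaller side has two neighbours, contains a
cycle of length `2n`. -/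
theorem hasAltCycle_of_almost_complete {n : ℕ} (hn : 5 ≤ n)
    {L : Finset α} {Q : Finset β}
    (hL : #L = n + 1) (hQ : #Q = n)
    (h1 : ∀ x ∈ L, ∀ q ∈ Q, ∀ q' ∈ Q, q ≠ q' → r x q ∨ r x q')
    (h2 : ∀ q ∈ Q, ∃ x ∈ L, ∃ x' ∈ L, x ≠ x' ∧ r x q ∧ r x' q) : HasAltCycle r n := by
  classical
  let g : α → β → Prop := fun a b => a ∈ L ∧ b ∈ Q ∧ r a b
  have hg1 : ∀ x ∈ L, ∀ q ∈ Q, ∀ q' ∈ Q, q ≠ q' → g x q ∨ g x q' := by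
    intro x hx q hq q' hq' hne
    exact (h1 x hx q hq q' hq' hne).imp (fun h => ⟨hx, hq, h⟩) fun h => ⟨hx, hq', h⟩
  suffices ∀ k, 2 ≤ k → k ≤ n → HasAltCycle g k from
    (this n (by omega) le_rfl).mono_rel fun _ _ h => h.2.2
  intro k hk2
  induction k, hk2 using Nat.le_induction with
  | base =>
    intro _
    obtain ⟨x, hx, x', hx', hxx⟩ := one_lt_card.1 (show 1 < #L by omega)
    have hfil : ∀ x ∈ L, #{q ∈ Q | ¬ g x q} ≤ 1 := by
      intro x hx
      refine card_le_one.2 fun a ha b hb => ?_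
      simp only [mem_filter] at ha hb
      by_contra hab
      exact (hg1 x hx a ha.1 b hb.1 hab).elim ha.2 hb.2
    have hc : 1 < #((Q \ {q ∈ Q | ¬ g x q}) \ {q ∈ Q | ¬ g x' q}) := by
      have e1 := le_card_sdiff {q ∈ Q | ¬ g x q} Q
      have e2 := le_card_sdiff {q ∈ Q | ¬ g x' q} (Q \ {q ∈ Q | ¬ g x q})
      have := hfil x hx
      have := hfil x' hx'
      omega
    obtain ⟨q, hq, q', hq', hqq⟩ := one_lt_card.1 hc
    simp only [mem_sdiff, mem_filter, not_and, not_not] at hq hq'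
    refine (AltPath.point g x).join (.point g x') (hq.1.2 hq.1.1) (hq.2 hq.1.1) (by simpa)
      (by simp) (by simp) (by simp) |>.cycle (z := q') (by simpa using hqq.symm)
      (hq'.1.2 hq'.1.1) (hq'.2 hq'.1.1) le_rfl rfl
  | succ k hk ih =>
    intro hkn
    obtain ⟨w, z, hC⟩ := (ih (by omega)).exists_fun
    have hwL : ∀ i < k, w i ∈ L := fun i hi => (hC.left i hi).1
    have hzQ : ∀ i < k, z i ∈ Q := fun i hi => (hC.left i hi).2.1
    have hxz : ∀ x ∈ L, ∀ a < k, ∀ b < k, a ≠ b → g x (z a) ∨ g x (z b) := fun x hx a ha b hb hab =>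
      hg1 x hx _ (hzQ a ha) _ (hzQ b hb) fun e => hab (hC.injz a ha b hb e)
    have hLout : 1 < #(L \ (range k).image w) := by
      have := le_card_sdiff ((range k).image w) L
      have := card_image_le (s := range k) (f := w)
      rw [card_range] at this
      omega
    have hQout : 0 < #(Q \ (range k).image z) := by
      have := le_card_sdiff ((range k).image z) Q
      have := card_image_le (s := range k) (f := z)
      rw [card_range] at this
      omega
    obtain ⟨x₁, hx₁, x₂, hx₂, hxx⟩ := one_lt_card.1 hLout
    simp only [mem_sdiff, mem_image, mem_range, not_exists, not_and] at hx₁ hx₂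
    by_cases hcase : ∃ q ∈ Q, (∀ i < k, z i ≠ q) ∧ ∃ i < k, g (w i) q
    · obtain ⟨q, hq, hqz, i, hi, hiq⟩ := hcase
      by_cases hout : ∃ x ∈ L, (∀ i < k, w i ≠ x) ∧ g x q
      · obtain ⟨x, hx, hxw, hxq⟩ := hout
        exact hC.insert hk hxw hqz hi hiq hxq (hxz x hx)
      · push Not at hout
        obtain ⟨j, hj, hji, hjq⟩ : ∃ j < k, j ≠ i ∧ g (w j) q := by
          obtain ⟨a, ha, b, hb, hab, hra, hrb⟩ := h2 q hq
          have key : ∀ c ∈ L, r c q → ∃ j < k, w j = c := by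
            intro c hc hcq
            by_contra hcon
            push Not at hcon
            exact hout c hc hcon ⟨hc, hq, hcq⟩
          obtain ⟨ja, hja, rfl⟩ := key a ha hra
          obtain ⟨jb, hjb, rfl⟩ := key b hb hrb
          by_cases e : ja = i
          · exact ⟨jb, hjb, fun e' => hab (by rw [e, e']), hb, hq, hrb⟩
          · exact ⟨ja, hja, e, ha, hq, hra⟩
        have hfull : ∀ a < k, g x₁ (z a) := fun a ha =>
          (hg1 x₁ hx₁.1 _ (hzQ a ha) q hq (hqz a ha)).resolve_right (hout x₁ hx₁.1 hx₁.2)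
        have hC' := hC.swap (u := w i) hx₁.2 fun a ha _ => hfull a ha
        have hne : w j ≠ w i := fun e => hji (hC.injw j hj i hi e)
        refine hC'.insert hk (x := w i) (fun a ha => ?_) hqz hj ?_ hiq (hxz _ (hwL i hi))
        · split_ifs with h
          · exact Ne.symm (hx₁.2 i hi)
          · exact h
        · simpa [hne] using hjq
    · push Not at hcase
      obtain ⟨q, hq⟩ := card_pos.1 hQout
      simp only [mem_sdiff, mem_image, mem_range, not_exists, not_and] at hq
      have hqC := hcase q hq.1 hq.2
      have hk4 : 4 ≤ k := by
        by_contra hlt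
        have : 1 < #(Q \ (range k).image z) := by
          have := le_card_sdiff ((range k).image z) Q
          have := card_image_le (s := range k) (f := z)
          rw [card_range] at this
          omega
        obtain ⟨a, ha, b, hb, hab⟩ := one_lt_card.1 this
        simp only [mem_sdiff, mem_image, mem_range, not_exists, not_and] at ha hb
        exact (hg1 _ (hwL 0 (by omega)) a ha.1 b hb.1 hab).elim
          (hcase a ha.1 ha.2 0 (by omega)) (hcase b hb.1 hb.2 0 (by omega))
      obtain ⟨x, hx, x', hx', hne, hxq, hxq'⟩ := h2 q hq.1
      have hxw : ∀ x ∈ L, r x q → ∀ i < k, w i ≠ x := by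
        rintro _ hx hxq i hi rfl
        exact hqC i hi ⟨hx, hq.1, hxq⟩
      obtain ⟨i, hi, hi0, hgood⟩ : ∃ i < k, 0 < i ∧ ∀ j < k, j = i ∨ j + 1 = i → g x (z j) := by
        by_cases hbad : ∃ j < k, ¬ g x (z j)
        · obtain ⟨j₀, hj₀, hb⟩ := hbad
          have key : ∀ j < k, j ≠ j₀ → g x (z j) := fun j hj hne =>
            (hxz x hx j hj j₀ hj₀ hne).resolve_right hb
          rcases Nat.lt_or_ge j₀ 2 with h | h
          · exact ⟨3, by omega, by omega, fun j hj h' => key j hj (by omega)⟩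
          · exact ⟨1, by omega, by omega, fun j hj h' => key j hj (by omega)⟩
        · push Not at hbad
          exact ⟨1, by omega, by omega, fun j hj _ => hbad j hj⟩
      have hC' := hC.swap (u := w i) (hxw x hx hxq) (fun j hj h => hgood j hj (by
        rcases h with h | h
        · exact .inl (hC.injw j hj i hi h)
        · rcases Nat.lt_or_ge (j + 1) k with h' | h'
          · exact .inr (hC.injw _ h' i hi h)
          · rw [show j + 1 = k by omega, hC.wrap] at h
            have := hC.injw 0 (by omega) i hi h
            omega))
      refine hC'.insert hk (x := x') (fun a ha => ?_) hq.2 hi ?_ ⟨hx', hq.1, hxq'⟩ (hxz x' hx')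
      · split_ifs with h
        · exact hne
        · exact hxw x' hx' hxq' a ha
      · simpa using ⟨hx, hq.1, hxq⟩

end Cycle

section Complete

open Finset

variable {α β : Type*} {r : α → β → Prop} {n : ℕ}

theorem AltPath.of_complete {P : Finset α} {Q : Finset β} (h : ∀ p ∈ P, ∀ q ∈ Q, r p q)
    (hPQ : #P ≤ #Q + 1) {u : α} (hu : u ∈ P) : ∃ v ∈ P, AltPath r u v #P P Q := by
  classical
  obtain ⟨k, hk⟩ : ∃ k, #P = k + 1 := ⟨#P - 1, by have := card_pos.2 ⟨u, hu⟩; omega⟩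
  rw [hk]
  induction k generalizing P Q u with
  | zero => exact ⟨u, hu, .single (by simpa using hu)⟩
  | succ k ih =>
    obtain ⟨q, hq⟩ : Q.Nonempty := card_pos.1 (by omega)
    obtain ⟨u', hu'⟩ : (P.erase u).Nonempty := card_pos.1 (by rw [card_erase_of_mem hu]; omega)
    obtain ⟨v, hv, hp⟩ := ih (P := P.erase u) (Q := Q.erase q)
      (fun p hp q hq => h p (mem_of_mem_erase hp) q (mem_of_mem_erase hq))
      (by rw [card_erase_of_mem hu, card_erase_of_mem hq]; omega) hu'
      (by rw [card_erase_of_mem hu]; omega)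
    refine ⟨v, mem_of_mem_erase hv, .cons (by simpa using hu) (by simpa using hq) (h _ hu _ hq)
      (h _ (mem_of_mem_erase hu') _ hq) ?_⟩
    simpa using hp

theorem hasAltCycle_of_complete {P : Finset α} {Q : Finset β} (hn : 2 ≤ n) (hP : #P + 1 = n)
    (hQ : #Q = n) (h : ∀ p ∈ P, ∀ q ∈ Q, r p q) {x : α} (hx : x ∉ P) {q q' : β} (hq : q ∈ Q)
    (hq' : q' ∈ Q) (hne : q ≠ q') (hxq : r x q) (hxq' : r x q') : HasAltCycle r n := by
  classical
  obtain ⟨u, hu⟩ : P.Nonempty := card_pos.1 (by omega)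
  obtain ⟨v, hv, hp⟩ := AltPath.of_complete (r := r) (P := P) (Q := (Q.erase q).erase q')
    (fun p hp q hq => h p hp q (mem_of_mem_erase (mem_of_mem_erase hq)))
    (by
      have h1 := card_erase_of_mem (mem_erase.2 ⟨hne.symm, hq'⟩)
      have h2 := card_erase_of_mem hq
      omega) hu
  refine (hp.join (.point r x) (h v hv q' hq') hxq' ?_ (by simp) (by simp) (by simp)).cycle (z := q)
    ?_ (h u hu q hq) hxq hn hP
  · simpa using hx
  · simpa using hne

variable [Fintype α]

theorem exists_star_of_complete (hn : 5 ≤ n) (hα : Fintype.card α = 2 * n)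
    (hr : ¬ HasAltCycle r n)
    (hs : ¬ HasAltCycle (fun a b => ¬ r a b) n) {P : Finset α} {Q : Finset β}
    (hP : #P + 1 = n) (hQ : #Q = n) (h : ∀ p ∈ P, ∀ q ∈ Q, r p q) :
    ∃ b ∈ Q, ∃ F : Finset α, Disjoint F P ∧ #F = n ∧ (∀ f ∈ F, r f b) ∧
      ∀ f ∈ F, ∀ q ∈ Q, q ≠ b → ¬ r f q := by
  classical
  have h0 : ∀ x ∉ P, ∀ q ∈ Q, ∀ q' ∈ Q, q ≠ q' → r x q → ¬ r x q' :=
    fun x hx q hq q' hq' hne h1 h2 =>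
      hr (hasAltCycle_of_complete (by omega) hP hQ h hx hq hq' hne h1 h2)
  have hL : #(univ \ P) = n + 1 := by
    rw [card_sdiff_of_subset (subset_univ _), card_univ]
    omega
  have hb : ∃ b ∈ Q, ∀ x ∉ P, ∀ x' ∉ P, x ≠ x' → r x b ∨ r x' b := by
    by_contra hcon
    push Not at hcon
    refine hs (hasAltCycle_of_almost_complete hn hL hQ (fun x hx q hq q' hq' hne => ?_)
      fun q hq => ?_)
    · have := h0 x (by simpa using hx) q hq q' hq' hne
      tauto
    · obtain ⟨x, hx, x', hx', hne, h1, h2⟩ := hcon q hq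
      exact ⟨x, by simpa using hx, x', by simpa using hx', hne, h1, h2⟩
  obtain ⟨b, hbQ, hb⟩ := hb
  have hc : #{x ∈ univ \ P | ¬ r x b} ≤ 1 := by
    refine card_le_one.2 fun x hx x' hx' => ?_
    simp only [mem_filter, mem_sdiff, mem_univ, true_and] at hx hx'
    by_contra hne
    exact (hb x hx.1 x' hx'.1 hne).elim hx.2 hx'.2
  have hc' : n ≤ #{x ∈ univ \ P | r x b} := by
    have := card_filter_add_card_filter_not (s := univ \ P) (fun x => r x b)
    omega
  obtain ⟨F, hF, hFn⟩ := exists_subset_card_eq hc'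
  have hF' : ∀ f ∈ F, f ∉ P ∧ r f b := fun f hf => by simpa using hF hf
  exact ⟨b, hbQ, F, disjoint_left.2 fun f hf => (hF' f hf).1, hFn, fun f hf => (hF' f hf).2,
    fun f hf q hq hne => h0 f (hF' f hf).1 b hbQ q hq hne.symm (hF' f hf).2⟩

variable [Fintype β]

/-- A colouring of `K_{2n,2n}` with a monochromatic `K_{n-1,n}` contains a monochromatic cycle of
length `2n`. -/
theorem not_complete (hn : 5 ≤ n) (hα : Fintype.card α = 2 * n)
    (hβ : Fintype.card β = 2 * n) (hr : ¬ HasAltCycle r n)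
    (hs : ¬ HasAltCycle (fun a b => ¬ r a b) n) {P : Finset α} {Q : Finset β}
    (hP : #P + 1 = n) (hQ : #Q = n) (h : ∀ p ∈ P, ∀ q ∈ Q, r p q) : False := by
  classical
  obtain ⟨b, hb, F, hFP, hF, hFb, hFQ⟩ := exists_star_of_complete hn hα hr hs hP hQ h
  obtain ⟨f₀, hf₀, G, hGQ, hG, hGf, hGF⟩ := exists_star_of_complete (r := fun b a => ¬ r a b)
    (P := Q.erase b) (Q := F) hn hβ (fun h => hs h.flip)
    (fun h => hr (h.flip.mono_rel fun _ _ => not_not.1)) (by rw [card_erase_of_mem hb]; omega) hF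
    (fun q hq f hf => hFQ f hf q (mem_of_mem_erase hq) (ne_of_mem_erase hq))
  obtain ⟨b₃, hb₃, F₃, hF₃F, hF₃, hF₃b, -⟩ := exists_star_of_complete (r := r)
    (P := F.erase f₀) (Q := G) hn hα hr hs (by rw [card_erase_of_mem hf₀]; omega) hG
    (fun f hf q hq => not_not.1 (hGF q hq f (mem_of_mem_erase hf) (ne_of_mem_erase hf)))
  have hbG : b ∉ G := fun hbG => hGf b hbG (hFb f₀ hf₀)
  have hb₃Q : b₃ ∉ Q := by
    intro hb₃Q
    refine disjoint_left.1 hGQ hb₃ (mem_erase.2 ⟨?_, hb₃Q⟩)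
    rintro rfl
    exact hbG hb₃
  have hf₀F₃ : f₀ ∉ F₃ := fun hf => hGf b₃ hb₃ (hF₃b f₀ hf)
  have hF₃eq : F₃ = univ \ F := by
    refine eq_of_subset_of_card_le (fun f hf => ?_) ?_
    · rw [mem_sdiff]
      refine ⟨mem_univ _, fun hfF => disjoint_left.1 hF₃F hf (mem_erase.2 ⟨?_, hfF⟩)⟩
      rintro rfl
      exact hf₀F₃ hf
    · rw [card_sdiff_of_subset (subset_univ _), card_univ]
      omega
  obtain ⟨q, hq⟩ : (Q.erase b).Nonempty := card_pos.1 (by rw [card_erase_of_mem hb]; omega)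
  obtain ⟨f, hf⟩ : (F.erase f₀).Nonempty := card_pos.1 (by rw [card_erase_of_mem hf₀]; omega)
  rw [mem_erase] at hq hf
  refine hr (hasAltCycle_of_complete (P := P) (Q := insert b₃ (Q.erase q)) (x := f) (q := b)
    (q' := b₃) (by omega) hP ?_ ?_ (disjoint_left.1 hFP hf.2) ?_ ?_ ?_ (hFb f hf.2) ?_)
  · rw [card_insert_of_notMem (by simp [hb₃Q]), card_erase_of_mem hq.2]
    omega
  · intro p hp y hy
    rw [mem_insert] at hy
    rcases hy with rfl | hy
    · refine hF₃b p ?_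
      rw [hF₃eq, mem_sdiff]
      exact ⟨mem_univ _, fun hpF => disjoint_left.1 hFP hpF hp⟩
    · exact h p hp y (mem_of_mem_erase hy)
  · simp [hb, hq.1.symm]
  · simp
  · rintro rfl
    exact hb₃Q hb
  · exact not_not.1 (hGF b₃ hb₃ f hf.2 hf.1)

/-- The two-sided pigeonhole consequence of `not_complete`. -/
theorem not_split (hn : 5 ≤ n) (hα : Fintype.card α = 2 * n)
    (hβ : Fintype.card β = 2 * n) (hr : ¬ HasAltCycle r n)
    (hs : ¬ HasAltCycle (fun a b => ¬ r a b) n) {B B' : Finset β} (hB : n ≤ #B + 1)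
    (hB' : n ≤ #B' + 1) (x₀ : α)
    (h : ∀ x ≠ x₀, (∀ b ∈ B, ¬ r x b) ∨ ∀ b ∈ B', ¬ r x b) : False := by
  classical
  have key : ∀ C : Finset β, n ≤ #C + 1 → #{x : α | ∀ b ∈ C, ¬ r x b} < n := by
    intro C hC
    by_contra! hcon
    obtain ⟨Q, hQ, hQn⟩ := exists_subset_card_eq hcon
    obtain ⟨P, hP, hPn⟩ := exists_subset_card_eq (show n - 1 ≤ #C by omega)
    refine not_complete (r := fun b a => ¬ r a b) (P := P) (Q := Q) hn hβ hα (fun h => hs h.flip)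
      (fun h => hr (h.flip.mono_rel fun _ _ => not_not.1)) (by omega) hQn fun p hp q hq => ?_
    have := hQ hq
    rw [mem_filter] at this
    exact this.2 p (hP hp)
  have h1 := key B hB
  have h2 := key B' hB'
  have h3 : (univ.erase x₀ : Finset α) ⊆
      ({x | ∀ b ∈ B, ¬ r x b} : Finset α) ∪ ({x | ∀ b ∈ B', ¬ r x b} : Finset α) := by
    intro x hx
    simpa using h x (ne_of_mem_erase hx)
  have h4 := (card_le_card h3).trans (card_union_le _ _)
  rw [card_erase_of_mem (mem_univ _), card_univ] at h4
  omega

end Complete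

section Crossing

open Finset

variable {α β : Type*} {r : α → β → Prop} {n t : ℕ}

/-- The bipartite graph of `r` contains a cycle through all `t` vertices of `S \ {x}` whose
other vertices are in `Z`. -/
def CycleAvoiding (r : α → β → Prop) (S : Set α) (Z : Set β) (t : ℕ) (x : α) : Prop :=
  ∃ (u v : α) (z : β), z ∈ Z ∧ AltPath r u v t (S \ {x}) (Z \ {z}) ∧ r u z ∧ r v z

theorem IsAltPath.image_z [DecidableEq β] {w : ℕ → α} {z : ℕ → β} {Z : Finset β}
    (h : IsAltPath r w z t)
    (hZ : #Z = t) (hz : ∀ i < t, z i ∈ Z) : (range t).image z = Z := by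
  refine eq_of_subset_of_card_le (fun b hb => ?_) ?_
  · obtain ⟨i, hi, rfl⟩ := mem_image.1 hb
    exact hz i (mem_range.1 hi)
  · rw [card_image_of_injOn, card_range, hZ]
    intro i hi j hj e
    exact h.injz i (by simpa using hi) j (by simpa using hj) e

theorem card_filter_eq_of_image [DecidableEq β] {z : ℕ → β} {Z : Finset β}
    (hz : (range t).image z = Z) (hZ : #Z = t) (p : β → Prop) [DecidablePred p] :
    #{b ∈ Z | p b} = #{i ∈ range t | p (z i)} := by
  have hinj : Set.InjOn z (range t) := by
    rw [← card_image_iff, hz, hZ, card_range]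
  rw [← hz, filter_image, card_image_of_injOn]
  exact hinj.mono (coe_subset.2 (filter_subset _ _))

/-- The functional form of `CycleAvoiding`. -/
theorem CycleAvoiding.exists_fun {S : Set α} {Z : Set β} {x : α} (h : CycleAvoiding r S Z t x) :
    ∃ (w : ℕ → α) (z : ℕ → β), IsAltCycle r w z t ∧ (∀ i ≤ t, w i ∈ S \ {x}) ∧
      ∀ i < t, z i ∈ Z := by
  obtain ⟨u, v, y, hy, h, hu, hv⟩ := h
  have : Nonempty β := ⟨y⟩
  obtain ⟨t, rfl⟩ : ∃ m, t = m + 1 := ⟨t - 1, by have := h.pos; omega⟩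
  obtain ⟨w, z, hw, rfl, rfl, hA, hZ⟩ := h.exists_fun
  have hne : ∀ i < t, z i ≠ y := by
    rintro i hi rfl
    exact (hZ i hi).2 rfl
  refine ⟨fun i => if i ≤ t then w i else w 0, fun i => if i < t then z i else y,
    ⟨fun i hi => ?_, fun i hi => ?_, by simp, fun i hi j hj => ?_, fun i hi j hj => ?_⟩,
    fun i hi => ?_, fun i hi => ?_⟩
  · rcases Nat.lt_succ_iff_lt_or_eq.1 hi with h | rfl
    · simpa [h, h.le] using hw.left i h
    · simpa using hv
  · rcases Nat.lt_succ_iff_lt_or_eq.1 hi with h | rfl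
    · simpa [h, Nat.succ_le_iff.2 h] using hw.right i h
    · simpa using hu
  · simpa [Nat.le_of_lt_succ hi, Nat.le_of_lt_succ hj] using hw.injw i (by omega) j (by omega)
  · have := hw.injz i
    have := hne i
    have := hne j
    grind
  · dsimp only
    split_ifs with h
    · exact hA i h
    · exact hA 0 (by omega)
  · dsimp only
    split_ifs with h
    · exact (hZ i h).1
    · exact hy

theorem IsAltPath.cycleAvoiding_zero {w : ℕ → α} {z : ℕ → β} {S : Set α} {Z : Set β}
    (h : IsAltPath r w z t) (ht : 1 ≤ t) (hw : ∀ i ≤ t, w i ∈ S) (hz : ∀ i < t, z i ∈ Z)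
    (hr : r (w t) (z 0)) : CycleAvoiding r S Z t (w 0) := by
  refine ⟨w 1, w t, z 0, hz 0 ht, ?_, h.right 0 ht, hr⟩
  have := (h.seg ht le_rfl).mono (A' := S \ {w 0}) (Z' := Z \ {z 0}) ?_ ?_
  · rwa [show t - 1 + 1 = t by omega] at this
  · rintro _ ⟨i, hi, rfl⟩
    rw [Set.mem_Icc] at hi
    refine ⟨hw i hi.2, fun e => ?_⟩
    have := h.injw _ hi.2 _ (by omega) e
    omega
  · rintro _ ⟨i, hi, rfl⟩
    rw [Set.mem_Ico] at hi
    refine ⟨hz i hi.2, fun e => ?_⟩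
    have := h.injz _ hi.2 _ (by omega) e
    omega

theorem IsAltPath.cycleAvoiding_of_cross {w : ℕ → α} {z : ℕ → β} {S : Set α} {Z : Set β}
    (h : IsAltPath r w z t) (hw : ∀ i ≤ t, w i ∈ S) (hz : ∀ i < t, z i ∈ Z) {k : ℕ} (hk : 1 ≤ k)
    (hkt : k < t) (h0 : r (w 0) (z k)) (ht : r (w t) (z (k - 1))) :
    CycleAvoiding r S Z t (w k) := by
  have hm : z (k - 1) ∉ z '' Set.Ico 0 (k - 1) ∧ z (k - 1) ∉ z '' Set.Ico (k + 1) t := by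
    rw [h.mem_z (by omega) (by omega), h.mem_z (by omega) (by omega)]
    omega
  have hm' : z k ∉ z '' Set.Ico 0 (k - 1) ∧ z k ∉ z '' Set.Ico (k + 1) t := by
    rw [h.mem_z (by omega) (by omega), h.mem_z (by omega) (by omega)]
    omega
  have hzz : z k ≠ z (k - 1) := fun e => by
    have := h.injz _ hkt _ (by omega) e
    omega
  have hp := (h.seg' (Nat.zero_le (k - 1)) (by omega)).join (h.seg (i := k + 1) (by omega) le_rfl)
    (z := z k) h0 (h.right k hkt) (h.disjoint_w (by omega) le_rfl (by omega))
    (h.disjoint_z (by omega) le_rfl (by omega)) hm'.1 hm'.2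
  refine ⟨w (k - 1), w t, z (k - 1), hz _ (by omega), ?_, h.left (k - 1) (by omega), ht⟩
  rw [show k - 1 - 0 + 1 + (t - (k + 1) + 1) = t by omega] at hp
  refine hp.mono ?_ ?_
  · rintro _ (⟨i, hi, rfl⟩ | ⟨i, hi, rfl⟩) <;> rw [Set.mem_Icc] at hi <;>
      refine ⟨hw i (by omega), fun e => ?_⟩ <;>
      · have := h.injw _ (by omega) _ (by omega) e
        omega
  · rintro b (rfl | hb)
    · exact ⟨hz k hkt, hzz⟩
    · refine ⟨?_, ?_⟩
      · rcases hb with ⟨i, hi, rfl⟩ | ⟨i, hi, rfl⟩ <;> rw [Set.mem_Ico] at hi <;>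
          exact hz i (by omega)
      · rintro rfl
        exact hb.elim hm.1 hm.2

/-- Hamiltonian paths obtained by inserting `x` into a cycle on the other vertices. -/
theorem IsAltCycle.hamPath {w : ℕ → α} {z : ℕ → β} {S : Set α} {Z : Set β} {x : α}
    (h : IsAltCycle r w z t) (hw : ∀ i ≤ t, w i ∈ S \ {x}) (hz : ∀ i < t, z i ∈ Z) (hx : x ∈ S)
    {i : ℕ} (hi : i < t) (hxi : r x (z i)) :
    AltPath r x (w (i + 1)) (t + 1) S Z ∧
      ∀ j < t, j ≠ i → r x (z j) → AltPath r (w (i + 1)) (w (j + 1)) (t + 1) S Z := by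
  obtain ⟨w₁, z₁, h', hw', hz', h0, hlast, hj⟩ : ∃ (w₁ : ℕ → α) (z₁ : ℕ → β), IsAltCycle r w₁ z₁ t ∧
      (∀ i ≤ t, w₁ i ∈ S \ {x}) ∧ (∀ i < t, z₁ i ∈ Z) ∧ w₁ 0 = w (i + 1) ∧ z₁ (t - 1) = z i ∧
      ∀ j < t, j ≠ i → ∃ j' < t - 1, z₁ j' = z j ∧ w₁ (j' + 1) = w (j + 1) := by
    by_cases hit : i + 1 < t
    · refine ⟨_, _, h.rotate hit, fun j hj => ?_, fun j hj => ?_, ?_, ?_, fun j hj hne => ?_⟩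
      · split_ifs <;> exact hw _ (by omega)
      · split_ifs <;> exact hz _ (by omega)
      · simp [hit]
      · rw [if_neg (by omega)]
        congr 1
        omega
      · rcases lt_or_gt_of_ne hne with hlt | hlt
        · refine ⟨j + t - (i + 1), by omega, ?_, ?_⟩
          · rw [if_neg (by omega)]
            congr 1
            omega
          · rw [if_neg (by omega)]
            congr 1
            omega
        · refine ⟨j - (i + 1), by omega, ?_, ?_⟩
          · rw [if_pos (by omega)]
            congr 1
            omega
          · split_ifs
            · congr 1
              omega
            · rw [show j + 1 = t by omega, h.wrap]
              congr 1
              omega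
    · obtain rfl : t = i + 1 := by omega
      exact ⟨w, z, h, hw, hz, h.wrap.symm, rfl, fun j hj hne => ⟨j, by omega, rfl, rfl⟩⟩
  have hp := h'.isAltPath
  have hxw : ∀ a b, b < t → Disjoint (w₁ '' Set.Icc a b) {x} := by
    intro a b hb
    rw [Set.disjoint_singleton_right]
    rintro ⟨k, hk, e⟩
    rw [Set.mem_Icc] at hk
    exact (hw' k (by omega)).2 e
  have hlz : ∀ a b, b < t → z₁ (t - 1) ∉ z₁ '' Set.Ico a b := by
    rintro a b hb ⟨k, hk, e⟩
    rw [Set.mem_Ico] at hk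
    have := h'.injz _ (by omega) _ (by omega) e
    omega
  have hSw : ∀ a b, b < t → w₁ '' Set.Icc a b ⊆ S := by
    rintro a b hb _ ⟨k, hk, rfl⟩
    exact (hw' k (hk.2.trans hb.le)).1
  have hSz : ∀ a b, b < t → z₁ '' Set.Ico a b ⊆ Z := by
    rintro a b hb _ ⟨k, hk, rfl⟩
    exact hz' k (hk.2.trans hb)
  have hlast' := h'.left (t - 1) (by omega)
  rw [← hlast] at hxi
  rw [← h0]
  refine ⟨?_, fun j hjt hne hxj => ?_⟩
  · refine ((AltPath.point r x).append (hp.seg' (Nat.zero_le (t - 1)) le_rfl) hxi hlast'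
      (hxw _ _ (by omega)).symm (by simp) (by simp) (hlz _ _ (by omega)) (A'' := S) (Z'' := Z)
      (by simpa) (hSw _ _ (by omega)) (by simp) (hSz _ _ (by omega)) (hz' _ (by omega))).mono
      subset_rfl subset_rfl |> fun h => ?_
    rwa [show 1 + (t - 1 - 0 + 1) = t + 1 by omega] at h
  · obtain ⟨j', hj', ez, ew⟩ := hj j hjt hne
    rw [← ez] at hxj
    rw [← ew]
    have h1 := (hp.seg (Nat.zero_le j') (by omega)).join (AltPath.point r x) (z := z₁ j')
      (h'.left _ (by omega)) hxj (hxw _ _ (by omega)) (by simp)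
      (by rw [hp.mem_z (by omega) (by omega)]; omega) (by simp)
    have h2 := h1.append (hp.seg' (i := j' + 1) (j := t - 1) (by omega) le_rfl) hxi hlast'
      (A'' := S) (Z'' := Z) ?_ ?_ ?_ (hlz _ _ (by omega)) ?_ (hSw _ _ (by omega)) ?_
      (hSz _ _ (by omega)) (hz' _ (by omega))
    · rwa [show j' - 0 + 1 + 1 + (t - 1 - (j' + 1) + 1) = t + 1 by omega] at h2
    · rw [Set.disjoint_union_left]
      exact ⟨hp.disjoint_w (by omega) (by omega) (by omega), (hxw _ _ (by omega)).symm⟩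
    · rw [Set.union_empty, Set.disjoint_insert_left, hp.mem_z (by omega) (by omega)]
      exact ⟨by omega, hp.disjoint_z (by omega) (by omega) (by omega)⟩
    · rw [Set.union_empty, Set.mem_insert_iff, not_or]
      refine ⟨fun e => ?_, hlz _ _ (by omega)⟩
      have := h'.injz _ (by omega) _ (by omega) e
      omega
    · exact Set.union_subset (hSw _ _ (by omega)) (by simpa)
    · rw [Set.union_empty]
      exact Set.insert_subset (hz' _ (by omega)) (hSz _ _ (by omega))

end Crossing

section Tight

open Finset

open scoped Classical

variable {α β : Type*} [Fintype β]

/-- The Hamiltonian paths of `r` between `S` and `Z` cannot be closed up outside `Z`, although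
the vertices of `S` have large degrees. -/
structure Tight (r : α → β → Prop) (S : Finset α) (Z : Finset β) (n t : ℕ) : Prop where
  cardS : #S = t + 1
  cardZ : #Z = t
  lt : t + 1 ≤ n
  card : Fintype.card β = 2 * n
  deg : ∀ a ∈ S, n ≤ #{b | r a b}
  disjoint : ∀ u v, AltPath r u v (t + 1) S Z → ∀ b ∉ Z, r u b → ¬ r v b

variable {r : α → β → Prop} {S : Finset α} {Z : Finset β} {n t : ℕ}

theorem Tight.card_out (h : Tight r S Z n t) {a : α} (ha : a ∈ S) :
    n ≤ #{b ∈ univ \ Z | r a b} + #{b ∈ Z | r a b} := by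
  refine (h.deg a ha).trans ((card_le_card ?_).trans (card_union_le _ _))
  intro b
  simp
  tauto

theorem Tight.card_compl (h : Tight r S Z n t) : #(univ \ Z) = 2 * n - t := by
  rw [card_sdiff_of_subset (subset_univ _), card_univ, h.card, h.cardZ]

/-- Pairwise disjointness of the neighbourhoods outside `Z` bounds their total size. -/
theorem Tight.sum_le (h : Tight r S Z n t) {ι : Type*} {I : Finset ι} {f : ι → α}
    (hf : ∀ i ∈ I, f i ∈ S) (hdis : ∀ i ∈ I, ∀ j ∈ I, i ≠ j → ∀ b ∉ Z, r (f i) b → ¬ r (f j) b) :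
    ∑ i ∈ I, (n - #{b ∈ Z | r (f i) b}) ≤ 2 * n - t := by
  calc ∑ i ∈ I, (n - #{b ∈ Z | r (f i) b}) ≤ ∑ i ∈ I, #{b ∈ univ \ Z | r (f i) b} := by
        refine sum_le_sum fun i hi => ?_
        have := h.card_out (hf i hi)
        omega
    _ = #(I.biUnion fun i => {b ∈ univ \ Z | r (f i) b}) := by
        rw [card_biUnion]
        intro i hi j hj hne
        refine disjoint_left.2 fun b hb hb' => ?_
        simp only [mem_filter, mem_sdiff, mem_univ, true_and] at hb hb'
        exact hdis i hi j hj hne b hb.1 hb.2 hb'.2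
    _ ≤ #(univ \ Z) := card_le_card (biUnion_subset.2 fun i _ => filter_subset _ _)
    _ = 2 * n - t := h.card_compl

theorem Tight.exists_cycle (h : Tight r S Z n t) {x : α} (hx : x ∈ S)
    (hc : CycleAvoiding r S Z t x) : ∃ (w : ℕ → α) (z : ℕ → β), IsAltCycle r w z t ∧
      (∀ i ≤ t, w i ∈ S \ {x}) ∧ (∀ i < t, z i ∈ Z) ∧
      #{i ∈ range t | r x (z i)} = #{b ∈ Z | r x b} ∧
      (∀ i < t, r x (z i) → AltPath r x (w (i + 1)) (t + 1) S Z) ∧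
      (∀ i < t, ∀ j < t, r x (z i) → r x (z j) → i ≠ j →
        AltPath r (w (i + 1)) (w (j + 1)) (t + 1) S Z) ∧
      ∑ i ∈ {i ∈ range t | r x (z i)}, (t - #{b ∈ Z | r (w (i + 1)) b}) +
        #{b ∈ Z | r x b} * (n - t) ≤ (n - t) + #{b ∈ Z | r x b} := by
  obtain ⟨w, z, hwz, hw, hz⟩ := hc.exists_fun
  have hx' : x ∈ (S : Set α) := hx
  have hzim : (range t).image z = Z := by
    refine eq_of_subset_of_card_le (fun b hb => ?_) ?_
    · obtain ⟨i, hi, rfl⟩ := mem_image.1 hb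
      exact hz i (mem_range.1 hi)
    · rw [card_image_of_injOn, card_range, h.cardZ]
      intro i hi j hj e
      exact hwz.injz i (by simpa using hi) j (by simpa using hj) e
  have hcard := card_filter_eq_of_image hzim h.cardZ (r x)
  have hw' : ∀ i ≤ t, w i ∈ S := fun i hi => (hw i hi).1
  have hH1 : ∀ i < t, r x (z i) → AltPath r x (w (i + 1)) (t + 1) S Z :=
    fun i hi hxi => (hwz.hamPath hw hz hx' hi hxi).1
  have hH2 : ∀ i < t, ∀ j < t, r x (z i) → r x (z j) → i ≠ j →
      AltPath r (w (i + 1)) (w (j + 1)) (t + 1) S Z :=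
    fun i hi j hj hxi hxj hne => (hwz.hamPath hw hz hx' hi hxi).2 j hj hne.symm hxj
  refine ⟨w, z, hwz, fun i hi => by simpa using hw i hi, hz, hcard.symm, hH1, hH2, ?_⟩
  have key' := h.sum_le (I := insertNone {i ∈ range t | r x (z i)})
    (f := fun o => o.elim x fun i => w (i + 1)) ?_ ?_
  · rw [sum_insertNone] at key'
    have key : n - #{b ∈ Z | r x b} +
        ∑ i ∈ {i ∈ range t | r x (z i)}, (n - #{b ∈ Z | r (w (i + 1)) b}) ≤ 2 * n - t := key'
    have e : ∀ i ∈ {i ∈ range t | r x (z i)}, n - #{b ∈ Z | r (w (i + 1)) b} =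
        (n - t) + (t - #{b ∈ Z | r (w (i + 1)) b}) := by
      intro i _
      have := card_filter_le Z fun b => r (w (i + 1)) b
      rw [h.cardZ] at this
      have := h.lt
      omega
    rw [sum_congr rfl e, sum_add_distrib, sum_const, ← hcard, smul_eq_mul] at key
    have := card_filter_le Z (r x)
    rw [h.cardZ] at this
    have := h.lt
    omega
  · simp only [mem_insertNone, mem_filter, mem_range]
    rintro (_ | i) hi
    · exact hx
    · exact hw' _ (hi i rfl).1
  · simp only [mem_insertNone, mem_filter, mem_range]
    rintro (_ | i) hi (_ | j) hj hne
    · exact absurd rfl hne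
    · exact h.disjoint _ _ (hH1 j (hj j rfl).1 (hj j rfl).2)
    · exact h.disjoint _ _ (hH1 i (hi i rfl).1 (hi i rfl).2).reverse
    · exact h.disjoint _ _ (hH2 i (hi i rfl).1 j (hj j rfl).1 (hi i rfl).2 (hj j rfl).2
        fun e => hne (by rw [e]))

theorem Tight.le (h : Tight r S Z n t) (a : α) : #{b ∈ Z | r a b} ≤ t := by
  rw [← h.cardZ]
  exact card_filter_le _ _

theorem Tight.exists_ends (h : Tight r S Z n t) {x : α} (hx : x ∈ S)
    (hc : CycleAvoiding r S Z t x) (hd : 2 ≤ #{b ∈ Z | r x b}) :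
    ∃ u v, AltPath r u v (t + 1) S Z ∧ #{b ∈ Z | r u b} = t ∧ t ≤ #{b ∈ Z | r v b} + 1 ∧
      (3 ≤ #{b ∈ Z | r x b} ∨ t + 2 = n → #{b ∈ Z | r v b} = t) ∧ n ≤ t + 2 := by
  obtain ⟨w, z, -, -, -, hI, -, hH, hsum⟩ := h.exists_cycle hx hc
  set I := {i ∈ range t | r x (z i)} with hIdef
  set d := #{b ∈ Z | r x b}
  set g : ℕ → ℕ := fun i => t - #{b ∈ Z | r (w (i + 1)) b} with hg
  change ∑ i ∈ I, g i + _ ≤ _ at hsum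
  have hlt := h.lt
  have hmem : ∀ i ∈ I, i < t ∧ r x (z i) := fun i hi => by simpa [hIdef] using hi
  have hfull : ∀ i, g i = 0 → #{b ∈ Z | r (w (i + 1)) b} = t := by
    intro i hi
    have := h.le (w (i + 1))
    simp only [hg] at hi
    omega
  have hbad : #{i ∈ I | g i ≠ 0} ≤ ∑ i ∈ I, g i := by
    rw [card_filter]
    refine sum_le_sum fun i _ => ?_
    split_ifs <;> omega
  have hsplit := card_filter_add_card_filter_not (s := I) (fun i => g i ≠ 0)
  simp only [not_not] at hsplit
  have hs1 : ∑ i ∈ I, g i ≤ 1 ∧ (t + 2 = n → ∑ i ∈ I, g i = 0) ∧ n ≤ t + 2 := by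
    obtain ⟨e, he⟩ : ∃ e, e = n - t := ⟨_, rfl⟩
    rw [← he] at hsum
    have he1 : 1 ≤ e := by omega
    obtain ⟨d', hd'⟩ : ∃ d', d = d' + 2 := ⟨d - 2, by omega⟩
    obtain ⟨e', rfl⟩ : ∃ e', e = e' + 1 := ⟨e - 1, by omega⟩
    rw [hd'] at hsum
    have : (d' + 2) * (e' + 1) = d' * e' + d' + 2 * e' + 2 := by ring
    rw [this] at hsum
    have h0 : 0 ≤ d' * e' := Nat.zero_le _
    refine ⟨by omega, fun h2 => by omega, by omega⟩
  by_cases hJ : 1 < #{i ∈ I | g i = 0}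
  · obtain ⟨i, hi, j, hj, hne⟩ := one_lt_card.1 hJ
    rw [mem_filter] at hi hj
    refine ⟨_, _, hH i (hmem i hi.1).1 j (hmem j hj.1).1 (hmem i hi.1).2 (hmem j hj.1).2 hne,
      hfull i hi.2, ?_, fun _ => hfull j hj.2, hs1.2.2⟩
    rw [hfull j hj.2]
    omega
  · have h2 : ¬ (3 ≤ d ∨ t + 2 = n) := by
      rintro (h3 | h3)
      · omega
      · have := hs1.2.1 h3
        omega
    obtain ⟨i, hi⟩ : ({i ∈ I | g i = 0} : Finset ℕ).Nonempty := card_pos.1 (by omega)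
    obtain ⟨j, hj⟩ : ({i ∈ I | g i ≠ 0} : Finset ℕ).Nonempty := card_pos.1 (by omega)
    rw [mem_filter] at hi hj
    refine ⟨_, _, hH i (hmem i hi.1).1 j (hmem j hj.1).1 (hmem i hi.1).2 (hmem j hj.1).2 ?_,
      hfull i hi.2, ?_, fun h => absurd h h2, hs1.2.2⟩
    · rintro rfl
      exact hj.2 hi.2
    · have h1 := single_le_sum (f := g) (fun _ _ => Nat.zero_le _) hj.1
      have : g j ≤ 1 := h1.trans hs1.1
      simp only [hg] at this
      omega

/-- If there is a cycle avoiding a vertex adjacent to all of `Z`, then the complement of `r` has a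
cycle through all of `S`. -/
theorem Tight.hasAltCycle_of_full (h : Tight r S Z n t) (hn : 5 ≤ n) {x : α} (hx : x ∈ S)
    (hc : CycleAvoiding r S Z t x) (hd : #{b ∈ Z | r x b} = t) (ht : n ≤ t + 2) :
    HasAltCycle (fun a b => a ∈ S ∧ ¬ r a b) n := by
  obtain ⟨w, z, hwz, hw, hz, hI, hH, hH2, hsum⟩ := h.exists_cycle hx hc
  have hlt := h.lt
  have htn : n = t + 1 := by
    by_contra hne
    have : n = t + 2 := by omega
    rw [hd, show n - t = 2 by omega] at hsum
    omega
  subst htn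
  have hxz : ∀ i < t, r x (z i) := fun i hi =>
    card_filter_eq_iff.1 (by rw [hd, h.cardZ]) _ (hz i hi)
  have hS : ∀ a ∈ S, a = x ∨ ∃ i < t, a = w (i + 1) := by
    have : (range t).image (fun i => w (i + 1)) = S.erase x := by
      refine eq_of_subset_of_card_le (fun b hb => ?_) ?_
      · obtain ⟨i, hi, rfl⟩ := mem_image.1 hb
        have := hw (i + 1) (by simpa using hi)
        simp only [mem_sdiff, mem_singleton] at this
        simp [this]
      · rw [card_image_of_injOn, card_range, card_erase_of_mem hx, h.cardS]
        · omega
        · have key : ∀ i < t, w (i + 1) = w (if i + 1 = t then 0 else i + 1) := by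
            intro i hi
            split_ifs with h'
            · rw [h', hwz.wrap]
            · rfl
          intro i hi j hj e
          simp only [coe_range, Set.mem_Iio] at hi hj
          simp only [key i hi, key j hj] at e
          have := hwz.injw _ (by split_ifs <;> omega) _ (by split_ifs <;> omega) e
          split_ifs at this <;> omega
    intro a ha
    by_cases hax : a = x
    · exact .inl hax
    · have : a ∈ (range t).image (fun i => w (i + 1)) := by
        rw [this]
        exact mem_erase.2 ⟨hax, ha⟩
      obtain ⟨i, hi, rfl⟩ := mem_image.1 this
      exact .inr ⟨i, mem_range.1 hi, rfl⟩
  have hdis : ∀ a ∈ S, ∀ a' ∈ S, a ≠ a' → ∀ b ∉ Z, r a b → ¬ r a' b := by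
    intro a ha a' ha' hne
    obtain rfl | ⟨i, hi, rfl⟩ := hS a ha
    · obtain rfl | ⟨j, hj, rfl⟩ := hS a' ha'
      · exact absurd rfl hne
      · exact h.disjoint _ _ (hH j hj (hxz j hj))
    · obtain rfl | ⟨j, hj, rfl⟩ := hS a' ha'
      · exact h.disjoint _ _ (hH i hi (hxz i hi)).reverse
      · exact h.disjoint _ _ (hH2 i hi j hj (hxz i hi) (hxz j hj) fun e => hne (by rw [e]))
  have hτ : ∀ a : α, ∃ b, a ∈ S → b ∉ Z ∧ r a b := by
    intro a
    by_cases ha : a ∈ S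
    · have h1 := h.card_out ha
      have h2 := h.le a
      obtain ⟨b, hb⟩ : ({b ∈ univ \ Z | r a b} : Finset β).Nonempty := card_pos.1 (by omega)
      simp only [mem_filter, mem_sdiff, mem_univ, true_and] at hb
      exact ⟨b, fun _ => hb⟩
    · have : 0 < Fintype.card β := by rw [h.card]; omega
      obtain ⟨b⟩ := Fintype.card_pos_iff.1 this
      exact ⟨b, fun h => absurd h ha⟩
  choose τ hτ using hτ
  have hS1 : #S = t + 1 := h.cardS
  let s : ℕ → α := fun i => if hi : i < t + 1 then (S.equivFinOfCardEq hS1).symm ⟨i, hi⟩ else x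
  have hs : ∀ i < t + 1, s i ∈ S := by
    intro i hi
    simp only [s, dif_pos hi]
    exact Subtype.coe_prop _
  have hsinj : ∀ i < t + 1, ∀ j < t + 1, s i = s j → i = j := by
    intro i hi j hj e
    simp only [s, hi, hj, dif_pos] at e
    simpa using (S.equivFinOfCardEq hS1).symm.injective (Subtype.ext e)
  have hblue : ∀ i < t + 1, ∀ j < t + 1, i ≠ j → s i ∈ S ∧ ¬ r (s i) (τ (s j)) := by
    intro i hi j hj hne
    refine ⟨hs i hi, fun hr => ?_⟩
    have := hτ _ (hs j hj)
    exact hdis _ (hs i hi) _ (hs j hj) (fun e => hne (hsinj i hi j hj e)) _ this.1 hr this.2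
  refine IsAltCycle.hasAltCycle (w := fun i => s (if i < t + 1 then i else 0))
    (z := fun i => τ (s (if i + 2 < t + 1 then i + 2 else i + 2 - (t + 1))))
    ⟨fun i hi => ?_, fun i hi => ?_, by simp, fun i hi j hj e => ?_, fun i hi j hj e => ?_⟩
    (by omega)
  · exact hblue _ (by split_ifs <;> omega) _ (by split_ifs <;> omega) (by split_ifs <;> omega)
  · exact hblue _ (by split_ifs <;> omega) _ (by split_ifs <;> omega) (by split_ifs <;> omega)
  · have := hsinj _ (by split_ifs <;> omega) _ (by split_ifs <;> omega) e
    grind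
  · by_contra hne
    have hi' : (if i + 2 < t + 1 then i + 2 else i + 2 - (t + 1)) < t + 1 := by
      split_ifs <;> omega
    have hj' : (if j + 2 < t + 1 then j + 2 else j + 2 - (t + 1)) < t + 1 := by
      split_ifs <;> omega
    refine (hblue _ hi' _ hj' (by split_ifs <;> omega)).2 ?_
    rw [← e]
    exact (hτ _ (hs _ hi')).2

end Tight

section Tight

open Finset

open scoped Classical

variable {α β : Type*} {r : α → β → Prop} {S : Finset α} {Z : Finset β} {n t : ℕ}

theorem IsAltPath.altPath {w : ℕ → α} {z : ℕ → β} {S : Set α} {Z : Set β} (h : IsAltPath r w z t)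
    (hw : ∀ i ≤ t, w i ∈ S) (hz : ∀ i < t, z i ∈ Z) : AltPath r (w 0) (w t) (t + 1) S Z := by
  refine (h.seg (Nat.zero_le t) le_rfl).mono ?_ ?_
  · rintro _ ⟨i, hi, rfl⟩
    exact hw i hi.2
  · rintro _ ⟨i, hi, rfl⟩
    exact hz i hi.2

variable [Fintype β]

theorem Tight.hasAltCycle_of_ends (h : Tight r S Z n t) (hn : 5 ≤ n) (htn : n ≤ t + 2) {u v : α}
    (huv : AltPath r u v (t + 1) S Z) (hu : #{b ∈ Z | r u b} = t) (hv : #{b ∈ Z | r v b} = t) :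
    HasAltCycle (fun a b => a ∈ S ∧ ¬ r a b) n := by
  have : Nonempty β := by
    refine Fintype.card_pos_iff.1 ?_
    rw [h.card]
    omega
  obtain ⟨w, z, hwz, rfl, rfl, hw, hz⟩ := huv.exists_fun
  refine h.hasAltCycle_of_full hn (hw 0 (by omega)) (hwz.cycleAvoiding_zero (by omega) hw hz ?_)
    hu htn
  exact card_filter_eq_iff.1 (by rw [hv, h.cardZ]) _ (hz 0 (by omega))

theorem Tight.hasAltCycle (h : Tight r S Z n t) (hn : 5 ≤ n) {x : α} (hx : x ∈ S)
    (hc : CycleAvoiding r S Z t x) (hd : 2 ≤ #{b ∈ Z | r x b}) :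
    HasAltCycle (fun a b => a ∈ S ∧ ¬ r a b) n := by
  obtain ⟨u, v, huv, hu, hv, hfull, htn⟩ := h.exists_ends hx hc hd
  by_cases hvt : #{b ∈ Z | r v b} = t
  · exact h.hasAltCycle_of_ends hn htn huv hu hvt
  have hlt := h.lt
  have hnt : n = t + 1 := by
    by_contra hne
    exact hvt (hfull (.inr (by omega)))
  subst hnt
  have : Nonempty β := by
    refine Fintype.card_pos_iff.1 ?_
    rw [h.card]
    omega
  obtain ⟨w, z, hwz, rfl, rfl, hw, hz⟩ := huv.exists_fun
  have hw' : ∀ i ≤ t, w i ∈ S := hw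
  have hz' : ∀ i < t, z i ∈ Z := hz
  have h0 : ∀ i < t, r (w 0) (z i) := fun i hi =>
    card_filter_eq_iff.1 (by rw [hu, h.cardZ]) _ (hz i hi)
  by_cases hvz : r (w t) (z 0)
  · exact h.hasAltCycle_of_full hn (hw 0 (by omega)) (hwz.cycleAvoiding_zero (by omega) hw hz hvz)
      hu htn
  have ht : ∀ i < t, 1 ≤ i → r (w t) (z i) := by
    intro i hi hi1
    by_contra hcon
    have h1 : 1 < #{b ∈ Z | ¬ r (w t) b} := by
      refine one_lt_card.2 ⟨z 0, ?_, z i, ?_, fun e => ?_⟩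
      · exact mem_filter.2 ⟨hz 0 (by omega), hvz⟩
      · exact mem_filter.2 ⟨hz i hi, hcon⟩
      · have := hwz.injz 0 (by omega) i hi e
        omega
    have := card_filter_add_card_filter_not (s := Z) (fun b => r (w t) b)
    rw [h.cardZ] at this
    omega
  have hdeg : ∀ i, 1 < i → i < t → #{b ∈ Z | r (w i) b} < 3 ∨
      HasAltCycle (fun a b => a ∈ S ∧ ¬ r a b) (t + 1) := by
    intro i hi hit
    by_contra! hcon
    obtain ⟨u', v', huv', hu', -, hv', -⟩ := h.exists_ends (hw' i hit.le)
      (hwz.cycleAvoiding_of_cross hw hz (by omega) hit (h0 i hit)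
        (ht (i - 1) (by omega) (by omega)))
      (by omega)
    exact hcon.2 (h.hasAltCycle_of_ends hn htn huv' hu' (hv' (.inl hcon.1)))
  have hrot : ∀ i < t, AltPath r (w i) (w t) (t + 1) S Z := by
    intro i hi
    have := (hwz.rotate hi (h0 i hi)).altPath (S := S) (Z := Z) ?_ ?_
    · simpa [hi.not_ge] using this
    · intro j hj
      split_ifs <;> exact hw _ (by omega)
    · intro j hj
      split_ifs <;> exact hz _ (by omega)
  have h23 : AltPath r (w 2) (w 3) (t + 1) S Z := by
    have h1 := (hwz.seg' (Nat.zero_le 2) (by omega)).append (hwz.seg' (i := 3) (j := t) (by omega)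
      le_rfl) (z := z 2) (A'' := (S : Set α)) (Z'' := (Z : Set β)) (h0 2 (by omega))
      (ht 2 (by omega) (by omega)) (hwz.disjoint_w (by omega) le_rfl (by omega))
      (hwz.disjoint_z (by omega) le_rfl (by omega))
      (by rw [hwz.mem_z (by omega) (by omega)]; omega)
      (by rw [hwz.mem_z (by omega) (by omega)]; omega) ?_ ?_ ?_ ?_ (hz 2 (by omega))
    · rwa [show 2 - 0 + 1 + (t - 3 + 1) = t + 1 by omega] at h1
    all_goals
      rintro _ ⟨i, hi, rfl⟩
      first
      | rw [Set.mem_Icc] at hi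
        exact hw i (by omega)
      | rw [Set.mem_Ico] at hi
        exact hz i (by omega)
  rcases hdeg 2 (by omega) (by omega) with h2 | h2
  swap
  · exact h2
  rcases hdeg 3 (by omega) (by omega) with h3 | h3
  swap
  · exact h3
  have hsum := h.sum_le (I := {2, 3, t}) (f := w) ?_ ?_
  · rw [sum_insert (by simp; omega), sum_insert (by simp; omega), sum_singleton] at hsum
    have := h.le (w t)
    omega
  · intro i hi
    simp only [mem_insert, mem_singleton] at hi
    exact hw i (by omega)
  · intro i hi j hj hne
    simp only [mem_insert, mem_singleton] at hi hj
    refine h.disjoint _ _ ?_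
    rcases hi with rfl | rfl | rfl <;> rcases hj with rfl | rfl | rfl
    · exact absurd rfl hne
    · exact h23
    · exact hrot 2 (by omega)
    · exact h23.reverse
    · exact absurd rfl hne
    · exact hrot 3 (by omega)
    · exact (hrot 2 (by omega)).reverse
    · exact (hrot 3 (by omega)).reverse
    · exact absurd rfl hne

end Tight

section GoodPath

open Finset

open scoped Classical

variable {α β : Type*} {r : α → β → Prop} {S : Finset α} {Z : Finset β} {n t : ℕ}
  {w : ℕ → α} {z : ℕ → β}

/-- An alternating path with vertices in `S` and `Z`. -/
structure IsPathOn (r : α → β → Prop) (S : Finset α) (Z : Finset β) (w : ℕ → α) (z : ℕ → β)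
    (t : ℕ) : Prop extends IsAltPath r w z t where
  memw : ∀ i ≤ t, w i ∈ S
  memz : ∀ i < t, z i ∈ Z

namespace IsPathOn

theorem rotate (h : IsPathOn r S Z w z t) {i : ℕ} (hi : i < t) (hr : r (w 0) (z i)) :
    IsPathOn r S Z (fun k => if k ≤ i then w (i - k) else w k)
      (fun k => if k < i then z (i - 1 - k) else z k) t where
  toIsAltPath := h.toIsAltPath.rotate hi hr
  memw k hk := by split_ifs <;> exact h.memw _ (by omega)
  memz k hk := by split_ifs <;> exact h.memz _ (by omega)

theorem reverse (h : IsPathOn r S Z w z t) :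
    IsPathOn r S Z (fun k => w (t - k)) (fun k => z (t - 1 - k)) t where
  toIsAltPath := h.toIsAltPath.reverse
  memw k hk := h.memw _ (by omega)
  memz k hk := h.memz _ (by omega)

theorem not_mem_z (h : IsPathOn r S Z w z t) {o : β} (ho : o ∉ Z) {a b : ℕ} (hb : b ≤ t) :
    o ∉ z '' Set.Ico a b := by
  rintro ⟨i, hi, rfl⟩
  exact ho (h.memz i (hi.2.trans_le hb))

theorem disjoint_point (h : IsPathOn r S Z w z t) {x : α} (hx : x ∉ S) {a b : ℕ} (hb : b ≤ t) :
    Disjoint (w '' Set.Icc a b) {x} := by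
  rw [Set.disjoint_singleton_right]
  rintro ⟨i, hi, rfl⟩
  exact hx (h.memw i (hi.2.trans hb))

variable [Fintype β]

theorem disjoint_ends (h : IsPathOn r S Z w z t) (H : Tight r S Z n t) {o : β} (ho : o ∉ Z)
    (h0 : r (w 0) o) : ¬ r (w t) o :=
  H.disjoint _ _ (h.altPath h.memw h.memz) o ho h0

theorem not_cross (h : IsPathOn r S Z w z t) (H : Tight r S Z n t) (hn : 5 ≤ n)
    (hs : ¬ HasAltCycle (fun a b => a ∈ S ∧ ¬ r a b) n) {k : ℕ} (hk : 1 ≤ k) (hkt : k < t)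
    (h0 : r (w 0) (z k)) : ¬ r (w t) (z (k - 1)) := by
  intro h1
  refine hs (H.hasAltCycle hn (h.memw k hkt.le)
    (h.cycleAvoiding_of_cross (S := S) (Z := Z) h.memw h.memz hk hkt h0 h1) ?_)
  refine one_lt_card.2 ⟨z k, ?_, z (k - 1), ?_, fun e => ?_⟩
  · exact mem_filter.2 ⟨h.memz k hkt, h.left k hkt⟩
  · refine mem_filter.2 ⟨h.memz _ (by omega), ?_⟩
    have := h.right (k - 1) (by omega)
    rwa [show k - 1 + 1 = k by omega] at this
  · have := h.injz k hkt (k - 1) (by omega) e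
    omega

theorem card_index (h : IsPathOn r S Z w z t) (H : Tight r S Z n t) (a : α) :
    #{b ∈ Z | r a b} = #{i ∈ range t | r a (z i)} :=
  card_filter_eq_of_image (h.image_z H.cardZ h.memz) H.cardZ (r a)

/-- The indices adjacent to neither end of the path, in the sense of crossing chords. -/
theorem card_add_card_le (h : IsPathOn r S Z w z t) (H : Tight r S Z n t) (hn : 5 ≤ n)
    (hs : ¬ HasAltCycle (fun a b => a ∈ S ∧ ¬ r a b) n) :
    #{b ∈ Z | r (w 0) b} + #{b ∈ Z | r (w t) b} +
      #{k ∈ range t | 1 ≤ k ∧ ¬ r (w 0) (z k) ∧ ¬ r (w t) (z (k - 1))} ≤ t + 1 := by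
  rw [h.card_index H, h.card_index H,
    ← card_map (s := {i ∈ range t | r (w t) (z i)}) (addRightEmbedding 1)]
  rw [← card_union_of_disjoint, ← card_union_of_disjoint]
  · calc _ ≤ #(range (t + 1)) := by
          refine card_le_card fun k => ?_
          simp only [mem_union, mem_filter, mem_map, mem_range, addRightEmbedding_apply]
          rintro ((⟨h1, -⟩ | ⟨a, ⟨h1, -⟩, rfl⟩) | ⟨h1, -⟩) <;> omega
      _ = t + 1 := card_range _
  · rw [disjoint_left]
    intro k
    simp only [mem_union, mem_filter, mem_map, mem_range, addRightEmbedding_apply]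
    rintro (⟨h1, h2⟩ | ⟨a, ⟨h1, h2⟩, rfl⟩) h3
    · exact h3.2.2.1 h2
    · exact h3.2.2.2 (by simpa using h2)
  · rw [disjoint_left]
    intro k
    simp only [mem_filter, mem_map, mem_range, addRightEmbedding_apply]
    rintro ⟨h1, h2⟩ ⟨a, ⟨h3, h4⟩, rfl⟩
    exact h.not_cross H hn hs (by omega) h1 h2 (by simpa using h4)

theorem card_le_one (h : IsPathOn r S Z w z t) (H : Tight r S Z n t) (hn : 5 ≤ n)
    (hs : ¬ HasAltCycle (fun a b => a ∈ S ∧ ¬ r a b) n) :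
    #{k ∈ range t | 1 ≤ k ∧ ¬ r (w 0) (z k) ∧ ¬ r (w t) (z (k - 1))} +
      #{b ∈ univ \ Z | ¬ r (w 0) b ∧ ¬ r (w t) b} ≤ 1 := by
  have h1 := h.card_add_card_le H hn hs
  have h2 := H.card_out (h.memw 0 (by omega))
  have h3 := H.card_out (h.memw t le_rfl)
  have h4 : #{b ∈ univ \ Z | r (w 0) b} + #{b ∈ univ \ Z | r (w t) b} +
      #{b ∈ univ \ Z | ¬ r (w 0) b ∧ ¬ r (w t) b} ≤ #(univ \ Z) := by
    rw [← card_union_of_disjoint, ← card_union_of_disjoint]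
    · refine card_le_card ?_
      exact union_subset (union_subset (filter_subset _ _) (filter_subset _ _)) (filter_subset _ _)
    · rw [disjoint_left]
      intro b
      simp only [mem_union, mem_filter]
      tauto
    · rw [disjoint_left]
      intro b
      simp only [mem_filter, mem_sdiff]
      rintro ⟨⟨-, h5⟩, h6⟩ ⟨-, h7⟩
      exact h.disjoint_ends H h5 h6 h7
  rw [H.card_compl] at h4
  have := H.lt
  omega

end IsPathOn

/-- A path on `n` vertices of large degree, in a colouring without monochromatic cycles of length
`2n`. -/
structure CritPath [Fintype β] (r : α → β → Prop) (S : Finset α) (Z : Finset β) (n t : ℕ)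
    (w : ℕ → α) (z : ℕ → β) : Prop extends IsPathOn r S Z w z t where
  hn : 5 ≤ n
  htn : t + 1 = n
  tight : Tight r S Z n t
  red : ¬ HasAltCycle r n
  blue : ¬ HasAltCycle (fun a b => ¬ r a b) n

namespace CritPath

variable [Fintype β]

theorem rotate (h : CritPath r S Z n t w z) {i : ℕ} (hi : i < t) (hr : r (w 0) (z i)) :
    CritPath r S Z n t (fun k => if k ≤ i then w (i - k) else w k)
      (fun k => if k < i then z (i - 1 - k) else z k) where
  toIsPathOn := h.toIsPathOn.rotate hi hr
  hn := h.hn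
  htn := h.htn
  tight := h.tight
  red := h.red
  blue := h.blue

theorem reverse (h : CritPath r S Z n t w z) :
    CritPath r S Z n t (fun k => w (t - k)) (fun k => z (t - 1 - k)) where
  toIsPathOn := h.toIsPathOn.reverse
  hn := h.hn
  htn := h.htn
  tight := h.tight
  red := h.red
  blue := h.blue

theorem not_blue (h : CritPath r S Z n t w z) : ¬ HasAltCycle (fun a b => a ∈ S ∧ ¬ r a b) n :=
  fun hc => h.blue (hc.mono_rel fun _ _ h => h.2)

theorem ends (h : CritPath r S Z n t w z) {o : β} (ho : o ∉ Z) (h0 : r (w 0) o) : ¬ r (w t) o :=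
  h.disjoint_ends h.tight ho h0

theorem cross (h : CritPath r S Z n t w z) {k : ℕ} (hk : 1 ≤ k) (hkt : k < t)
    (h0 : r (w 0) (z k)) : ¬ r (w t) (z (k - 1)) :=
  h.not_cross h.tight h.hn h.not_blue hk hkt h0

theorem unique_index (h : CritPath r S Z n t w z) {k k' : ℕ} (hk : 1 ≤ k) (hkt : k < t)
    (hk' : 1 ≤ k') (hkt' : k' < t) (hne : k ≠ k') :
    r (w 0) (z k) ∨ r (w t) (z (k - 1)) ∨ r (w 0) (z k') ∨ r (w t) (z (k' - 1)) := by
  by_contra! hcon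
  have h1 := h.card_le_one h.tight h.hn h.not_blue
  have h2 : 1 < #{k ∈ range t | 1 ≤ k ∧ ¬ r (w 0) (z k) ∧ ¬ r (w t) (z (k - 1))} := by
    refine one_lt_card.2 ⟨k, ?_, k', ?_, hne⟩ <;> simp <;> tauto
  omega

theorem unique_out (h : CritPath r S Z n t w z) {o o' : β} (ho : o ∉ Z) (ho' : o' ∉ Z)
    (hne : o ≠ o') : r (w 0) o ∨ r (w t) o ∨ r (w 0) o' ∨ r (w t) o' := by
  by_contra! hcon
  have h1 := h.card_le_one h.tight h.hn h.not_blue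
  have h2 : 1 < #{b ∈ univ \ Z | ¬ r (w 0) b ∧ ¬ r (w t) b} := by
    refine one_lt_card.2 ⟨o, ?_, o', ?_, hne⟩ <;> simp <;> tauto
  omega

theorem unique_mixed (h : CritPath r S Z n t w z) {k : ℕ} (hk : 1 ≤ k) (hkt : k < t)
    {o : β} (ho : o ∉ Z) :
    r (w 0) (z k) ∨ r (w t) (z (k - 1)) ∨ r (w 0) o ∨ r (w t) o := by
  by_contra! hcon
  have h1 := h.card_le_one h.tight h.hn h.not_blue
  have h2 : 0 < #{k ∈ range t | 1 ≤ k ∧ ¬ r (w 0) (z k) ∧ ¬ r (w t) (z (k - 1))} := by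
    refine card_pos.2 ⟨k, ?_⟩
    simp
    tauto
  have h3 : 0 < #{b ∈ univ \ Z | ¬ r (w 0) b ∧ ¬ r (w t) b} := by
    refine card_pos.2 ⟨o, ?_⟩
    simp
    tauto
  omega

theorem exists_out (h : CritPath r S Z n t w z) {i : ℕ} (hi : i ≤ t) : ∃ o ∉ Z, r (w i) o := by
  have h1 := h.tight.card_out (h.memw i hi)
  have h2 := h.tight.le (w i)
  have := h.htn
  obtain ⟨b, hb⟩ : ({b ∈ univ \ Z | r (w i) b} : Finset β).Nonempty := card_pos.1 (by omega)
  exact ⟨b, by simpa using hb⟩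

/-- The start of the path shares an outside neighbour with the start of each rotation. -/
theorem share (h : CritPath r S Z n t w z) {i : ℕ} (hi : i < t) (hr : r (w 0) (z i)) {j : ℕ}
    (hj : j < t) (hnf : ¬ r (w 0) (z j)) : ∃ o ∉ Z, r (w 0) o ∧ r (w i) o := by
  by_contra! hcon
  have h1 := h.tight.card_out (h.memw 0 (by omega))
  have h2 : #{b ∈ Z | r (w 0) b} < t := by
    rw [← h.tight.cardZ]
    refine card_lt_card (filter_ssubset.2 ⟨z j, h.memz j hj, hnf⟩)
  have h3 := h.htn
  obtain ⟨o, ho, o', ho', hne⟩ := one_lt_card.1 (show 1 < #{b ∈ univ \ Z | r (w 0) b} by omega)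
  simp only [mem_filter, mem_sdiff, mem_univ, true_and] at ho ho'
  have := (h.rotate hi hr).unique_out ho.1 ho'.1 hne
  simp only [Nat.zero_le, if_true, Nat.sub_zero, hi.not_ge, if_false] at this
  rcases this with h' | h' | h' | h'
  · exact hcon o ho.1 ho.2 h'
  · exact h.ends ho.1 ho.2 h'
  · exact hcon o' ho'.1 ho'.2 h'
  · exact h.ends ho'.1 ho'.2 h'

theorem share' (h : CritPath r S Z n t w z) {i : ℕ} (hi0 : 1 ≤ i) (hi : i ≤ t)
    (hr : r (w t) (z (i - 1))) {j : ℕ}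
    (hj : j < t) (hnf : ¬ r (w t) (z j)) : ∃ o ∉ Z, r (w t) o ∧ r (w i) o := by
  have := h.reverse.share (i := t - i) (by omega)
    (by simpa [show t - 1 - (t - i) = i - 1 by omega] using hr) (j := t - 1 - j) (by omega)
    (by simpa [show t - 1 - (t - 1 - j) = j by omega] using hnf)
  simpa [show t - (t - i) = i by omega] using this

theorem not_swap (h : CritPath r S Z n t w z) {s : ℕ} (hs : 1 ≤ s) (hst : s ≤ t) {o o' : β}
    (ho : o ∉ Z) (ho' : o' ∉ Z) (h1 : r (w 0) o) (h2 : r (w s) o) (h3 : r (w t) o')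
    (h4 : r (w (s - 1)) o') : False := by
  have htn := h.htn
  have hn := h.hn
  refine h.red (((h.seg hst le_rfl).join (h.seg' (Nat.zero_le (s - 1)) (by omega)) h3 h4
    (h.disjoint_w (by omega) (by omega) (by omega))
    (h.disjoint_z (by omega) (by omega) (by omega)) (h.not_mem_z ho' (by omega))
    (h.not_mem_z ho' (by omega))).cycle (z := o) ?_ h2 h1 (by omega) (by omega))
  rintro (rfl | h' | h')
  · exact h.ends ho h1 h3
  · exact h.not_mem_z ho (by omega) h'
  · exact h.not_mem_z ho (by omega) h'

/-- Chords from the two ends of the path do not cross. -/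
theorem le_of_chords (h : CritPath r S Z n t w z) {i j : ℕ} (hi : i < t) (hj : j < t)
    (h0 : r (w 0) (z i)) (ht : r (w t) (z j)) : i ≤ j := by
  by_contra! hji
  have hne : i ≠ j + 1 := by
    rintro rfl
    exact h.cross (by omega) hi h0 ht
  have hnf0 : ¬ r (w 0) (z (j + 1)) := fun h' => h.cross (by omega) (by omega) h' ht
  have hnft : ¬ r (w t) (z (i - 1)) := h.cross (by omega) hi h0
  have hshare : ∀ k, j + 1 ≤ k → k ≤ i →
      (∃ o ∉ Z, r (w 0) o ∧ r (w k) o) ∨ ∃ o ∉ Z, r (w t) o ∧ r (w k) o := by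
    intro k hk hki
    obtain ⟨o, ho, hko⟩ := h.exists_out (i := k) (by omega)
    rcases h.unique_mixed (k := k) (by omega) (by omega) ho with h' | h' | h' | h'
    · exact .inl (h.share (by omega) h' (by omega) hnf0)
    · exact .inr (h.share' (by omega) (by omega) h' (j := i - 1) (by omega) hnft)
    · exact .inl ⟨o, ho, h', hko⟩
    · exact .inr ⟨o, ho, h', hko⟩
  have htype : ∀ k, j + 1 ≤ k → k ≤ i → ∃ o ∉ Z, r (w t) o ∧ r (w k) o := by
    intro k hk
    induction k, hk using Nat.le_induction with
    | base =>
      intro _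
      exact h.share' (by omega) (by omega) (by simpa using ht) (j := i - 1) (by omega) hnft
    | succ k hk ih =>
      intro hki
      obtain ⟨o', ho', h1, h2⟩ := ih (by omega)
      refine (hshare (k + 1) (by omega) hki).resolve_left ?_
      rintro ⟨o, ho, h3, h4⟩
      exact h.not_swap (s := k + 1) (by omega) (by omega) ho ho' h3 h4 h1 (by simpa using h2)
  obtain ⟨o', ho', h1, h2⟩ := htype (i - 1) (by omega) (by omega)
  obtain ⟨o, ho, h3, h4⟩ := h.share hi h0 (j := j + 1) (by omega) hnf0
  exact h.not_swap (s := i) (by omega) (by omega) ho ho' h3 h4 h1 h2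

end CritPath

end GoodPath

section Final

open Finset

open scoped Classical

variable {α β : Type*} {r : α → β → Prop} {S : Finset α} {Z : Finset β} {n t : ℕ}
  {w : ℕ → α} {z : ℕ → β}

/-- The vertices preceding a chord from the start of the path, together with the neighbours of the
start of the path outside of it. -/
def NearStart (r : α → β → Prop) (Z : Finset β) (t : ℕ) (w : ℕ → α) (z : ℕ → β) (b : β) : Prop :=
  (∃ l, l + 1 < t ∧ r (w 0) (z (l + 1)) ∧ b = z l) ∨ (b ∉ Z ∧ r (w 0) b)

/-- The vertices following a chord from the end of the path, together with the neighbours of the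
end of the path outside of it. -/
def NearEnd (r : α → β → Prop) (Z : Finset β) (t : ℕ) (w : ℕ → α) (z : ℕ → β) (b : β) : Prop :=
  (∃ k, 1 ≤ k ∧ k < t ∧ r (w t) (z (k - 1)) ∧ b = z k) ∨ (b ∉ Z ∧ r (w t) b)

theorem nearEnd_reverse (b : β) :
    NearEnd r Z t (fun k => w (t - k)) (fun k => z (t - 1 - k)) b ↔ NearStart r Z t w z b := by
  simp only [NearEnd, NearStart, Nat.sub_self]
  refine or_congr_left ⟨?_, ?_⟩
  · rintro ⟨k, h1, h2, h3, rfl⟩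
    exact ⟨t - 1 - k, by omega, by rwa [show t - 1 - k + 1 = t - 1 - (k - 1) by omega], rfl⟩
  · rintro ⟨l, h1, h2, rfl⟩
    exact ⟨t - 1 - l, by omega, by omega,
      by rwa [show t - 1 - (t - 1 - l - 1) = l + 1 by omega], by congr 1; omega⟩

theorem nearStart_reverse (b : β) :
    NearStart r Z t (fun k => w (t - k)) (fun k => z (t - 1 - k)) b ↔ NearEnd r Z t w z b := by
  simp only [NearEnd, NearStart, Nat.sub_zero]
  refine or_congr_left ⟨?_, ?_⟩
  · rintro ⟨l, h1, h2, rfl⟩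
    exact ⟨t - 1 - l, by omega, by omega,
      by rwa [show t - 1 - l - 1 = t - 1 - (l + 1) by omega], rfl⟩
  · rintro ⟨k, h1, h2, h3, rfl⟩
    exact ⟨t - 1 - k, by omega,
      by rwa [show t - 1 - (t - 1 - k + 1) = k - 1 by omega], by congr 1; omega⟩

namespace CritPath

variable [Fintype β]

theorem card_nearStart (h : CritPath r S Z n t w z) :
    n ≤ #{b | NearStart r Z t w z b} + 1 := by
  have h1 := h.tight.card_out (h.memw 0 (by omega))
  rw [h.card_index h.tight] at h1
  have h2 : #{i ∈ range t | r (w 0) (z i)} ≤ #{b ∈ Z | NearStart r Z t w z b} + 1 := by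
    have e : {i ∈ range t | r (w 0) (z i)} ⊆
        insert 0 (({l ∈ range (t - 1) | r (w 0) (z (l + 1))}).image (· + 1)) := by
      intro i hi
      simp only [mem_filter, mem_range, mem_insert, mem_image] at hi ⊢
      rcases Nat.eq_zero_or_pos i with rfl | h'
      · exact .inl rfl
      · exact .inr ⟨i - 1, ⟨by omega, by rw [show i - 1 + 1 = i by omega]; exact hi.2⟩, by omega⟩
    refine (card_le_card e).trans ((card_insert_le _ _).trans (Nat.succ_le_succ ?_))
    refine card_image_le.trans (card_le_card_of_injOn z ?_ ?_)
    · intro l hl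
      simp only [coe_filter, mem_range, Set.mem_ofPred_eq] at hl ⊢
      exact ⟨h.memz l (by omega), .inl ⟨l, by omega, hl.2, rfl⟩⟩
    · intro l hl l' hl' e
      simp only [coe_filter, mem_range, Set.mem_ofPred_eq] at hl hl'
      exact h.injz l (by omega) l' (by omega) e
  have h3 : #{b ∈ univ \ Z | r (w 0) b} ≤ #{b ∈ univ \ Z | NearStart r Z t w z b} := by
    refine card_le_card fun b hb => ?_
    simp only [mem_filter, mem_sdiff, mem_univ, true_and] at hb ⊢
    exact ⟨hb.1, .inr hb⟩
  have h4 : #{b ∈ univ \ Z | NearStart r Z t w z b} + #{b ∈ Z | NearStart r Z t w z b} =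
      #{b | NearStart r Z t w z b} := by
    rw [← card_union_of_disjoint, ← filter_union, sdiff_union_of_subset (subset_univ Z)]
    exact disjoint_filter_filter sdiff_disjoint
  omega

theorem card_nearEnd (h : CritPath r S Z n t w z) : n ≤ #{b | NearEnd r Z t w z b} + 1 := by
  have := h.reverse.card_nearStart
  simpa only [nearStart_reverse] using this

theorem not_nearEnd (h : CritPath r S Z n t w z) {i : ℕ} (hi : i < t) (h0 : r (w 0) (z i)) (b : β)
    (hb : NearEnd r Z t w z b) : ¬ r (w i) b := by
  intro hr
  have h' := h.rotate hi h0
  rcases hb with ⟨k, hk, hkt, hk', rfl⟩ | ⟨hb, hbt⟩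
  · have := h.le_of_chords hi (by omega) h0 hk'
    refine h'.cross hk hkt ?_ ?_
    · simpa [show ¬ k < i by omega] using hr
    · simpa [show ¬ k - 1 < i by omega, hi.not_ge] using hk'
  · exact h'.ends (o := b) hb (by simpa using hr) (by simpa [hi.not_ge] using hbt)

theorem not_nearStart (h : CritPath r S Z n t w z) {i : ℕ} (hi : 1 ≤ i) (hit : i ≤ t)
    (ht : r (w t) (z (i - 1))) (b : β) (hb : NearStart r Z t w z b) : ¬ r (w i) b := by
  have := h.reverse.not_nearEnd (i := t - i) (by omega)
    (by simpa [show t - 1 - (t - i) = i - 1 by omega] using ht) b ((nearEnd_reverse b).2 hb)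
  simpa [show t - (t - i) = i by omega] using this

/-- Skipping an inner vertex of the path by way of a chord `y`. -/
theorem not_skip (h : CritPath r S Z n t w z) {x : α} (hx : x ∉ S) {c b : β} (hc : c ∉ Z)
    (hb : b ∉ Z) (h0c : r (w 0) c) (hxc : r x c) (htb : r (w t) b) (hxb : r x b) {k : ℕ}
    (hk : 1 ≤ k) (hkt : k < t) {y : ℕ} (hy : y = k - 1 ∨ y = k) (h1 : r (w (k - 1)) (z y))
    (h2 : r (w (k + 1)) (z y)) : False := by
  have htn := h.htn
  have hn := h.hn
  have hp := (h.seg (Nat.zero_le (k - 1)) (by omega)).join (h.seg (i := k + 1) (by omega) le_rfl)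
    (z := z y) h1 h2 (h.disjoint_w (by omega) le_rfl (by omega))
    (h.disjoint_z (by omega) le_rfl (by omega))
    (by rw [h.mem_z (by omega) (by omega)]; omega) (by rw [h.mem_z (by omega) (by omega)]; omega)
  have hcZ : ∀ o ∉ Z, o ∉ insert (z y) (z '' Set.Ico 0 (k - 1) ∪ z '' Set.Ico (k + 1) t) := by
    rintro o ho (rfl | h' | h')
    · exact ho (h.memz y (by omega))
    · exact h.not_mem_z ho (by omega) h'
    · exact h.not_mem_z ho (by omega) h'
  refine h.red ((hp.join (.point r x) htb hxb ?_ (by simp) (hcZ b hb) (by simp)).cycle (z := c)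
    ?_ h0c hxc (by omega) (by omega))
  · rw [Set.disjoint_union_left]
    exact ⟨h.disjoint_point hx (by omega), h.disjoint_point hx le_rfl⟩
  · rw [Set.union_empty]
    rintro (rfl | h')
    · exact h.ends hc h0c htb
    · exact hcZ c hc h'

theorem not_out_out_of_chord (h : CritPath r S Z n t w z) {x : α} (hx : x ∉ S) {c b : β}
    (hc : c ∉ Z) (hb : b ∉ Z) (h0c : r (w 0) c) (hxc : r x c) (htb : r (w t) b) (hxb : r x b)
    (h1 : r (w 0) (z (t - 1))) : False := by
  have htn := h.htn
  have hn := h.hn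
  have hskip := fun {k} => h.not_skip hx hc hb h0c hxc htb hxb (k := k)
  have hwt : ∀ j, j + 1 < t → ¬ r (w t) (z j) := by
    intro j hj hr
    have := h.le_of_chords (by omega) (by omega) h1 hr
    omega
  have hz1 : ¬ r (w 0) (z 1) := fun h' =>
    hskip (k := 1) le_rfl (by omega) (.inr rfl) h' (h.right 1 (by omega))
  have hz2 : r (w 0) (z 2) := by
    have := h.unique_index (k := 1) (k' := 2) le_rfl (by omega) (by omega) (by omega) (by omega)
    have h3 := hwt 0 (by omega)
    have h4 := hwt 1 (by omega)
    tauto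
  have := (h.rotate (by omega) hz2).unique_index (k := 1) (k' := 3) le_rfl (by omega) (by omega)
    (by omega) (by omega)
  simp only [Nat.zero_le, if_true, show ¬ t ≤ 2 by omega, if_false,
    show ((1 : ℕ) < 2) by omega, show ¬ ((3 : ℕ) < 2) by omega,
    show ((0 : ℕ) < 2) by omega, show (2 - 1 - 1 : ℕ) = 0 by omega, show (2 - 1 : ℕ) = 1 by omega,
    show (3 - 1 : ℕ) = 2 by omega, show ¬ ((2 : ℕ) < 2) by omega] at this
  rcases this with h' | h' | h' | h'
  · exact hskip (k := 1) le_rfl (by omega) (.inl rfl) (h.left 0 (by omega)) h'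
  · exact hwt 1 (by omega) h'
  · exact hskip (k := 3) (by omega) (by omega) (.inr rfl) h' (h.right 3 (by omega))
  · exact hwt 2 (by omega) h'

theorem not_out_out (h : CritPath r S Z n t w z) {x : α} (hx : x ∉ S) {c b : β}
    (hc : c ∉ Z) (hb : b ∉ Z) (h0c : r (w 0) c) (hxc : r x c) (htb : r (w t) b) (hxb : r x b) :
    False := by
  have htn := h.htn
  have hn := h.hn
  have := h.unique_index (k := 1) (k' := t - 1) le_rfl (by omega) (by omega) (by omega) (by omega)
  rcases this with h' | h' | h' | h'
  · exact h.not_skip hx hc hb h0c hxc htb hxb (k := 1) le_rfl (by omega) (.inr rfl) h'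
      (h.right 1 (by omega))
  · exact h.reverse.not_out_out_of_chord hx hb hc (by simpa using htb) hxb (by simpa using h0c) hxc
      (by simpa using h')
  · exact h.not_out_out_of_chord hx hc hb h0c hxc htb hxb h'
  · refine h.not_skip hx hc hb h0c hxc htb hxb (k := t - 1) (by omega) (by omega) (.inl rfl)
      (h.left (t - 1 - 1) (by omega)) ?_
    rwa [show t - 1 + 1 = t by omega]

theorem not_chord_out (h : CritPath r S Z n t w z) {x : α} (hx : x ∉ S) {l : ℕ} (hl : l + 1 < t)
    (h0 : r (w 0) (z (l + 1))) (hxl : r x (z l)) {b : β} (hb : b ∉ Z) (htb : r (w t) b)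
    (hxb : r x b) : False := by
  have htn := h.htn
  have hn := h.hn
  have hp := (h.seg' (Nat.zero_le l) (by omega)).join (h.seg (i := l + 2) (by omega) le_rfl)
    (z := z (l + 1)) h0 (h.right _ hl) (h.disjoint_w (by omega) le_rfl (by omega))
    (h.disjoint_z (by omega) le_rfl (by omega))
    (by rw [h.mem_z (by omega) (by omega)]; omega) (by rw [h.mem_z (by omega) (by omega)]; omega)
  refine h.red ((hp.join (.point r x) htb hxb ?_ (by simp) ?_ (by simp)).cycle (z := z l)
    ?_ (h.left l (by omega)) hxl (by omega) (by omega))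
  · rw [Set.disjoint_union_left]
    exact ⟨h.disjoint_point hx (by omega), h.disjoint_point hx le_rfl⟩
  · rintro (rfl | h' | h')
    · exact hb (h.memz _ hl)
    · exact h.not_mem_z hb (by omega) h'
    · exact h.not_mem_z hb (by omega) h'
  · rw [Set.union_empty]
    rintro (rfl | h' | h' | h')
    · exact hb (h.memz _ (by omega))
    · have := h.injz l (by omega) (l + 1) hl h'
      omega
    · rw [h.mem_z (by omega) (by omega)] at h'
      omega
    · rw [h.mem_z (by omega) (by omega)] at h'
      omega

theorem not_chord_chord (h : CritPath r S Z n t w z) {x : α} (hx : x ∉ S) {l k : ℕ}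
    (hl : l + 1 < t) (h0 : r (w 0) (z (l + 1))) (hxl : r x (z l)) (hk : 1 ≤ k) (hkt : k < t)
    (ht : r (w t) (z (k - 1))) (hxk : r x (z k)) : False := by
  have htn := h.htn
  have hn := h.hn
  have hlk := h.le_of_chords hl (by omega) h0 ht
  have hnf : ¬ r (w t) (z 0) := by
    intro h'
    have := h.le_of_chords hl (by omega) h0 h'
    omega
  obtain ⟨o, ho, hto, hko⟩ := h.share' hk hkt.le ht (by omega) hnf
  have hp := (h.seg' (Nat.zero_le l) (by omega)).join (h.seg (i := l + 2) (j := k) (by omega)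
    (by omega))
    (z := z (l + 1)) h0 (h.right _ hl) (h.disjoint_w (by omega) (by omega) (by omega))
    (h.disjoint_z (by omega) (by omega) (by omega))
    (by rw [h.mem_z (by omega) (by omega)]; omega) (by rw [h.mem_z (by omega) (by omega)]; omega)
  have hp' := hp.join (h.seg' (i := k + 1) (by omega) le_rfl) hko hto
    (by
      rw [Set.disjoint_union_left]
      exact ⟨h.disjoint_w (by omega) (by omega) (by omega),
        h.disjoint_w (by omega) (by omega) (by omega)⟩)
    (by
      rw [Set.disjoint_insert_left, Set.disjoint_union_left, h.mem_z (by omega) (by omega)]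
      exact ⟨by omega, h.disjoint_z (by omega) (by omega) (by omega),
        h.disjoint_z (by omega) (by omega) (by omega)⟩)
    (by
      rintro (rfl | h' | h')
      · exact ho (h.memz _ hl)
      · exact h.not_mem_z ho (by omega) h'
      · exact h.not_mem_z ho (by omega) h')
    (h.not_mem_z ho (by omega))
  have hmem : ∀ a, a = l ∨ a = k → z a ∉ insert o (insert (z (l + 1))
      (z '' Set.Ico 0 l ∪ z '' Set.Ico (l + 2) k) ∪ z '' Set.Ico (k + 1) t) := by
    intro a ha
    have hat : a < t := by omega
    rintro (rfl | (h' | h' | h') | h')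
    · exact ho (h.memz _ hat)
    · have := h.injz a hat (l + 1) hl h'
      omega
    · rw [h.mem_z hat (by omega)] at h'
      omega
    · rw [h.mem_z hat (by omega)] at h'
      omega
    · rw [h.mem_z hat (by omega)] at h'
      omega
  refine h.red ((hp'.join (.point r x) (h.right k hkt) hxk ?_ (by simp) (hmem k (.inr rfl))
    (by simp)).cycle (z := z l) ?_ (h.left l (by omega)) hxl (by omega) (by omega))
  · rw [Set.disjoint_union_left, Set.disjoint_union_left]
    exact ⟨⟨h.disjoint_point hx (by omega), h.disjoint_point hx (by omega)⟩,
      h.disjoint_point hx le_rfl⟩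
  · rw [Set.union_empty]
    rintro (h' | h')
    · have := h.injz l (by omega) k hkt h'
      omega
    · exact hmem l (.inl rfl) h'

/-- A path on `n` vertices of degree at least `n` forces a monochromatic cycle of length `2n`. -/
theorem false [Fintype α] (h : CritPath r S Z n t w z) (hα : Fintype.card α = 2 * n) : False := by
  have htn := h.htn
  have hn := h.hn
  obtain ⟨x₀, hx₀⟩ : ∃ x₀ : α, ∀ i, 1 ≤ i → i < t → w i ≠ x₀ →
      r (w 0) (z i) ∨ r (w t) (z (i - 1)) := by
    by_cases hU : ∃ k, 1 ≤ k ∧ k < t ∧ ¬ r (w 0) (z k) ∧ ¬ r (w t) (z (k - 1))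
    · obtain ⟨k, hk, hkt, h1, h2⟩ := hU
      refine ⟨w k, fun i hi hit hne => ?_⟩
      have := h.unique_index hk hkt hi hit (by rintro rfl; exact hne rfl)
      tauto
    · push Not at hU
      refine ⟨w 0, fun i hi hit _ => ?_⟩
      have := hU i hi hit
      tauto
  refine not_split (r := r) hn hα h.tight.card h.red h.blue (B := {b | NearStart r Z t w z b})
    (B' := {b | NearEnd r Z t w z b}) h.card_nearStart h.card_nearEnd x₀ fun x hx => ?_
  simp only [mem_filter, mem_univ, true_and]
  by_cases hxS : x ∈ S
  · obtain ⟨i, hi, rfl⟩ : ∃ i ≤ t, w i = x := by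
      have : (range (t + 1)).image w = S := by
        refine eq_of_subset_of_card_le (fun b hb => ?_) ?_
        · obtain ⟨i, hi, rfl⟩ := mem_image.1 hb
          exact h.memw i (by simpa [Nat.lt_succ_iff] using hi)
        · rw [card_image_of_injOn, card_range, h.tight.cardS]
          intro i hi j hj e
          exact h.injw i (by simpa [Nat.lt_succ_iff] using hi) j
            (by simpa [Nat.lt_succ_iff] using hj) e
      rw [← this] at hxS
      obtain ⟨i, hi, rfl⟩ := mem_image.1 hxS
      exact ⟨i, by simpa [Nat.lt_succ_iff] using hi, rfl⟩
    rcases Nat.eq_zero_or_pos i with rfl | hi0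
    · exact .inr (h.not_nearEnd (by omega) (h.left 0 (by omega)))
    rcases hi.eq_or_lt with rfl | hit
    · refine .inl (h.not_nearStart hi0 le_rfl ?_)
      have := h.right (i - 1) (by omega)
      rwa [show i - 1 + 1 = i by omega] at this
    · rcases hx₀ i hi0 hit hx with h' | h'
      · exact .inr (h.not_nearEnd hit h')
      · exact .inl (h.not_nearStart hi0 hi h')
  · by_contra! hcon
    obtain ⟨⟨c, hc, hxc⟩, b, hb, hxb⟩ := hcon
    rcases hc with ⟨l, hl, h0, rfl⟩ | ⟨hc, h0⟩ <;> rcases hb with ⟨k, hk, hkt, ht, rfl⟩ | ⟨hb, ht⟩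
    · exact h.not_chord_chord hxS hl h0 hxc hk hkt ht hxb
    · exact h.not_chord_out hxS hl h0 hxc hb ht hxb
    · refine h.reverse.not_chord_out hxS (l := t - 1 - k) (by omega) ?_ ?_ hc (by simpa using h0)
        hxc
      · simpa [show t - 1 - (t - 1 - k + 1) = k - 1 by omega] using ht
      · simpa [show t - 1 - (t - 1 - k) = k by omega] using hxb
    · exact h.not_out_out hxS hc hb h0 hxc ht hxb

end CritPath

end Final

section Links

open Finset

variable {α β : Type*}

/-- A two-step instance of Menger's theorem. -/
theorem exists_disjoint_links [Nonempty α] {p : α → β → Prop} {q : α → β → Prop}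
    (hx : ∀ x₀, ∃ x b c, x ≠ x₀ ∧ p x b ∧ q x c) (hb : ∀ b₀, ∃ x b c, b ≠ b₀ ∧ p x b ∧ q x c)
    (hc : ∀ c₀, ∃ x b c, c ≠ c₀ ∧ p x b ∧ q x c) :
    ∃ x b c x' b' c', p x b ∧ q x c ∧ p x' b' ∧ q x' c' ∧ x ≠ x' ∧ b ≠ b' ∧ c ≠ c' := by
  by_contra! H
  have H' : ∀ x b c x' b' c', p x b → q x c → p x' b' → q x' c' → x = x' ∨ b = b' ∨ c = c' := by
    intro x b c x' b' c' h₁ h₂ h₃ h₄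
    by_contra! h
    exact h.2.2 (H x b c x' b' c' h₁ h₂ h₃ h₄ h.1 h.2.1)
  obtain ⟨x₀⟩ := ‹Nonempty α›
  obtain ⟨x₁, b₁, c₁, -, hp₁, hq₁⟩ := hx x₀
  obtain ⟨x₂, b₂, c₂, hx₂, hp₂, hq₂⟩ := hx x₁
  obtain ⟨x₃, b₃, c₃, hb₃, hp₃, hq₃⟩ := hb b₁
  obtain ⟨x₄, b₄, c₄, hc₄, hp₄, hq₄⟩ := hc c₁
  grind

variable {r : α → β → Prop} {n : ℕ}

theorem hasAltCycle_of_links [DecidableEq α] [DecidableEq β] (hn : 5 ≤ n) {S T : Finset α}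
    {Y Z : Finset β} (hST : Disjoint S T) (hYZ : Disjoint Y Z) (hc : #S + #T = n)
    (hS : S.Nonempty) (hT : T.Nonempty) (hY : n ≤ #Y) (hZ : n ≤ #Z)
    (hSY : ∀ a ∈ S, ∀ b ∈ Y, r a b) (hTZ : ∀ a ∈ T, ∀ b ∈ Z, r a b) {x x' : α} {b b' c c' : β}
    (hx : x ∉ S) (hxT : x ∉ T) (hx' : x' ∉ S) (hxT' : x' ∉ T) (hxx : x ≠ x') (hb : b ∈ Y)
    (hb' : b' ∈ Y) (hbb : b ≠ b') (hc : c ∈ Z) (hc' : c' ∈ Z) (hcc : c ≠ c') (h₁ : r x b)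
    (h₂ : r x c) (h₃ : r x' b') (h₄ : r x' c') : HasAltCycle r n := by
  have hS0 := hS.card_pos
  have hT0 := hT.card_pos
  obtain ⟨k, l, hkl, hk, hkS, hl, hlT⟩ :
      ∃ k l, k + l + 2 = n ∧ 1 ≤ k ∧ k ≤ #S ∧ 1 ≤ l ∧ l ≤ #T := by
    by_cases h : #S + 3 ≤ n
    · exact ⟨#S, n - 2 - #S, by omega⟩
    · exact ⟨n - 3, 1, by omega⟩
  obtain ⟨P, hPS, rfl⟩ := exists_subset_card_eq hkS
  obtain ⟨P', hPT, rfl⟩ := exists_subset_card_eq hlT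
  obtain ⟨u, hu⟩ := card_pos.1 hk
  obtain ⟨u', hu'⟩ := card_pos.1 hl
  have hQ : #(Y \ {b, b'}) = #Y - 2 := by
    rw [card_sdiff_of_subset (by simp [insert_subset_iff, hb, hb']), card_pair hbb]
  have hQ' : #(Z \ {c, c'}) = #Z - 2 := by
    rw [card_sdiff_of_subset (by simp [insert_subset_iff, hc, hc']), card_pair hcc]
  obtain ⟨v, hv, p⟩ := AltPath.of_complete (r := r) (P := P) (Q := Y \ {b, b'})
    (fun a ha y hy => hSY a (hPS ha) y (mem_sdiff.1 hy).1) (by omega) hu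
  obtain ⟨v', hv', p'⟩ := AltPath.of_complete (r := r) (P := P') (Q := Z \ {c, c'})
    (fun a ha y hy => hTZ a (hPT ha) y (mem_sdiff.1 hy).1) (by omega) hu'
  have e₁ : x ∉ P := fun h => hx (hPS h)
  have e₂ : x ∉ P' := fun h => hxT (hPT h)
  have e₃ : x' ∉ P := fun h => hx' (hPS h)
  have e₄ : x' ∉ P' := fun h => hxT' (hPT h)
  have e₅ : c ∉ Y := fun h => disjoint_left.1 hYZ h hc
  have e₆ : c' ∉ Y := fun h => disjoint_left.1 hYZ h hc'
  have e₇ : b ∉ Z := fun h => disjoint_left.1 hYZ hb h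
  have e₈ : b' ∉ Z := fun h => disjoint_left.1 hYZ hb' h
  have e₉ : Disjoint (P : Set α) P' := disjoint_coe.2 (hST.mono hPS hPT)
  have e₁₀ : Disjoint ((Y \ {b, b'} : Finset β) : Set β) (Z \ {c, c'} : Finset β) :=
    disjoint_coe.2 (hYZ.mono sdiff_subset sdiff_subset)
  have e₁₁ : Disjoint ((Y : Set β) \ {b'}) (Z \ {c, c'}) :=
    (disjoint_coe.2 hYZ).mono Set.sdiff_subset Set.sdiff_subset
  have hbc : b ≠ c := fun h => e₇ (h ▸ hc)
  have hbc₂ : b ≠ c' := fun h => e₇ (h ▸ hc')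
  have hbc₃ : b' ≠ c := fun h => e₈ (h ▸ hc)
  have hbc₄ : b' ≠ c' := fun h => e₈ (h ▸ hc')
  refine ((((p.join (AltPath.point r x) (z := b) (hSY v (hPS hv) b hb) h₁ ?_ ?_ ?_ ?_).join p'
    (z := c) h₂ (hTZ _ (hPT hu') c hc) ?_ ?_ ?_ ?_).join (AltPath.point r x') (z := c')
    (hTZ _ (hPT hv') c' hc') h₄ ?_ ?_ ?_ ?_).cycle (z := b') ?_ (hSY u (hPS hu) b' hb') h₃)
    (by omega) (by omega)
  all_goals simp_all [Set.disjoint_insert_left, eq_comm]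

variable [Fintype α] [Fintype β]

theorem not_two_complete (hn : 5 ≤ n) (hα : Fintype.card α = 2 * n)
    (hβ : Fintype.card β = 2 * n) (hr : ¬ HasAltCycle r n)
    (hs : ¬ HasAltCycle (fun a b => ¬ r a b) n) {S T : Finset α} {Y Z : Finset β}
    (hST : Disjoint S T) (hYZ : Disjoint Y Z) (hc : #S + #T = n) (hS : S.Nonempty)
    (hT : T.Nonempty) (hY : n ≤ #Y) (hZ : n ≤ #Z) (hSY : ∀ a ∈ S, ∀ b ∈ Y, r a b)
    (hSZ : ∀ a ∈ S, ∀ b ∈ Z, ¬ r a b) (hTZ : ∀ a ∈ T, ∀ b ∈ Z, r a b)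
    (hTY : ∀ a ∈ T, ∀ b ∈ Y, ¬ r a b) : False := by
  classical
  obtain ⟨x₁, hx₁⟩ := hS
  have : Nonempty α := ⟨x₁⟩
  have key : ∀ x₀ B C, n ≤ #B + 1 → n ≤ #C + 1 →
      ∃ x b c, x ≠ x₀ ∧ b ∈ B ∧ c ∈ C ∧ r x b ∧ r x c := by
    intro x₀ B C hB hC
    by_contra! H
    refine not_split hn hα hβ hr hs hB hC x₀ fun x hx => ?_
    by_contra! h
    obtain ⟨⟨b, hb, hxb⟩, c, hc, hxc⟩ := h
    exact H x b c hx hb hc hxb hxc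
  obtain ⟨x, b, c, x', b', c', h₁, h₂, h₃, h₄, hx, hb, hc⟩ :=
    exists_disjoint_links (p := fun x b => b ∈ Y ∧ r x b) (q := fun x c => c ∈ Z ∧ r x c)
      (fun x₀ => by
        obtain ⟨x, b, c, h⟩ := key x₀ Y Z (by omega) (by omega)
        exact ⟨x, b, c, by tauto⟩)
      (fun b₀ => by
        obtain ⟨x, b, c, h⟩ := key x₁ (Y.erase b₀) Z
          (by have := pred_card_le_card_erase (s := Y) (a := b₀); omega) (by omega)
        rw [mem_erase] at h
        exact ⟨x, b, c, by tauto⟩)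
      (fun c₀ => by
        obtain ⟨x, b, c, h⟩ := key x₁ Y (Z.erase c₀)
          (by omega) (by have := pred_card_le_card_erase (s := Z) (a := c₀); omega)
        rw [mem_erase] at h
        exact ⟨x, b, c, by tauto⟩)
  exact hr (hasAltCycle_of_links hn hST hYZ ‹_› ⟨x₁, hx₁⟩ hT hY hZ hSY hTZ
    (fun h => hSZ x h c h₂.1 h₂.2) (fun h => hTY x h b h₁.1 h₁.2)
    (fun h => hSZ x' h c' h₄.1 h₄.2) (fun h => hTY x' h b' h₃.1 h₃.2) hx h₁.1 h₃.1 hb h₂.1 h₄.1 hc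
    h₁.2 h₂.2 h₃.2 h₄.2)

end Links

section Main

open Finset

open scoped Classical

variable {α β : Type*} {r : α → β → Prop} {S : Finset α} {n t : ℕ}

theorem AltPath.le_card {u v : α} {k : ℕ} {Z : Set β} (h : AltPath r u v k S Z) : k ≤ #S := by
  generalize hA : (S : Set α) = A at h
  induction h generalizing S with
  | single hu =>
    subst hA
    exact card_pos.2 ⟨_, hu⟩
  | @cons u _ _ _ _ _ _ hu _ _ _ _ ih =>
    subst hA
    have := ih (S := S.erase u) (by simp)
    rw [card_erase_of_mem (by simpa using hu)] at this
    have := card_pos.2 ⟨u, mem_coe.1 hu⟩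
    omega

/-- There is a longest alternating path. -/
theorem exists_longest (r : α → β → Prop) (hS : S.Nonempty) :
    ∃ t u v, AltPath r u v (t + 1) S Set.univ ∧
      ∀ u v k, AltPath r u v k S Set.univ → k ≤ t + 1 := by
  obtain ⟨a, ha⟩ := hS
  let p : ℕ → Prop := fun k => ∃ u v, AltPath r u v (k + 1) S Set.univ
  have h0 : p 0 := ⟨a, a, .single ha⟩
  obtain ⟨u, v, h⟩ := Nat.findGreatest_spec (P := p) (Nat.zero_le #S) h0
  refine ⟨_, u, v, h, fun u' v' k h' => ?_⟩
  have hk := h'.pos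
  have := Nat.le_findGreatest (P := p) (m := k - 1) (n := #S) (by have := h'.le_card; omega)
    ⟨u', v', by rwa [show k - 1 + 1 = k by omega]⟩
  omega

/-- A vertex sharing a neighbour with a cycle can be used to lengthen the cycle to a path. -/
theorem IsAltCycle.exists_altPath {w : ℕ → α} {z : ℕ → β} {k : ℕ} (h : IsAltCycle r w z k)
    (hw : ∀ i < k, w i ∈ S) {s : α} (hs : s ∈ S) (hsw : ∀ i < k, w i ≠ s) {i : ℕ} (hi : i < k)
    {b : β} (hib : r (w i) b) (hsb : r s b) : ∃ u v, AltPath r u v (k + 1) S Set.univ := by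
  have key : ∀ (w : ℕ → α) (z : ℕ → β), IsAltCycle r w z k → (∀ i < k, w i ∈ S) →
      (∀ i < k, w i ≠ s) → r (w 0) b → (∀ i < k - 1, z i ≠ b) →
      ∃ u v, AltPath r u v (k + 1) S Set.univ := by
    intro w z h hw hsw h0 hz
    have := (AltPath.point r s).join (h.isAltPath.seg (Nat.zero_le _) le_rfl) hsb h0
      (by
        rw [Set.disjoint_singleton_left]
        rintro ⟨j, hj, e⟩
        rw [Set.mem_Icc] at hj
        exact hsw j (by omega) e) (by simp) (by simp)
      (by
        rintro ⟨j, hj, e⟩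
        rw [Set.mem_Ico] at hj
        exact hz j hj.2 e)
    rw [show 1 + (k - 1 - 0 + 1) = k + 1 by omega] at this
    refine ⟨_, _, this.mono (Set.union_subset (by simpa using hs) ?_) (Set.subset_univ _)⟩
    rintro _ ⟨j, hj, rfl⟩
    rw [Set.mem_Icc] at hj
    exact hw j (by omega)
  by_cases hz : ∃ j < k, z j = b
  · obtain ⟨j, hj, rfl⟩ := hz
    rcases Nat.lt_or_ge (j + 1) k with hjk | hjk
    · have h' := h.rotate hjk
      refine key _ _ h' (fun i hi => ?_) (fun i hi => ?_) ?_ fun i hi e => ?_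
      · split_ifs <;> exact hw _ (by omega)
      · split_ifs <;> exact hsw _ (by omega)
      · simpa [hjk] using h.right j hj
      · split_ifs at e <;> [have := h.injz _ (by omega) _ hj e; have := h.injz _ (by omega) _ hj e]
          <;> omega
    · refine key _ _ h hw hsw ?_ fun i hi e => ?_
      · have := h.right j hj
        rwa [show j + 1 = k by omega, h.wrap] at this
      · have := h.injz _ (by omega) _ hj e
        omega
  · push Not at hz
    refine key _ _ (h.rotate hi) (fun i hi => ?_) (fun i hi => ?_) ?_ fun i hi => ?_
    · split_ifs <;> exact hw _ (by omega)
    · split_ifs <;> exact hsw _ (by omega)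
    · simpa [hi] using hib
    · split_ifs <;> exact hz _ (by omega)

theorem IsAltPath.isAltCycle {w : ℕ → α} {z : ℕ → β} (h : IsAltPath r w z t) {b : β}
    (hz : ∀ i < t, z i ≠ b) (h0 : r (w 0) b) (ht : r (w t) b) :
    IsAltCycle r (fun i => if i ≤ t then w i else w 0) (fun i => if i < t then z i else b)
      (t + 1) where
  left i hi := by
    rcases Nat.lt_succ_iff_lt_or_eq.1 hi with h' | rfl
    · simpa [h', h'.le] using h.left i h'
    · simpa using ht
  right i hi := by
    rcases Nat.lt_succ_iff_lt_or_eq.1 hi with h' | rfl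
    · simpa [h', Nat.succ_le_iff] using h.right i h'
    · simpa using h0
  wrap := by simp
  injw i hi j hj e := by
    rw [if_pos (by omega), if_pos (by omega)] at e
    exact h.injw i (by omega) j (by omega) e
  injz i hi j hj e := by
    split_ifs at e with h₁ h₂ h₂
    · exact h.injz i h₁ j h₂ e
    · exact absurd e (hz i h₁)
    · exact absurd e.symm (hz j h₂)
    · omega

variable [Fintype β]

/-- A longest path that closes up to a cycle splits the vertices of large degree. -/
theorem not_longest_cycle [Fintype α] (hn : 5 ≤ n) (hα : Fintype.card α = 2 * n)
    (hβ : Fintype.card β = 2 * n) (hr : ¬ HasAltCycle r n)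
    (hs : ¬ HasAltCycle (fun a b => ¬ r a b) n) (hS : #S = n)
    (hdeg : ∀ a ∈ S, n ≤ #{b | r a b})
    (hmax : ∀ u v k, AltPath r u v k S Set.univ → k ≤ t + 1) {w : ℕ → α} {z : ℕ → β}
    (h : IsAltCycle r w z (t + 1)) (hw : ∀ i < t + 1, w i ∈ S) : False := by
  let K := (range (t + 1)).image w
  have hKS : K ⊆ S := image_subset_iff.2 fun i hi => hw i (mem_range.1 hi)
  have hK : #K = t + 1 := by
    rw [card_image_of_injOn, card_range]
    intro i hi j hj e
    exact h.injw i (by simpa using hi) j (by simpa using hj) e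
  have hKn : t + 1 < n := by
    rcases (card_le_card hKS).lt_or_eq with h' | h'
    · omega
    · rw [hK, hS] at h'
      exact absurd (h' ▸ h.hasAltCycle (by omega)) hr
  have hT : #(S \ K) = n - (t + 1) := by rw [card_sdiff_of_subset hKS, hS, hK]
  have hdis : ∀ a ∈ K, ∀ s ∈ S \ K, ∀ b, r a b → ¬ r s b := by
    intro a ha s hs b hab hsb
    obtain ⟨i, hi, rfl⟩ := mem_image.1 ha
    rw [mem_sdiff] at hs
    obtain ⟨u, v, huv⟩ := h.exists_altPath hw hs.1
      (fun j hj e => hs.2 (mem_image.2 ⟨j, mem_range.2 hj, e⟩)) (mem_range.1 hi) hab hsb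
    have := hmax _ _ _ huv
    omega
  have hcompl : ∀ a ∈ K, ∀ s ∈ S \ K, ∀ b, ¬ r a b → r s b := by
    intro a ha s hs b hab
    by_contra hsb
    have h1 : #{b | r a b} + #{b | r s b} ≤ #(univ.erase b) := by
      rw [← card_union_of_disjoint]
      · refine card_le_card (union_subset ?_ ?_) <;> intro c hc <;> simp at hc ⊢ <;> rintro rfl <;>
          contradiction
      · exact disjoint_filter.2 fun c _ hc => hdis a ha s hs c hc
    have h2 := hdeg a (hKS ha)
    have h3 := hdeg s (mem_sdiff.1 hs).1
    rw [card_erase_of_mem (mem_univ _), card_univ] at h1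
    omega
  obtain ⟨a, ha⟩ : K.Nonempty := card_pos.1 (by omega)
  obtain ⟨s, hs'⟩ : (S \ K).Nonempty := card_pos.1 (by omega)
  refine not_two_complete (Y := {b | r a b}) (Z := {b | r s b}) hn hα hβ hr hs
    disjoint_sdiff (disjoint_filter.2 fun c _ hc => hdis a ha s hs' c hc) (by omega) ⟨a, ha⟩
    ⟨s, hs'⟩ (hdeg a (hKS ha)) (hdeg s (mem_sdiff.1 hs').1) (fun a' ha' b hb => ?_)
    (fun a' ha' b hb => ?_) (fun a' ha' b hb => ?_) (fun a' ha' b hb => ?_) <;>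
    simp only [mem_filter, mem_univ, true_and] at hb
  · by_contra h'
    exact hdis a ha s hs' b hb (hcompl a' ha' s hs' b h')
  · exact fun h' => hdis a' ha' s hs' b h' hb
  · exact hcompl a ha a' ha' b fun h' => hdis a ha s hs' b h' hb
  · exact hdis a ha a' ha' b hb

/-- In a colouring of `K_{2n,2n}` without monochromatic cycles of length `2n`, fewer than `n`
vertices have degree at least `n`. -/
theorem not_large_degree [Fintype α] (hn : 5 ≤ n) (hα : Fintype.card α = 2 * n)
    (hβ : Fintype.card β = 2 * n) (hr : ¬ HasAltCycle r n)
    (hs : ¬ HasAltCycle (fun a b => ¬ r a b) n) (hS : #S = n)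
    (hdeg : ∀ a ∈ S, n ≤ #{b | r a b}) : False := by
  obtain ⟨t, u, v, huv, hmax⟩ := exists_longest r (card_pos.1 (by omega : 0 < #S))
  have hβ' : Nonempty β := Fintype.card_pos_iff.1 (by omega)
  have hnc : ∀ u v (Z : Set β), AltPath r u v (t + 1) S Z → ∀ b ∉ Z, r u b → ¬ r v b := by
    intro u v Z h b hb hub hvb
    obtain ⟨w, z, hwz, rfl, rfl, hw, hz⟩ := h.exists_fun
    refine not_longest_cycle hn hα hβ hr hs hS hdeg hmax
      (hwz.isAltCycle (fun i hi e => hb (by rw [← e]; exact hz i hi)) hub hvb) fun i hi => ?_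
    rw [if_pos (by omega)]
    exact hw i (by omega)
  obtain ⟨w, z, hwz, rfl, rfl, hw, -⟩ := huv.exists_fun
  have hwS : (range (t + 1)).image w ⊆ S :=
    image_subset_iff.2 fun i hi => hw i (by rw [mem_range] at hi; omega)
  have hK : #((range (t + 1)).image w) = t + 1 := by
    rw [card_image_of_injOn, card_range]
    intro i hi j hj e
    simp only [coe_range, Set.mem_Iio] at hi hj
    exact hwz.injw i (by omega) j (by omega) e
  have hZ : #((range t).image z) = t := by
    rw [card_image_of_injOn, card_range]
    intro i hi j hj e
    simp only [coe_range, Set.mem_Iio] at hi hj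
    exact hwz.injz i (by omega) j (by omega) e
  have htn : t + 1 ≤ n := by rw [← hK, ← hS]; exact card_le_card hwS
  set S' := (range (t + 1)).image w with hS'
  set Z := (range t).image z with hZ'
  have H : Tight r S' Z n t := ⟨hK, hZ, htn, hβ, fun a ha => hdeg a (hwS ha),
    fun u v h b hb => hnc u v Z (h.mono (coe_subset.2 hwS) subset_rfl) b (by simpa using hb)⟩
  have P : IsPathOn r S' Z w z t := ⟨hwz,
    fun i hi => mem_image.2 ⟨i, mem_range.2 (by omega), rfl⟩,
    fun i hi => mem_image.2 ⟨i, mem_range.2 hi, rfl⟩⟩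
  rcases htn.eq_or_lt with htn' | htn'
  · exact CritPath.false ⟨P, hn, htn', H, hr, hs⟩ hα
  have hle := P.card_add_card_le H hn fun h => hs (h.mono_rel fun _ _ h => h.2)
  obtain ⟨s, hs'⟩ : (S \ S').Nonempty :=
    card_pos.1 (by rw [card_sdiff_of_subset hwS]; omega)
  rw [mem_sdiff] at hs'
  have hend : ∀ u v, AltPath r u v (t + 1) S' Z → ∀ b ∉ Z, r u b → ¬ r s b := by
    intro u v h b hb hub hsb
    have := (AltPath.point r s).join h hsb hub (by simpa using hs'.2) (by simp) (by simp)
      (by simpa using hb)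
    have := hmax _ _ _ (this.mono (Set.union_subset (by simpa using hs'.1) (coe_subset.2 hwS))
      (Set.subset_univ _))
    omega
  have p := P.altPath P.memw P.memz
  have h1 := H.card_out (P.memw 0 (by omega))
  have h2 := H.card_out (P.memw t le_rfl)
  have h3 := hdeg s hs'.1
  have h4 : #{b ∈ univ \ Z | r (w 0) b} + #{b ∈ univ \ Z | r (w t) b} + #{b | r s b} ≤
      #(univ : Finset β) := by
    rw [← card_union_of_disjoint, ← card_union_of_disjoint]
    · exact card_le_card (subset_univ _)
    · rw [disjoint_left]
      intro b
      simp only [mem_union, mem_filter, mem_sdiff, mem_univ, true_and]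
      rintro (⟨h5, h6⟩ | ⟨h5, h6⟩)
      · exact hend _ _ p b h5 h6
      · exact hend _ _ p.reverse b h5 h6
    · rw [disjoint_left]
      intro b
      simp only [mem_filter, mem_sdiff, mem_univ, true_and]
      rintro ⟨h5, h6⟩ ⟨-, h7⟩
      exact P.disjoint_ends H h5 h6 h7
  rw [card_univ, hβ] at h4
  omega

/-- Every red/blue colouring of `K_{2n,2n}` contains a monochromatic cycle of length `2n`. -/
theorem hasAltCycle_or_compl [Fintype α] (hn : 5 ≤ n) (hα : Fintype.card α = 2 * n)
    (hβ : Fintype.card β = 2 * n) (r : α → β → Prop) :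
    HasAltCycle r n ∨ HasAltCycle (fun a b => ¬ r a b) n := by
  by_contra! H
  have key : ∀ s : α → β → Prop, ¬ HasAltCycle s n → ¬ HasAltCycle (fun a b => ¬ s a b) n →
      #{a | n ≤ #{b | s a b}} < n := by
    intro s h h'
    by_contra! hc
    obtain ⟨S, hS, hSn⟩ := exists_subset_card_eq hc
    exact not_large_degree hn hα hβ h h' hSn fun a ha => (mem_filter.1 (hS ha)).2
  have h1 := key r H.1 H.2
  have h2 : #{a | n ≤ #{b | ¬ r a b}} < n := by
    convert key (fun a b => ¬ r a b) H.2 fun h => H.1 (h.mono_rel fun _ _ => not_not.1)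
  have h3 : (univ : Finset α) ⊆ ({a | n ≤ #{b | r a b}} : Finset α) ∪
      ({a | n ≤ #{b | ¬ r a b}} : Finset α) := by
    intro a _
    have := card_filter_add_card_filter_not (s := (univ : Finset β)) (fun b => r a b)
    rw [card_univ] at this
    simp only [mem_union, mem_filter, mem_univ, true_and]
    omega
  have h4 := (card_le_card h3).trans (card_union_le _ _)
  rw [card_univ] at h4
  omega

end Main

section Graph

open Finset

variable {α β : Type*} {r : α → β → Prop} {G : SimpleGraph (α ⊕ β)}

theorem AltPath.exists_walk {u v : α} {k : ℕ} {A : Set α} {Z : Set β} (h : AltPath r u v k A Z)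
    (hG : ∀ a b, r a b → G.Adj (.inl a) (.inr b)) :
    ∃ p : G.Walk (.inl u) (.inl v), p.IsPath ∧ p.length + 2 = 2 * k ∧
      (∀ a, .inl a ∈ p.support → a ∈ A) ∧ ∀ b, .inr b ∈ p.support → b ∈ Z := by
  induction h with
  | single hu => exact ⟨.nil, by simp, by simp, by simpa using hu, by simp⟩
  | cons hu hz h h' _ ih =>
    obtain ⟨p, hp, hl, hA, hZ⟩ := ih
    refine ⟨.cons (hG _ _ h) (.cons (hG _ _ h').symm p), ?_, ?_, fun a ha => ?_, fun b hb => ?_⟩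
    · rw [SimpleGraph.Walk.cons_isPath_iff, SimpleGraph.Walk.cons_isPath_iff]
      refine ⟨⟨hp, fun hb => (hZ _ hb).2 rfl⟩, fun ha => ?_⟩
      rw [SimpleGraph.Walk.support_cons, List.mem_cons] at ha
      exact ha.elim (by simp) fun ha => (hA _ ha).2 rfl
    · simp only [SimpleGraph.Walk.length_cons]
      omega
    · simp only [SimpleGraph.Walk.support_cons, List.mem_cons, Sum.inl.injEq, reduceCtorEq,
        false_or] at ha
      rcases ha with rfl | ha
      · exact hu
      · exact (hA a ha).1
    · simp only [SimpleGraph.Walk.support_cons, List.mem_cons, Sum.inr.injEq, reduceCtorEq,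
        false_or] at hb
      rcases hb with rfl | hb
      · exact hz
      · exact (hZ b hb).1

theorem HasAltCycle.hasCycleLength {k : ℕ} (h : HasAltCycle r k)
    (hG : ∀ a b, r a b → G.Adj (.inl a) (.inr b)) : hasCycleLength G (2 * k) := by
  obtain ⟨u, v, z, A, Z, h, hz, hu, hv, hk⟩ := h
  have hne : u ≠ v := by
    cases h with
    | single _ => omega
    | cons _ _ _ _ hp => exact fun e => hp.right_mem.2 e.symm
  obtain ⟨p, hp, hl, -, hZ⟩ := h.exists_walk hG
  refine ⟨.inl v, .cons (hG _ _ hv) (.cons (hG _ _ hu).symm p), ?_, ?_⟩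
  · rw [SimpleGraph.Walk.cons_isCycle_iff, SimpleGraph.Walk.cons_isPath_iff]
    refine ⟨⟨hp, fun hb => hz (hZ _ hb)⟩, fun he => ?_⟩
    rw [SimpleGraph.Walk.edges_cons, List.mem_cons] at he
    rcases he with he | he
    · simp at he
      exact hne he.symm
    · exact hz (hZ _ (p.snd_mem_support_of_mem_edges he))
  · simp only [SimpleGraph.Walk.length_cons]
    omega

/-- A graph with a cut vertex and small blocks has no long cycles. -/
theorem not_hasCycleLength_of_label {V κ : Type*} [DecidableEq V] {G : SimpleGraph V}
    {l : ℕ} (f : V → κ) (s : V → Prop) (hs : ∀ x y, s x → s y → x = y)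
    (hf : ∀ x y, G.Adj x y → ¬ s x → ¬ s y → f x = f y)
    (hcard : ∀ c, ∀ T : Finset V, (∀ x ∈ T, ¬ s x ∧ f x = c) → #T + 1 < l) :
    ¬ hasCycleLength G l := by
  have key : ∀ (v : V) (p : G.Walk v v), p.IsCycle → p.length = l →
      (∀ i, 1 ≤ i → i < l → ¬ s (p.getVert i)) → False := by
    intro v p hp hl hns
    have hl3 := hp.three_le_length
    have hlab : ∀ i, i + 1 < l → f (p.getVert (i + 1)) = f (p.getVert 1) := by
      intro i
      induction i with
      | zero => simp
      | succ i ih =>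
        intro hi
        rw [← ih (by omega)]
        exact (hf _ _ (p.adj_getVert_succ (by omega)) (hns _ (by omega) (by omega))
          (hns _ (by omega) hi)).symm
    have := hcard (f (p.getVert 1)) ((Ico 1 l).image p.getVert) fun x hx => by
      obtain ⟨i, hi, rfl⟩ := mem_image.1 hx
      rw [mem_Ico] at hi
      refine ⟨hns i hi.1 hi.2, ?_⟩
      have := hlab (i - 1) (by omega)
      rwa [show i - 1 + 1 = i by omega] at this
    rw [card_image_of_injOn, Nat.card_Ico] at this
    · omega
    · intro i hi j hj e
      rw [coe_Ico, Set.mem_Ico] at hi hj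
      exact hp.getVert_injOn ⟨hi.1, by omega⟩ ⟨hj.1, by omega⟩ e
  rintro ⟨v, p, hp, hl⟩
  by_cases h : ∃ x ∈ p.support, s x
  · obtain ⟨x, hx, hsx⟩ := h
    refine key x (p.rotate x hx) (hp.rotate hx) (by simpa using hl) fun i hi hil hsi => ?_
    have e := (hs _ _ hsi hsx).trans (p.rotate x hx).getVert_length.symm
    have hl' : (p.rotate x hx).length = l := by simpa using hl
    have := (hp.rotate hx).getVert_injOn ⟨hi, by omega⟩ ⟨by omega, le_rfl⟩ e
    omega
  · push Not at h
    exact key v p hp hl fun i _ _ => h _ (p.getVert_mem_support i)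

/-- The common indexing of the two sides of `K_{N,N}`. -/
def sideIndex {N : ℕ} (x : Fin N ⊕ Fin N) : ℕ := x.elim Fin.val Fin.val

theorem card_lt_of_block {N m : ℕ} (hm : 0 < m) {T : Finset (Fin N ⊕ Fin N)}
    (h : ∀ x ∈ T, ∀ y ∈ T, x.isLeft = y.isLeft → sideIndex x / m = sideIndex y / m) :
    #T ≤ 2 * m := by
  have : #T ≤ #(univ ×ˢ range m : Finset (Bool × ℕ)) := by
    refine card_le_card_of_injOn (fun x => (x.isLeft, sideIndex x % m)) (fun x _ => ?_) ?_
    · cases x <;> simp [Nat.mod_lt _ hm]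
    · intro x hx y hy e
      simp only [Prod.mk.injEq] at e
      have h1 : sideIndex x = sideIndex y := by
        rw [← Nat.div_add_mod (sideIndex x) m, ← Nat.div_add_mod (sideIndex y) m, e.2,
          h x hx y hy e.1]
      rcases x with x | x <;> rcases y with y | y <;> simp_all [sideIndex, Fin.ext_iff]
  simpa [card_product] using this

/-- The subgraph of `K_{N,N}` determined by a relation. -/
def bipartiteOf {N : ℕ} (R : ℕ → ℕ → Prop) : SimpleGraph (Fin N ⊕ Fin N) where
  Adj x y := (x.isLeft ∧ y.isRight ∧ R (sideIndex x) (sideIndex y)) ∨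
    (y.isLeft ∧ x.isRight ∧ R (sideIndex y) (sideIndex x))
  symm := ⟨fun _ _ h => h.symm⟩
  loopless := ⟨by rintro (x | x) <;> simp⟩

/-- The extremal colouring of `K_{2m+1,2m+1}`. -/
theorem exists_coloring {N m : ℕ} (hm : 0 < m) (hN : N ≤ 2 * m + 1) :
    ∃ red : SimpleGraph (Fin N ⊕ Fin N), red ≤ completeBipartiteGraph (Fin N) (Fin N) ∧
      ¬ hasCycleLength red (2 * (m + 1)) ∧
      ¬ hasCycleLength (completeBipartiteGraph (Fin N) (Fin N) \ red) (2 * (m + 1)) := by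
  have hdiv : ∀ i : Fin N, (i : ℕ) ≠ 2 * m → (i : ℕ) / m < 2 := fun i hi =>
    (Nat.div_lt_iff_lt_mul hm).2 (by have := i.2; omega)
  have hdiv' : 2 * m / m = 2 := Nat.mul_div_cancel _ hm
  refine ⟨bipartiteOf fun i j => i = 2 * m ∨ i / m = j / m, ?_, ?_, ?_⟩
  · rintro (x | x) (y | y) h <;> simp_all [bipartiteOf]
  · refine not_hasCycleLength_of_label (fun x => sideIndex x / m)
      (fun x => x.isLeft ∧ sideIndex x = 2 * m) ?_ ?_ fun c T hT => ?_
    · rintro (x | x) (y | y) <;> simp [sideIndex, Fin.ext_iff]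
      omega
    · rintro (x | x) (y | y) <;> simp [sideIndex, bipartiteOf]
      · tauto
      · exact fun h h' => (h.resolve_left h').symm
    · have := card_lt_of_block (T := T) hm fun x hx y hy _ => (hT x hx).2.trans (hT y hy).2.symm
      omega
  · refine not_hasCycleLength_of_label
      (fun x => if x.isLeft then sideIndex x / m else 1 - sideIndex x / m)
      (fun x => x.isRight ∧ sideIndex x = 2 * m) ?_ ?_ fun c T hT => ?_
    · rintro (x | x) (y | y) <;> simp [sideIndex, Fin.ext_iff]
      omega
    · rintro (x | x) (y | y) <;> simp [sideIndex, bipartiteOf]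
      · intro h h' h''
        have h₁ := hdiv x h
        have h₂ := hdiv y h''
        generalize (x : ℕ) / m = a at *
        generalize (y : ℕ) / m = b at *
        omega
      · intro h h' h''
        have h₁ := hdiv x h''
        have h₂ := hdiv y h
        generalize (x : ℕ) / m = a at *
        generalize (y : ℕ) / m = b at *
        omega
    · have := card_lt_of_block (T := T) hm fun x hx y hy e => ?_
      · omega
      · have h1 := hT x hx
        have h2 := hT y hy
        rcases x with x | x <;> rcases y with y | y <;> simp [sideIndex] at h1 h2 e ⊢
        · omega
        · have := hdiv x h1.1
          have := hdiv y h2.1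
          omega

end Graph

/-- For `n ≥ 5`, the diagonal bipartite Ramsey number `br(C_{2n}, C_{2n})` equals `2n`:
`2n` is the least `N` such that every red/blue coloring of `K_{N,N}` contains a
monochromatic `C_{2n}`. -/
theorem bipartite_ramsey_cycles_diag (n : ℕ) (hn : 5 ≤ n) :
    IsLeast {N : ℕ |
      ∀ red : SimpleGraph (Fin N ⊕ Fin N),
        red ≤ completeBipartiteGraph (Fin N) (Fin N) →
          hasCycleLength red (2 * n) ∨
          hasCycleLength (completeBipartiteGraph (Fin N) (Fin N) \ red) (2 * n)}
      (2 * n) := by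
  refine ⟨fun red _ => ?_, fun N hN => ?_⟩
  · rcases hasAltCycle_or_compl hn (Fintype.card_fin _) (Fintype.card_fin _)
      fun i j : Fin (2 * n) => red.Adj (.inl i) (.inr j) with h | h
    · exact .inl (h.hasCycleLength fun _ _ h => h)
    · exact .inr (h.hasCycleLength fun a b h => by simpa using h)
  · by_contra! h
    obtain ⟨m, rfl⟩ : ∃ m, n = m + 1 := ⟨n - 1, by omega⟩
    obtain ⟨red, hle, h1, h2⟩ := exists_coloring (N := N) (m := m) (by omega) (by omega)
    exact (hN red hle).elim h1 h2
end

section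
/- Let G be a bipartite graph with parts A and B, |A| = |B| ≥ m ≥ 4. If a red/blue edge-coloring of the complete bipartite graph on (A, B) contains no red C_{2m}, then some connected component of the blue graph, with vertex sets A_1 ⊆ A and B_1 ⊆ B, satisfies |A_1| + |B_1| ≥ |A|. -/
/-- The graph `H` has a cyclic sequence of consecutively adjacent vertices visiting every vertex of
`X` exactly once and no other vertex. -/
def HasSpanningCycle {V : Type*} (H : SimpleGraph V) (X : Finset V) : Prop :=
  ∃ l : List V, l.Nodup ∧ (∀ x, x ∈ l ↔ x ∈ X) ∧ l.IsChain H.Adj ∧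
    ∀ x ∈ l.getLast?, ∀ y ∈ l.head?, H.Adj x y

section

variable {V : Type*} {H : SimpleGraph V} {X : Finset V}

theorem HasSpanningCycle.hasCycleLength [DecidableEq V] (h : HasSpanningCycle H X)
    (hX : 3 ≤ X.card) : hasCycleLength H X.card := by
  obtain ⟨l, hnd, hmem, hch, hcl⟩ := h
  have hlen : l.length = X.card := by
    rw [← List.toFinset_card_of_nodup hnd]
    congr 1
    ext x
    simp [hmem]
  have hne : l ≠ [] := by
    rintro rfl
    simp at hlen
    omega
  have hadj : H.Adj (l.getLast hne) (l.head hne) :=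
    hcl _ (by simp [List.getLast?_eq_getLast_of_ne_nil hne]) _
      (by simp [List.head?_eq_some_head hne])
  have hp : (SimpleGraph.Walk.ofSupport l hne hch).IsPath := by
    rw [SimpleGraph.Walk.isPath_def, SimpleGraph.Walk.support_ofSupport]
    exact hnd
  refine ⟨_, .cons hadj (.ofSupport l hne hch), ?_, ?_⟩
  · rw [SimpleGraph.Walk.cons_isCycle_iff]
    refine ⟨hp, fun hmem' => ?_⟩
    have := hp.length_eq_one_of_mem_edges (Sym2.eq_swap ▸ hmem')
    rw [SimpleGraph.Walk.length_ofSupport] at this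
    omega
  · rw [SimpleGraph.Walk.length_cons, SimpleGraph.Walk.length_ofSupport]
    omega

/-- A spanning cycle can be started at any prescribed vertex. -/
theorem HasSpanningCycle.exists_cons (h : HasSpanningCycle H X) {a : V} (ha : a ∈ X) :
    ∃ t : List V, (a :: t).Nodup ∧ (∀ x, x ∈ a :: t ↔ x ∈ X) ∧ (a :: t).IsChain H.Adj ∧
      ∀ x ∈ (a :: t).getLast?, H.Adj x a := by
  obtain ⟨l, hnd, hmem, hch, hcl⟩ := h
  obtain ⟨p, q, rfl⟩ := List.append_of_mem ((hmem a).2 ha)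
  refine ⟨q ++ p, ?_, ?_, ?_, ?_⟩
  · exact (List.perm_append_comm (l₁ := p) (l₂ := a :: q)).nodup_iff.1 hnd
  · intro x
    rw [← hmem]
    simp only [List.mem_append, List.mem_cons]
    tauto
  · rw [← List.cons_append, List.isChain_append]
    rw [List.isChain_append] at hch
    refine ⟨hch.2.1, hch.1, fun x hx y hy => hcl x ?_ y ?_⟩
    · rw [List.getLast?_append]
      simp [Option.mem_def.1 hx]
    · rw [List.head?_append]
      simp [Option.mem_def.1 hy]
  · rw [List.isChain_append] at hch
    intro x hx
    rcases p.eq_nil_or_concat with rfl | ⟨p', z, rfl⟩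
    · exact hcl x (by simpa using hx) a (by simp)
    · have : x = z := by
        simpa [eq_comm, List.getLast?_cons] using hx
      subst this
      exact hch.2.2 x (by simp) a (by simp)

/-- Rotation of a Hamiltonian path of a bipartite graph whose end vertices have large total
degree. -/
theorem hasSpanningCycle_of_path [DecidableEq V] [DecidableRel H.Adj] {s : V → Bool}
    (hs : ∀ x y, H.Adj x y → s x ≠ s y)
    {a b : V} (hsa : s a = true) (hsb : s b = false)
    (hdeg : (X.filter (s · = true)).card < (X.filter (H.Adj a)).card + (X.filter (H.Adj b)).card)
    {l : List V} (hnd : l.Nodup) (hmem : ∀ x, x ∈ l ↔ x ∈ X) (hch : l.IsChain H.Adj)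
    (hhead : l.head? = some a) (hlast : l.getLast? = some b) : HasSpanningCycle H X := by
  set f : ℕ → V := fun j => l.getD j a with hf
  have hfl : ∀ j (h : j < l.length), f j = l[j] := fun j h => by simp [hf, h]
  have hf0 : f 0 = a := by
    cases l <;> simp_all
  have hfn : f (l.length - 1) = b := by
    rw [List.getLast?_eq_getElem?] at hlast
    simp [hf, List.getD, hlast]
  set I := Finset.range (l.length - 1) with hI
  set S := I.filter (fun j => H.Adj a (f (j + 1))) with hS
  set T := I.filter (fun j => H.Adj b (f j)) with hT
  set P := I.filter (fun j => s (f j) = true) with hP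
  have hstep : ∀ j ∈ I, H.Adj (f j) (f (j + 1)) := by
    intro j hj
    rw [hI, Finset.mem_range] at hj
    rw [hfl j (by omega), hfl (j + 1) (by omega)]
    exact List.isChain_iff_getElem.1 hch j (by omega)
  have hidx : ∀ x ∈ X, ∃ j, j < l.length ∧ f j = x := by
    intro x hx
    obtain ⟨j, hj, rfl⟩ := List.mem_iff_getElem.1 ((hmem x).2 hx)
    exact ⟨j, hj, hfl j hj⟩
  have hST : S ∪ T ⊆ P := by
    intro j hj
    rcases Finset.mem_union.1 hj with h | h
    · rw [hS, Finset.mem_filter] at h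
      rw [hP, Finset.mem_filter]
      have h1 := hs _ _ h.2
      have h2 := hs _ _ (hstep j h.1)
      refine ⟨h.1, ?_⟩
      cases h3 : s (f j) <;> simp_all
    · rw [hT, Finset.mem_filter] at h
      rw [hP, Finset.mem_filter]
      have h1 := hs _ _ h.2
      refine ⟨h.1, ?_⟩
      simpa [hsb] using h1
  have hPc : P.card ≤ (X.filter (s · = true)).card := by
    refine Finset.card_le_card_of_injOn f ?_ ?_
    · intro j hj
      simp only [hP, hI, Finset.coe_filter, Finset.mem_range, Set.mem_ofPred_eq] at hj
      simp only [Finset.coe_filter, Set.mem_ofPred_eq]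
      refine ⟨(hmem _).1 ?_, hj.2⟩
      rw [hfl j (by omega)]
      exact List.getElem_mem _
    · intro i hi j hj hij
      simp only [hP, hI, Finset.coe_filter, Finset.mem_range, Set.mem_ofPred_eq] at hi hj
      rw [hfl i (by omega), hfl j (by omega)] at hij
      exact (hnd.getElem_inj_iff).1 hij
  have hSc : (X.filter (H.Adj a)).card ≤ S.card := by
    refine (Finset.card_le_card (t := S.image fun j => f (j + 1)) ?_).trans Finset.card_image_le
    intro x hx
    rw [Finset.mem_filter] at hx
    obtain ⟨j, hj, rfl⟩ := hidx x hx.1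
    rcases j with _ | j
    · rw [hf0] at hx
      exact (H.irrefl hx.2).elim
    · refine Finset.mem_image.2 ⟨j, ?_, rfl⟩
      simp only [hS, hI, Finset.mem_filter, Finset.mem_range]
      exact ⟨by omega, hx.2⟩
  have hTc : (X.filter (H.Adj b)).card ≤ T.card := by
    refine (Finset.card_le_card (t := T.image f) ?_).trans Finset.card_image_le
    intro x hx
    rw [Finset.mem_filter] at hx
    obtain ⟨j, hj, rfl⟩ := hidx x hx.1
    refine Finset.mem_image.2 ⟨j, ?_, rfl⟩
    simp only [hT, hI, Finset.mem_filter, Finset.mem_range]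
    refine ⟨?_, hx.2⟩
    by_contra hlt
    have : j = l.length - 1 := by omega
    rw [this, hfn] at hx
    exact H.irrefl hx.2
  have hinter : (S ∩ T).Nonempty := by
    rw [← Finset.card_pos]
    have := Finset.card_union_add_card_inter S T
    have := Finset.card_le_card hST
    omega
  obtain ⟨i, hi⟩ := hinter
  simp only [hS, hT, hI, Finset.mem_inter, Finset.mem_filter, Finset.mem_range] at hi
  obtain ⟨⟨hil, hai⟩, -, hbi⟩ := hi
  rw [hfl _ (by omega)] at hai hbi
  have hsplit := List.take_append_drop (i + 1) l
  have htake : (l.take (i + 1)).getLast? = some l[i] := by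
    rw [List.getLast?_take]
    simp [show i < l.length by omega]
  have hdrop : (l.drop (i + 1)).head? = some l[i + 1] := by
    rw [List.head?_drop]
    simp [show i + 1 < l.length by omega]
  have htake' : (l.take (i + 1)).head? = some a := by
    rw [List.head?_take]
    simp [hhead]
  have hdrop' : (l.drop (i + 1)).getLast? = some b := by
    rw [List.getLast?_drop]
    simp [hlast, show ¬ l.length ≤ i + 1 by omega]
  have hperm : ((l.take (i + 1)).reverse ++ l.drop (i + 1)).Perm l := by
    conv_rhs => rw [← hsplit]
    exact (List.reverse_perm _).append_right _
  refine ⟨(l.take (i + 1)).reverse ++ l.drop (i + 1), hperm.nodup_iff.2 hnd,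
    fun x => hperm.mem_iff.trans (hmem x), ?_, ?_⟩
  · rw [List.isChain_append, List.isChain_reverse]
    refine ⟨(hch.take _).imp fun _ _ h => h.symm, hch.drop _, ?_⟩
    intro x hx y hy
    rw [List.getLast?_reverse, htake'] at hx
    rw [hdrop] at hy
    cases hx
    cases hy
    exact hai
  · intro x hx y hy
    rw [List.getLast?_append, hdrop'] at hx
    rw [List.head?_append, List.head?_reverse, htake] at hy
    cases hx
    cases hy
    exact hbi

/-- Removing one edge from a spanning cycle leaves a spanning cycle or a spanning path. -/
theorem HasSpanningCycle.of_sup_edge [DecidableEq V] {a b : V} (ha : a ∈ X) (hX : 3 ≤ X.card)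
    (h : HasSpanningCycle (H ⊔ SimpleGraph.edge a b) X) :
    HasSpanningCycle H X ∨ ∃ l : List V, l.Nodup ∧ (∀ x, x ∈ l ↔ x ∈ X) ∧ l.IsChain H.Adj ∧
      l.head? = some a ∧ l.getLast? = some b := by
  obtain ⟨t, hnd, hmem, hch, hcl⟩ := h.exists_cons ha
  have hat : a ∉ t := (List.nodup_cons.1 hnd).1
  have htn : t.Nodup := (List.nodup_cons.1 hnd).2
  have hlen : (a :: t).length = X.card := by
    rw [← List.toFinset_card_of_nodup hnd]
    congr 1
    ext x
    simp [← hmem]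
  have hadj : ∀ x y, (H ⊔ SimpleGraph.edge a b).Adj x y → H.Adj x y ∨ (x = a ∧ y = b) ∨
      (x = b ∧ y = a) := by
    intro x y hxy
    rw [SimpleGraph.sup_adj, SimpleGraph.edge_adj] at hxy
    tauto
  rw [List.isChain_cons] at hch
  have hct : t.IsChain H.Adj := by
    rw [List.isChain_iff_getElem] at hch ⊢
    intro i hi
    rcases hadj _ _ (hch.2 i hi) with h | h | h
    · exact h
    · exact (hat (h.1 ▸ List.getElem_mem _)).elim
    · exact (hat (h.2 ▸ List.getElem_mem _)).elim
  have hne : t ≠ [] := by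
    rintro rfl
    simp at hlen
    omega
  have hheq := List.head?_eq_some_head hne
  have hleq := List.getLast?_eq_getLast_of_ne_nil hne
  have hhl : t.head hne ≠ t.getLast hne := by
    rw [List.head_eq_getElem, List.getLast_eq_getElem]
    intro heq
    have := (htn.getElem_inj_iff).1 heq
    simp at hlen
    omega
  have hleq' : (a :: t).getLast? = some (t.getLast hne) := by
    rw [List.getLast?_cons, hleq]
    rfl
  have h1 := hch.1 _ hheq
  have h2 := hcl _ hleq'
  have hha : t.head hne ≠ a := fun h => hat (h ▸ List.head_mem hne)
  have hla : t.getLast hne ≠ a := fun h => hat (h ▸ List.getLast_mem hne)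
  by_cases hhb : t.head hne = b
  · right
    refine ⟨a :: t.reverse, ?_, ?_, ?_, rfl, ?_⟩
    · simpa using hnd
    · simpa using hmem
    · rw [List.isChain_cons, List.isChain_reverse]
      refine ⟨?_, hct.imp fun _ _ h => h.symm⟩
      intro y hy
      rw [List.head?_reverse, hleq] at hy
      cases hy
      rcases hadj _ _ h2 with h | h | h
      · exact h.symm
      · exact (hla h.1).elim
      · exact (hhl (hhb.trans h.1.symm)).elim
    · rw [List.getLast?_cons, List.getLast?_reverse, hheq, hhb]
      rfl
  · have h1' : H.Adj a (t.head hne) := by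
      rcases hadj _ _ h1 with h | h | h
      · exact h
      · exact (hhb h.2).elim
      · exact (hha h.2).elim
    have hchain : (a :: t).IsChain H.Adj := by
      rw [List.isChain_cons]
      refine ⟨?_, hct⟩
      intro y hy
      rw [hheq] at hy
      cases hy
      exact h1'
    rcases hadj _ _ h2 with h | h | h
    · left
      refine ⟨a :: t, hnd, hmem, hchain, ?_⟩
      intro x hx y hy
      rw [hleq'] at hx
      cases hx
      cases hy
      exact h
    · exact (hla h.1).elim
    · right
      exact ⟨a :: t, hnd, hmem, hchain, rfl, by rw [hleq', h.1]⟩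

/-- Two disjoint sets of the same size admit an alternating enumeration. -/
theorem exists_alternating_list [DecidableEq V] (n : ℕ) :
    ∀ P Q : Finset V, Disjoint P Q → P.card = n → Q.card = n → ∃ l : List V, l.Nodup ∧ (∀ x, x ∈ l ↔ x ∈ P ∪ Q) ∧
      l.IsChain (fun x y => x ∈ P ∧ y ∈ Q ∨ x ∈ Q ∧ y ∈ P) ∧
      (∀ x ∈ l.head?, x ∈ P) ∧ ∀ x ∈ l.getLast?, x ∈ Q := by
  induction n with
  | zero =>
    intro P Q _ hP hQ
    rw [Finset.card_eq_zero] at hP hQ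
    subst hP hQ
    exact ⟨[], by simp⟩
  | succ n ih =>
    intro P Q hPQ hP hQ
    obtain ⟨p, hp⟩ := Finset.card_pos.1 (by omega : 0 < P.card)
    obtain ⟨q, hq⟩ := Finset.card_pos.1 (by omega : 0 < Q.card)
    have hpQ : p ∉ Q := Finset.disjoint_left.1 hPQ hp
    have hqP : q ∉ P := Finset.disjoint_right.1 hPQ hq
    obtain ⟨l, hnd, hmem, hch, hh, hl⟩ := ih (P.erase p) (Q.erase q)
      (hPQ.mono (Finset.erase_subset _ _) (Finset.erase_subset _ _))
      (by rw [Finset.card_erase_of_mem hp]; omega) (by rw [Finset.card_erase_of_mem hq]; omega)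
    refine ⟨p :: q :: l, ?_, ?_, ?_, ?_, ?_⟩
    · rw [List.nodup_cons, List.nodup_cons, List.mem_cons, hmem, hmem]
      refine ⟨?_, ?_, hnd⟩ <;> grind
    · intro x
      rw [List.mem_cons, List.mem_cons, hmem]
      grind
    · rw [List.isChain_cons, List.isChain_cons]
      refine ⟨?_, ?_, hch.imp ?_⟩
      · intro y hy
        cases hy
        exact Or.inl ⟨hp, hq⟩
      · intro y hy
        exact Or.inr ⟨hq, Finset.mem_of_mem_erase (hh y hy)⟩
      · intro x y hxy
        grind
    · intro x hx
      cases hx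
      exact hp
    · intro x hx
      rcases l.eq_nil_or_concat with rfl | ⟨l', z, rfl⟩
      · cases hx
        exact hq
      · refine Finset.mem_of_mem_erase (hl x ?_)
        simpa [List.getLast?_cons] using hx

end

open scoped Classical in
/-- The theorem of Moon and Moser: the Ore condition for balanced bipartite graphs. -/
theorem hasSpanningCycle_of_ore {V : Type*} [Finite V] {X : Finset V} {s : V → Bool} {n : ℕ}
    (hn : 2 ≤ n)
    (hA : (X.filter (s · = true)).card = n) (hB : (X.filter (s · = false)).card = n)
    (H : SimpleGraph V) (hs : ∀ x y, H.Adj x y → s x ≠ s y)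
    (hdeg : ∀ a ∈ X, ∀ b ∈ X, s a = true → s b = false → ¬ H.Adj a b →
      n < (X.filter (H.Adj a)).card + (X.filter (H.Adj b)).card) :
    HasSpanningCycle H X := by
  have hdisj : Disjoint (X.filter (s · = true)) (X.filter (s · = false)) := by
    rw [Finset.disjoint_left]
    intro x hx hx'
    simp_all
  have hunion : X.filter (s · = true) ∪ X.filter (s · = false) = X := by
    ext x
    cases h : s x <;> simp [h]
  have hcard : X.card = n + n := by
    rw [← hunion, Finset.card_union_of_disjoint hdisj, hA, hB]
  induction H using WellFoundedGT.induction with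
  | ind H ih =>
  by_cases hcomp : ∀ a ∈ X, ∀ b ∈ X, s a = true → s b = false → H.Adj a b
  · obtain ⟨l, hnd, hmem, hch, hh, hl⟩ := exists_alternating_list n _ _ hdisj hA hB
    refine ⟨l, hnd, fun x => by rw [hmem, hunion], hch.imp ?_, ?_⟩
    · intro x y hxy
      simp only [Finset.mem_filter] at hxy
      rcases hxy with ⟨hx, hy⟩ | ⟨hx, hy⟩
      · exact hcomp _ hx.1 _ hy.1 hx.2 hy.2
      · exact (hcomp _ hy.1 _ hx.1 hy.2 hx.2).symm
    · intro x hx y hy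
      have h1 := Finset.mem_filter.1 (hl x hx)
      have h2 := Finset.mem_filter.1 (hh y hy)
      exact (hcomp _ h2.1 _ h1.1 h2.2 h1.2).symm
  · push Not at hcomp
    obtain ⟨a, ha, b, hb, hsa, hsb, hab⟩ := hcomp
    have hne : a ≠ b := by
      rintro rfl
      simp_all
    have hle : H ≤ H ⊔ SimpleGraph.edge a b := le_sup_left
    have hcyc : HasSpanningCycle (H ⊔ SimpleGraph.edge a b) X := by
      refine ih _ (H.lt_sup_edge _ _ hne hab) ?_ ?_
      · intro x y hxy
        rw [SimpleGraph.sup_adj, SimpleGraph.edge_adj] at hxy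
        rcases hxy with h | ⟨⟨rfl, rfl⟩ | ⟨rfl, rfl⟩, -⟩
        · exact hs _ _ h
        · simp [hsa, hsb]
        · simp [hsa, hsb]
      · intro x hx y hy hsx hsy hxy
        refine (hdeg x hx y hy hsx hsy fun h => hxy (hle h)).trans_le ?_
        refine Nat.add_le_add (Finset.card_le_card ?_) (Finset.card_le_card ?_) <;>
        · intro z hz
          simp only [Finset.mem_filter] at hz ⊢
          exact ⟨hz.1, hle hz.2⟩
    rcases hcyc.of_sup_edge ha (by omega) with h | ⟨l, hnd, hmem, hch, hhead, hlast⟩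
    · exact h
    · exact hasSpanningCycle_of_path hs hsa hsb (hA.symm ▸ hdeg a ha b hb hsa hsb hab)
        hnd hmem hch hhead hlast

open scoped Classical in
/-- If all vertices of different sides and different colours are adjacent and no colour class is
too large, then a balanced bipartite graph is Hamiltonian. -/
theorem hasSpanningCycle_of_colouring {V C : Type*} [Finite V] {X : Finset V} {s : V → Bool}
    {c : V → C} {n : ℕ} (hn : 2 ≤ n)
    (hA : (X.filter (s · = true)).card = n) (hB : (X.filter (s · = false)).card = n)
    (H : SimpleGraph V) (hs : ∀ x y, H.Adj x y → s x ≠ s y)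
    (hc : ∀ x y, s x ≠ s y → c x ≠ c y → H.Adj x y)
    (hsmall : ∀ i, (X.filter (c · = i)).card < n) : HasSpanningCycle H X := by
  refine hasSpanningCycle_of_ore hn hA hB H hs ?_
  intro a ha b hb hsa hsb hab
  have hcab : c a = c b := by
    by_contra h
    exact hab (hc _ _ (by simp [hsa, hsb]) h)
  have key : ∀ t : Bool, ∀ v, s v = !t → c v = c a →
      (X.filter (s · = t)).card ≤
        (X.filter (H.Adj v)).card + ((X.filter (c · = c a)).filter (s · = t)).card := by
    intro t v hv hcv
    refine (Finset.card_le_card ?_).trans (Finset.card_union_le _ _)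
    intro x hx
    simp only [Finset.mem_union, Finset.mem_filter] at hx ⊢
    by_cases h : c x = c a
    · exact Or.inr ⟨⟨hx.1, h⟩, hx.2⟩
    · refine Or.inl ⟨hx.1, hc _ _ ?_ ?_⟩
      · rw [hv, hx.2]
        cases t <;> simp
      · rw [hcv]
        exact Ne.symm h
  have h1 := key false a (by simp [hsa]) rfl
  have h2 := key true b (by simp [hsb]) hcab.symm
  have h3 := Finset.card_filter_add_card_filter_not (s := X.filter (c · = c a)) (s · = true)
  simp only [Bool.not_eq_true] at h3
  have h4 := hsmall (c a)
  omega

open scoped Classical in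
/-- In a balanced bipartitioned set, one vertex of either side can be removed so that every
colour class of size at least `n` loses a vertex. -/
theorem exists_balanced_erase {V C : Type*} {X : Finset V} {s : V → Bool} {c : V → C} {n : ℕ}
    (hn : 3 ≤ n)
    (hA : (X.filter (s · = true)).card = n + 1) (hB : (X.filter (s · = false)).card = n + 1) :
    ∃ a ∈ X, ∃ b ∈ X, s a = true ∧ s b = false ∧
      ∀ i, n ≤ (X.filter (c · = i)).card → c a = i ∨ c b = i := by
  have hcard : X.card = (n + 1) + (n + 1) := by
    have := Finset.card_filter_add_card_filter_not (s := X) (s · = true)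
    simp only [Bool.not_eq_true] at this
    omega
  have hpick : ∀ t : Bool, ∃ x ∈ X, s x = t := by
    intro t
    have : 0 < (X.filter (s · = t)).card := by
      cases t <;> omega
    obtain ⟨x, hx⟩ := Finset.card_pos.1 this
    exact ⟨x, (Finset.mem_filter.1 hx).1, (Finset.mem_filter.1 hx).2⟩
  have hdisj : ∀ i j, i ≠ j → Disjoint (X.filter (c · = i)) (X.filter (c · = j)) := by
    intro i j hij
    rw [Finset.disjoint_left]
    intro x hx hx'
    rw [Finset.mem_filter] at hx hx'
    exact hij (hx.2.symm.trans hx'.2)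
  by_cases h1 : ∃ i, n ≤ (X.filter (c · = i)).card
  swap
  · obtain ⟨a, ha, hsa⟩ := hpick true
    obtain ⟨b, hb, hsb⟩ := hpick false
    exact ⟨a, ha, b, hb, hsa, hsb, fun i hi => (h1 ⟨i, hi⟩).elim⟩
  obtain ⟨i, hi⟩ := h1
  by_cases h2 : ∃ j, j ≠ i ∧ n ≤ (X.filter (c · = j)).card
  swap
  · obtain ⟨x, hx⟩ := Finset.card_pos.1 (by omega : 0 < (X.filter (c · = i)).card)
    rw [Finset.mem_filter] at hx
    have honly : ∀ j, n ≤ (X.filter (c · = j)).card → j = i := by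
      intro j hj
      by_contra hji
      exact h2 ⟨j, hji, hj⟩
    obtain ⟨y, hy, hsy⟩ := hpick (!s x)
    cases hsx : s x
    · exact ⟨y, hy, x, hx.1, by simpa [hsx] using hsy, hsx,
        fun j hj => Or.inr (hx.2.trans (honly j hj).symm)⟩
    · exact ⟨x, hx.1, y, hy, hsx, by simpa [hsx] using hsy,
        fun j hj => Or.inl (hx.2.trans (honly j hj).symm)⟩
  obtain ⟨j, hji, hj⟩ := h2
  have honly : ∀ k, n ≤ (X.filter (c · = k)).card → k = i ∨ k = j := by
    intro k hk
    by_contra! hne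
    have hd : Disjoint (X.filter (c · = i) ∪ X.filter (c · = j)) (X.filter (c · = k)) :=
      Finset.disjoint_union_left.2 ⟨hdisj _ _ hne.1.symm, hdisj _ _ hne.2.symm⟩
    have hsub : X.filter (c · = i) ∪ X.filter (c · = j) ∪ X.filter (c · = k) ⊆ X := by
      intro x hx
      simp only [Finset.mem_union, Finset.mem_filter] at hx
      tauto
    have := Finset.card_le_card hsub
    rw [Finset.card_union_of_disjoint hd, Finset.card_union_of_disjoint (hdisj _ _ hji.symm)] at this
    omega
  have hmiss : ∀ t : Bool, (∃ x ∈ X, s x = t ∧ c x = i) ∨ ∃ x ∈ X, s x = t ∧ c x = j := by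
    intro t
    by_contra! hno
    have hsub : X.filter (c · = i) ∪ X.filter (c · = j) ⊆ X.filter (s · = !t) := by
      intro x hx
      simp only [Finset.mem_union, Finset.mem_filter] at hx ⊢
      have hxX : x ∈ X := by tauto
      refine ⟨hxX, ?_⟩
      have h3 := hno.1 x hxX
      have h4 := hno.2 x hxX
      cases t <;> cases h5 : s x <;> simp_all
    have := Finset.card_le_card hsub
    rw [Finset.card_union_of_disjoint (hdisj _ _ hji.symm)] at this
    cases t <;> simp only [Bool.not_true, Bool.not_false] at this <;> omega
  have hside : ∀ k, n ≤ (X.filter (c · = k)).card →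
      (∃ x ∈ X, s x = true ∧ c x = k) ∨ ∃ x ∈ X, s x = false ∧ c x = k := by
    intro k hk
    obtain ⟨x, hx⟩ := Finset.card_pos.1 (by omega : 0 < (X.filter (c · = k)).card)
    rw [Finset.mem_filter] at hx
    cases hsx : s x
    · exact Or.inr ⟨x, hx.1, hsx, hx.2⟩
    · exact Or.inl ⟨x, hx.1, hsx, hx.2⟩
  have hfin : ((∃ x ∈ X, s x = true ∧ c x = i) ∧ ∃ x ∈ X, s x = false ∧ c x = j) ∨
      ((∃ x ∈ X, s x = true ∧ c x = j) ∧ ∃ x ∈ X, s x = false ∧ c x = i) := by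
    have h1 := hmiss true
    have h2 := hmiss false
    have h3 := hside i hi
    have h4 := hside j hj
    clear * - h1 h2 h3 h4
    generalize (∃ x ∈ X, s x = true ∧ c x = i) = p1 at *
    generalize (∃ x ∈ X, s x = true ∧ c x = j) = p2 at *
    generalize (∃ x ∈ X, s x = false ∧ c x = i) = p3 at *
    generalize (∃ x ∈ X, s x = false ∧ c x = j) = p4 at *
    tauto
  rcases hfin with ⟨⟨a, ha, hsa, hca⟩, b, hb, hsb, hcb⟩ | ⟨⟨a, ha, hsa, hca⟩, b, hb, hsb, hcb⟩
  · refine ⟨a, ha, b, hb, hsa, hsb, fun k hk => ?_⟩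
    rcases honly k hk with rfl | rfl
    · exact Or.inl hca
    · exact Or.inr hcb
  · refine ⟨a, ha, b, hb, hsa, hsb, fun k hk => ?_⟩
    rcases honly k hk with rfl | rfl
    · exact Or.inr hcb
    · exact Or.inl hca

open scoped Classical in
/-- A balanced bipartitioned set whose colour classes are smaller than its sides contains such
sets of every smaller size at least three. -/
theorem exists_balanced_subset {V C : Type*} {s : V → Bool} {c : V → C} {m n : ℕ} (hm : 3 ≤ m)
    (hmn : m ≤ n) : ∀ X : Finset V, (X.filter (s · = true)).card = n →
      (X.filter (s · = false)).card = n → (∀ i, (X.filter (c · = i)).card < n) →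
      ∃ Y : Finset V, (Y.filter (s · = true)).card = m ∧ (Y.filter (s · = false)).card = m ∧
        ∀ i, (Y.filter (c · = i)).card < m := by
  induction n, hmn using Nat.le_induction with
  | base => exact fun X hA hB hX => ⟨X, hA, hB, hX⟩
  | succ n hmn ih =>
    intro X hA hB hX
    obtain ⟨a, ha, b, hb, hsa, hsb, hab⟩ := exists_balanced_erase (c := c) (by omega) hA hB
    refine ih ((X.erase a).erase b) ?_ ?_ ?_
    · rw [Finset.filter_erase, Finset.filter_erase, Finset.erase_eq_of_notMem (by simp [hsb]),
        Finset.card_erase_of_mem (by simp [ha, hsa]), hA]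
      rfl
    · rw [Finset.filter_erase, Finset.filter_erase,
        Finset.erase_eq_of_notMem (a := a) (by simp [hsa]),
        Finset.card_erase_of_mem (by simp [hb, hsb]), hB]
      rfl
    · intro i
      by_cases hi : n ≤ (X.filter (c · = i)).card
      · refine lt_of_lt_of_le (Finset.card_lt_card (t := X.filter (c · = i)) ?_)
          (Nat.lt_succ_iff.1 (hX i))
        rw [Finset.ssubset_iff_of_subset]
        · rcases hab i hi with h | h
          · exact ⟨a, by simp [ha, h], by simp⟩
          · exact ⟨b, by simp [hb, h], by simp⟩
        · exact Finset.filter_subset_filter _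
            ((Finset.erase_subset _ _).trans (Finset.erase_subset _ _))
      · refine lt_of_le_of_lt (Finset.card_le_card ?_) (not_le.1 hi)
        exact Finset.filter_subset_filter _
          ((Finset.erase_subset _ _).trans (Finset.erase_subset _ _))

/-- If a red/blue coloring of `K_{M,M}` (parts `A`, `B` of size `M ≥ m ≥ 4`) has no red
`C_{2m}`, then some connected component of the blue graph has at least `M` vertices
(i.e. its parts `A₁ ⊆ A`, `B₁ ⊆ B` satisfy `|A₁| + |B₁| ≥ M`). -/
theorem blue_component_large (M m : ℕ) (hm : 4 ≤ m) (hMm : m ≤ M)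
    (red : SimpleGraph (Fin M ⊕ Fin M))
    (hred : red ≤ completeBipartiteGraph (Fin M) (Fin M))
    (hnored : ¬ hasCycleLength red (2 * m)) :
    ∃ c : (completeBipartiteGraph (Fin M) (Fin M) \ red).ConnectedComponent,
      M ≤ Set.ncard
        {v | (completeBipartiteGraph (Fin M) (Fin M) \ red).connectedComponentMk v = c} := by
  classical
  by_contra! hsmall
  apply hnored
  set blue := completeBipartiteGraph (Fin M) (Fin M) \ red with hblue
  have hside : ∀ x y : Fin M ⊕ Fin M,
      (completeBipartiteGraph (Fin M) (Fin M)).Adj x y ↔ x.isLeft ≠ y.isLeft := by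
    rintro (x | x) (y | y) <;> simp
  have hA : (Finset.univ.filter fun x : Fin M ⊕ Fin M => x.isLeft = true).card = M := by
    rw [← Fintype.card_subtype, Fintype.card_congr Equiv.sumIsLeft]
    simp
  have hB : (Finset.univ.filter fun x : Fin M ⊕ Fin M => x.isLeft = false).card = M := by
    have := Finset.card_filter_add_card_filter_not
      (s := (Finset.univ : Finset (Fin M ⊕ Fin M))) (fun x => x.isLeft = true)
    simp only [Bool.not_eq_true, Finset.card_univ, Fintype.card_sum, Fintype.card_fin] at this
    omega
  obtain ⟨Y, hYA, hYB, hY⟩ := exists_balanced_subset (s := Sum.isLeft)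
    (c := blue.connectedComponentMk) (by omega) hMm Finset.univ (by convert hA) (by convert hB)
    (by
      intro i
      refine lt_of_eq_of_lt ?_ (hsmall i)
      rw [← Set.ncard_coe_finset]
      simp)
  have hYc : Y.card = 2 * m := by
    have := Finset.card_filter_add_card_filter_not (s := Y) (fun x => x.isLeft = true)
    simp only [Bool.not_eq_true] at this
    omega
  rw [← hYc]
  refine (hasSpanningCycle_of_colouring (by omega) hYA hYB red
    (fun x y h => (hside x y).1 (hred h)) ?_ hY).hasCycleLength (by omega)
  intro x y hxy hc
  by_contra hr
  refine hc (SimpleGraph.ConnectedComponent.eq.2 (SimpleGraph.Adj.reachable ?_))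
  rw [hblue, SimpleGraph.sdiff_adj]
  exact ⟨(hside x y).2 hxy, hr⟩
end

section
/- Let G(A,B) and H(C,D) be bipartite graphs on pairwise disjoint vertex sets A, B, C, D inside a common graph, such that every vertex of A has at least |B|−1 ≥ 3 neighbors in B and every vertex of C has at least |D|−1 ≥ 3 neighbors in D. If there are two disjoint edges between A and C, then the union graph contains cycles of every even length from 6 to min{2|A|, 2|B|} + min{2|C|, 2|D|} − 2. -/
theorem exists_forall_ne_imp_of_card_sub_one_le {V : Type*} (B : Finset V) (P : V → Prop)
    (hB : B.Nonempty) (h : B.card - 1 ≤ Set.ncard {b | b ∈ B ∧ P b}) :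
    ∃ z, ∀ b ∈ B, b ≠ z → P b := by
  classical
  have hset : {b | b ∈ B ∧ P b} = ((B.filter P : Finset V) : Set V) := by
    ext; simp
  rw [hset, Set.ncard_coe_finset] at h
  have hsum := Finset.card_filter_add_card_filter_not (s := B) P
  have hle : (B.filter (fun b => ¬ P b)).card ≤ 1 := by omega
  obtain ⟨b₀, hb₀⟩ := hB
  rcases (B.filter (fun b => ¬ P b)).eq_empty_or_nonempty with he | ⟨z, hz⟩
  · refine ⟨b₀, fun b hb _ => ?_⟩
    by_contra hP
    have : b ∈ B.filter (fun b => ¬ P b) := by simp [hb, hP]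
    simp [he] at this
  · refine ⟨z, fun b hb hne => ?_⟩
    by_contra hP
    exact hne (Finset.card_le_one.1 hle b (by simp [hb, hP]) z hz)

/-- An injective enumeration of `m + 1` elements of `A` with prescribed first and last element. -/
theorem exists_injOn_enumeration {V : Type*} [DecidableEq V] (A : Finset V) {a a' : V}
    (ha : a ∈ A) (ha' : a' ∈ A) (hne : a ≠ a') {m : ℕ} (hm : 1 ≤ m) (hmA : m + 1 ≤ A.card) :
    ∃ s : ℕ → V, Set.InjOn s (Set.Iic m) ∧ (∀ i ≤ m, s i ∈ A) ∧ s 0 = a ∧ s m = a' := by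
  have hcard : Fintype.card (Fin (m + 1)) ≤ Fintype.card A := by simpa using hmA
  obtain ⟨e⟩ := Function.Embedding.nonempty_of_card_le hcard
  let g : ℕ → V := fun i => e (Fin.ofNat (m + 1) i)
  have hgA : ∀ i, g i ∈ A := fun i => (e _).2
  have hginj : Set.InjOn g (Set.Iic m) := by
    intro i hi j hj hij
    have h := e.injective (Subtype.ext hij)
    have h' := congrArg Fin.val h
    simp only [Set.mem_Iic] at hi hj
    simpa [Fin.ofNat, Nat.mod_eq_of_lt (Nat.lt_succ_of_le hi),
      Nat.mod_eq_of_lt (Nat.lt_succ_of_le hj)] using h'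
  have hswap : ∀ {x y z : V}, x ∈ A → y ∈ A → z ∈ A → Equiv.swap x y z ∈ A := by
    intro x y z hx hy hz
    rw [Equiv.swap_apply_def]
    split_ifs <;> assumption
  let t : ℕ → V := fun i => Equiv.swap (g 0) a (g i)
  have htA : ∀ i, t i ∈ A := fun i => hswap (hgA 0) ha (hgA i)
  have ht0 : t 0 = a := Equiv.swap_apply_left _ _
  have htinj : Set.InjOn t (Set.Iic m) := fun i hi j hj hij =>
    hginj hi hj ((Equiv.swap (g 0) a).injective hij)
  refine ⟨fun i => Equiv.swap (t m) a' (t i), fun i hi j hj hij =>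
    htinj hi hj ((Equiv.swap (t m) a').injective hij),
    fun i _ => hswap (htA m) ha' (htA i), ?_, Equiv.swap_apply_left _ _⟩
  have htm : a ≠ t m := by
    rw [← ht0]
    intro h
    have := htinj (by simp) (by simp) h
    omega
  simp only [ht0]
  exact Equiv.swap_apply_of_ne_of_ne htm hne

/-- Distinct representatives in `B` avoiding two consecutive forbidden values each. -/
theorem exists_injOn_avoiding_consecutive {V : Type*} [DecidableEq V] (B : Finset V) (f : ℕ → V)
    {m : ℕ} (hm : m + 1 ≤ B.card)
    (h : m + 2 ≤ B.card ∨ (2 ≤ m ∧ f 0 ≠ f 2) ∨ f 0 = f 1) :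
    ∃ b : ℕ → V, Set.InjOn b (Set.Iio m) ∧
      ∀ i < m, b i ∈ B ∧ b i ≠ f i ∧ b i ≠ f (i + 1) := by
  let t : Fin m → Finset V := fun i => (B.erase (f i)).erase (f (i + 1))
  have ht : ∀ i, B.card - 2 ≤ (t i).card := by
    intro i
    have h1 := Finset.pred_card_le_card_erase (s := B) (a := f i)
    have h2 := Finset.pred_card_le_card_erase (s := B.erase (f i)) (a := f (i + 1))
    simp only [t]
    omega
  have hall : ∀ S : Finset (Fin m), S.card ≤ (S.biUnion t).card := by
    intro S
    rcases S.eq_empty_or_nonempty with rfl | ⟨i, hi⟩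
    · simp
    have hSm : S.card ≤ m := by simpa using S.card_le_univ
    have hti := (ht i).trans (Finset.card_le_card (Finset.subset_biUnion_of_mem t hi))
    by_cases hlt : S.card ≤ B.card - 2
    · exact hlt.trans hti
    have hS : S = Finset.univ := by
      rw [← Finset.card_eq_iff_eq_univ, Fintype.card_fin]
      omega
    subst hS
    have hpos : 0 < m := i.pos
    suffices hx : B.erase (f 1) ⊆ Finset.univ.biUnion t by
      have h1 := Finset.pred_card_le_card_erase (s := B) (a := f 1)
      have h2 := Finset.card_le_card hx
      omega
    intro x hx
    rw [Finset.mem_erase] at hx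
    rw [Finset.mem_biUnion]
    by_cases hx0 : x = f 0
    · rcases h with h | ⟨h2, h02⟩ | h01
      · omega
      · exact ⟨⟨1, h2⟩, Finset.mem_univ _, by simp [t, hx.1, hx.2, hx0 ▸ h02]⟩
      · exact absurd (hx0.trans h01) hx.1
    · exact ⟨⟨0, hpos⟩, Finset.mem_univ _, by simp [t, hx.1, hx.2, hx0]⟩
  obtain ⟨b, hbinj, hb⟩ := (Finset.all_card_le_biUnion_card_iff_exists_injective t).1 hall
  refine ⟨fun i => if hi : i < m then b ⟨i, hi⟩ else f 0, ?_, ?_⟩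
  · intro i hi j hj hij
    simp only [Set.mem_Iio] at hi hj
    simp only [hi, hj, dif_pos] at hij
    simpa using hbinj hij
  · intro i hi
    have := hb ⟨i, hi⟩
    simp only [t, Finset.mem_erase] at this
    simp only [hi, dif_pos]
    exact ⟨this.2.2, this.2.1, this.1⟩

theorem exists_path_of_alternating {V : Type*} (K : SimpleGraph V) (s b : ℕ → V) (m : ℕ)
    (hs : Set.InjOn s (Set.Iic m)) (hb : Set.InjOn b (Set.Iio m))
    (hsb : ∀ i ≤ m, ∀ j < m, s i ≠ b j)
    (hadj : ∀ i < m, K.Adj (s i) (b i) ∧ K.Adj (b i) (s (i + 1))) :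
    ∃ p : K.Walk (s 0) (s m), p.IsPath ∧ p.length = 2 * m ∧
      ∀ x ∈ p.support, (∃ i ≤ m, x = s i) ∨ ∃ i < m, x = b i := by
  induction m with
  | zero => exact ⟨.nil, by simp, by simp, by simp⟩
  | succ m ih =>
    obtain ⟨p, hp, hlen, hsup⟩ := ih (hs.mono (Set.Iic_subset_Iic.2 (by omega)))
      (hb.mono (Set.Iio_subset_Iio (by omega)))
      (fun i hi j hj => hsb i (by omega) j (by omega)) (fun i hi => hadj i (by omega))
    have hbm : b m ∉ p.support := by
      intro hmem
      rcases hsup _ hmem with ⟨i, hi, h⟩ | ⟨i, hi, h⟩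
      · exact hsb i (by omega) m (by omega) h.symm
      · have := hb (by simp) (by simp; omega) h
        omega
    have hsm : s (m + 1) ∉ p.support := by
      intro hmem
      rcases hsup _ hmem with ⟨i, hi, h⟩ | ⟨i, hi, h⟩
      · have := hs (by simp) (by simp; omega) h
        omega
      · exact hsb _ (by omega) i (by omega) h
    obtain ⟨h1, h2⟩ := hadj m (by omega)
    refine ⟨(p.concat h1).concat h2, ?_, ?_, ?_⟩
    · refine (hp.concat hbm h1).concat ?_ h2
      simp [SimpleGraph.Walk.support_concat, hsm, hsb (m + 1) le_rfl m (by omega)]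
    · simp [SimpleGraph.Walk.length_concat, hlen]; omega
    · intro x hx
      simp only [SimpleGraph.Walk.support_concat, List.mem_append,
        List.mem_singleton] at hx
      rcases hx with (hx | hx) | hx
      · rcases hsup x hx with ⟨i, hi, h⟩ | ⟨i, hi, h⟩
        · exact .inl ⟨i, by omega, h⟩
        · exact .inr ⟨i, by omega, h⟩
      · exact .inr ⟨m, by omega, hx⟩
      · exact .inl ⟨m + 1, le_rfl, hx⟩

theorem exists_path_of_bipartite_almost_complete {V : Type*} [DecidableEq V]
    (K : SimpleGraph V) (A B : Finset V) (hAB : Disjoint A B) (hB : 4 ≤ B.card)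
    (hK : ∀ a ∈ A, ∃ z, ∀ b ∈ B, b ≠ z → K.Adj a b)
    {a a' : V} (ha : a ∈ A) (ha' : a' ∈ A) (hne : a ≠ a')
    {m : ℕ} (hm : 1 ≤ m) (hmA : m + 1 ≤ A.card) (hmB : m + 1 ≤ B.card) :
    ∃ p : K.Walk a a', p.IsPath ∧ p.length = 2 * m ∧ ∀ x ∈ p.support, x ∈ A ∨ x ∈ B := by
  choose! z hz using hK
  obtain ⟨s, hs, hsA, rfl, rfl⟩ :
      ∃ s : ℕ → V, Set.InjOn s (Set.Iic m) ∧ (∀ i ≤ m, s i ∈ A) ∧ s 0 = a ∧ s m = a' :=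
    exists_injOn_enumeration A ha ha' hne hm hmA
  obtain ⟨r, hr, hrA, hr0, hrm, hcond⟩ : ∃ r : ℕ → V, Set.InjOn r (Set.Iic m) ∧
      (∀ i ≤ m, r i ∈ A) ∧ r 0 = s 0 ∧ r m = s m ∧
      (m + 2 ≤ B.card ∨ (2 ≤ m ∧ z (r 0) ≠ z (r 2)) ∨ z (r 0) = z (r 1)) := by
    by_cases hlt : m + 2 ≤ B.card
    · exact ⟨s, hs, hsA, rfl, rfl, .inl hlt⟩
    by_cases h02 : z (s 0) = z (s 2)
    · have hσ : ∀ i ≤ m, Equiv.swap 1 2 i ≤ m := by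
        intro i hi
        rw [Equiv.swap_apply_def]
        split_ifs <;> omega
      refine ⟨fun i => s (Equiv.swap 1 2 i), ?_, fun i hi => hsA _ (hσ i hi), ?_, ?_, ?_⟩
      · intro i hi j hj hij
        exact (Equiv.swap 1 2).injective (hs (hσ i hi) (hσ j hj) hij)
      · simp only [Equiv.swap_apply_of_ne_of_ne (show 0 ≠ 1 by omega) (show 0 ≠ 2 by omega)]
      · simp only [Equiv.swap_apply_of_ne_of_ne (show m ≠ 1 by omega) (show m ≠ 2 by omega)]
      · refine .inr (.inr ?_)
        simpa only [Equiv.swap_apply_of_ne_of_ne (show 0 ≠ 1 by omega) (show 0 ≠ 2 by omega),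
          Equiv.swap_apply_left] using h02
    · exact ⟨s, hs, hsA, rfl, rfl, .inr (.inl ⟨by omega, h02⟩)⟩
  obtain ⟨b, hb, hbB⟩ := exists_injOn_avoiding_consecutive B (fun i => z (r i)) hmB hcond
  obtain ⟨p, hp, hlen, hsup⟩ := exists_path_of_alternating K r b m hr hb
    (fun i hi j hj => Finset.disjoint_iff_ne.1 hAB _ (hrA i hi) _ (hbB j hj).1)
    (fun i hi => ⟨hz _ (hrA i (by omega)) _ (hbB i hi).1 (hbB i hi).2.1,
      (hz _ (hrA (i + 1) (by omega)) _ (hbB i hi).1 (hbB i hi).2.2).symm⟩)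
  refine ⟨p.copy hr0 hrm, by simpa using hp, by simpa using hlen, fun x hx => ?_⟩
  rw [SimpleGraph.Walk.support_copy] at hx
  rcases hsup x hx with ⟨i, hi, rfl⟩ | ⟨i, hi, rfl⟩
  · exact .inl (hrA i hi)
  · exact .inr (hbB i hi).1

/-- Two disjoint paths joined by two edges at their ends form a cycle. -/
theorem hasCycleLength_of_disjoint_paths {V : Type*} (K : SimpleGraph V) {a a' c c' : V}
    (p : K.Walk a a') (q : K.Walk c c') (hp : p.IsPath) (hq : q.IsPath)
    (hdisj : p.support.Disjoint q.support) (hne : a ≠ a')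
    (h : K.Adj a c) (h' : K.Adj a' c') :
    hasCycleLength K (p.length + q.length + 2) := by
  have ha : a ∉ q.support := fun hx => hdisj p.start_mem_support hx
  have hc : c ∉ p.support := fun hx => hdisj hx q.start_mem_support
  refine ⟨c, .cons h.symm (p.append (.cons h' q.reverse)), ?_, ?_⟩
  · rw [SimpleGraph.Walk.cons_isCycle_iff]
    constructor
    · rw [SimpleGraph.Walk.isPath_def, SimpleGraph.Walk.support_append]
      simpa [List.nodup_append', hp.support_nodup, hq.support_nodup] using hdisj
    · rw [SimpleGraph.Walk.edges_append, SimpleGraph.Walk.edges_cons, List.mem_append,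
        List.mem_cons]
      rintro (hx | hx | hx)
      · exact hc (p.fst_mem_support_of_mem_edges hx)
      · rcases Sym2.eq_iff.1 hx with ⟨h1, _⟩ | ⟨_, h1⟩
        · exact hc (h1 ▸ p.end_mem_support)
        · exact hne h1
      · exact ha (by simpa using q.reverse.snd_mem_support_of_mem_edges hx)
  · simp; omega

/-- Let `A, B, C, D` be pairwise disjoint vertex sets with every vertex of `A` having
at least `|B| - 1 ≥ 3` neighbors in `B` and every vertex of `C` having at least
`|D| - 1 ≥ 3` neighbors in `D`. If there are two disjoint edges between `A` and `C`,
then the graph consisting of the edges between `A` and `B`, between `C` and `D`, and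
between `A` and `C` contains cycles of every even length from `6` to
`min(2|A|, 2|B|) + min(2|C|, 2|D|) - 2`. -/
theorem cycles_from_two_dense_bipartite_graphs {V : Type*} [DecidableEq V]
    (G : SimpleGraph V) (A B C D : Finset V)
    (hAB : Disjoint A B) (hAC : Disjoint A C) (hAD : Disjoint A D)
    (hBC : Disjoint B C) (hBD : Disjoint B D) (hCD : Disjoint C D)
    (hBcard : 4 ≤ B.card) (hDcard : 4 ≤ D.card)
    (hdegA : ∀ a ∈ A, B.card - 1 ≤ Set.ncard {b | b ∈ B ∧ G.Adj a b})
    (hdegC : ∀ c ∈ C, D.card - 1 ≤ Set.ncard {d | d ∈ D ∧ G.Adj c d})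
    (he : ∃ a ∈ A, ∃ a' ∈ A, ∃ c ∈ C, ∃ c' ∈ C,
      a ≠ a' ∧ c ≠ c' ∧ G.Adj a c ∧ G.Adj a' c') :
    ∀ l : ℕ, Even l → 6 ≤ l →
      l ≤ min (2 * A.card) (2 * B.card) + min (2 * C.card) (2 * D.card) - 2 →
      hasCycleLength
        (SimpleGraph.fromRel (fun u v => G.Adj u v ∧
          ((u ∈ A ∧ v ∈ B) ∨ (u ∈ C ∧ v ∈ D) ∨ (u ∈ A ∧ v ∈ C)))) l := by
  intro l hl hl6 hlmax
  obtain ⟨a, ha, a', ha', c, hc, c', hc', hne, hne', hac, hac'⟩ := he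
  set K := SimpleGraph.fromRel (fun u v => G.Adj u v ∧
    ((u ∈ A ∧ v ∈ B) ∨ (u ∈ C ∧ v ∈ D) ∨ (u ∈ A ∧ v ∈ C)))
  have hKA : ∀ x ∈ A, ∃ z, ∀ y ∈ B, y ≠ z → K.Adj x y := by
    intro x hx
    obtain ⟨z, hz⟩ := exists_forall_ne_imp_of_card_sub_one_le B (G.Adj x)
      (Finset.card_pos.1 (by omega)) (hdegA x hx)
    exact ⟨z, fun y hy hyz => ⟨(hz y hy hyz).ne, .inl ⟨hz y hy hyz, .inl ⟨hx, hy⟩⟩⟩⟩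
  have hKC : ∀ x ∈ C, ∃ z, ∀ y ∈ D, y ≠ z → K.Adj x y := by
    intro x hx
    obtain ⟨z, hz⟩ := exists_forall_ne_imp_of_card_sub_one_le D (G.Adj x)
      (Finset.card_pos.1 (by omega)) (hdegC x hx)
    exact ⟨z, fun y hy hyz => ⟨(hz y hy hyz).ne, .inl ⟨hz y hy hyz, .inr (.inl ⟨hx, hy⟩)⟩⟩⟩
  have hA2 : 2 ≤ A.card := Finset.one_lt_card.2 ⟨a, ha, a', ha', hne⟩
  have hC2 : 2 ≤ C.card := Finset.one_lt_card.2 ⟨c, hc, c', hc', hne'⟩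
  obtain ⟨m, n, hm, hn, hmA, hmB, hnC, hnD, rfl⟩ : ∃ m n : ℕ, 1 ≤ m ∧ 1 ≤ n ∧
      m + 1 ≤ A.card ∧ m + 1 ≤ B.card ∧ n + 1 ≤ C.card ∧ n + 1 ≤ D.card ∧
      2 * m + 2 * n + 2 = l := by
    obtain ⟨k, rfl⟩ := hl
    refine ⟨min (k - 2) (min A.card B.card - 1), k - 1 - min (k - 2) (min A.card B.card - 1), ?_⟩
    omega
  obtain ⟨p, hp, hplen, hpsup⟩ :=
    exists_path_of_bipartite_almost_complete K A B hAB hBcard hKA ha ha' hne hm hmA hmB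
  obtain ⟨q, hq, hqlen, hqsup⟩ :=
    exists_path_of_bipartite_almost_complete K C D hCD hDcard hKC hc hc' hne' hn hnC hnD
  rw [← hplen, ← hqlen]
  refine hasCycleLength_of_disjoint_paths K p q hp hq ?_ hne
    ⟨hac.ne, .inl ⟨hac, .inr (.inr ⟨ha, hc⟩)⟩⟩ ⟨hac'.ne, .inl ⟨hac', .inr (.inr ⟨ha', hc'⟩)⟩⟩
  intro x hxp hxq
  rw [Finset.disjoint_left] at hAC hAD hBC hBD
  rcases hpsup x hxp with hx | hx <;> rcases hqsup x hxq with hy | hy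
  · exact hAC hx hy
  · exact hAD hx hy
  · exact hBC hx hy
  · exact hBD hx hy
end
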